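/- Suppose f is an integer-valued arithmetic function with f(n) ≠ 0 for all n > 1, and suppose there are functions a(m), b(m) on the positive integers, nonzero for m > 1, such that f(mP) = P·a(m) + b(m) for every positive integer m and every prime P not dividing m. Suppose further there is a constant c > 0 such that |f(n)| ≤ n^c, |a(m)| ≤ m^c, and |b(m)| ≤ m^c for all n, m > 1. For real x, set y = (log x)², z = x^{1/log₃ x}, and 𝒫_x = {primes p : y < p ≤ z}; say m is d-compatible if for every prime p | d, either p divides both a(m) and b(m) or p divides neither, and say m is d-ideal if gcd(d, a(m)·b(m)) = 1. Assume: (i) Σ_{p ≤ y} Σ_{m ≤ x, p | a(m) and p | b(m)} 1/m = o((√(log log x) / log₄ x)·log x) as x → ∞; and (ii) for each fixed positive integer k, Σ_d Σ_m gcd(d, a(m))/(m·d) ≤ (log log x)^{O(1)}, where d ranges over squarefree integers with all prime factors in 𝒫_x and at most k prime factors, and m ranges over 1 < m < x that are d-compatible but not d-ideal. Then for each fixed real u, (1/x)·#{n : 1 < n ≤ x and ω(|f(n)|) − log log x ≤ u·√(log log x)} → (1/√(2π)) ∫_{−∞}^{u} e^{−t²/2} dt as x → ∞. -/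

import Mathlib

open Filter

section Probability
open MeasureTheory ProbabilityTheory

/-- The uniform distribution of the values of `g` on the finite set `s`. -/
noncomputable def empiricalMeasure (s : Finset ℕ) (g : ℕ → ℝ) : Measure ℝ :=
  ∑ n ∈ s, (s.card : ENNReal)⁻¹ • Measure.dirac (g n)

lemma isProbabilityMeasure_empiricalMeasure {s : Finset ℕ} (hs : s.Nonempty) (g : ℕ → ℝ) :
    IsProbabilityMeasure (empiricalMeasure s g) := by
  constructor
  simp only [empiricalMeasure, Measure.coe_finsetSum, Finset.sum_apply, Measure.smul_apply,
    measure_univ, smul_eq_mul, mul_one, Finset.sum_const, nsmul_eq_mul]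
  exact ENNReal.mul_inv_cancel (by exact_mod_cast hs.card_pos.ne') (ENNReal.natCast_ne_top _)

lemma charFun_empiricalMeasure (s : Finset ℕ) (g : ℕ → ℝ) (t : ℝ) :
    charFun (empiricalMeasure s g) t =
      (∑ n ∈ s, Complex.exp (t * g n * Complex.I)) / s.card := by
  rcases s.eq_empty_or_nonempty with rfl | hs
  · simp [empiricalMeasure, charFun]
  rw [charFun_apply_real, empiricalMeasure, integral_finsetSum_measure]
  · simp [integral_smul_measure, div_eq_inv_mul, Finset.mul_sum]
  · intro n _
    refine Integrable.smul_measure ?_ (by simp [hs.ne_empty])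
    exact integrable_dirac (by simp)

open scoped Classical in
lemma real_empiricalMeasure_Iic (s : Finset ℕ) (g : ℕ → ℝ) (u : ℝ) :
    (empiricalMeasure s g).real (Set.Iic u) = ((s.filter (fun n => g n ≤ u)).card : ℝ) / s.card := by
  rcases s.eq_empty_or_nonempty with rfl | hs
  · simp [empiricalMeasure]
  rw [Measure.real, empiricalMeasure]
  simp only [Measure.coe_finsetSum, Finset.sum_apply, Measure.smul_apply, smul_eq_mul]
  rw [ENNReal.toReal_sum]
  · simp only [ENNReal.toReal_mul, ENNReal.toReal_inv, ENNReal.toReal_natCast]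
    rw [← Finset.mul_sum, Finset.card_filter]
    push_cast
    rw [div_eq_inv_mul]
    congr 1
    refine Finset.sum_congr rfl fun n _ => ?_
    by_cases h : g n ≤ u <;> simp [Measure.dirac_apply', h]
  · intro n _
    refine ENNReal.mul_ne_top (by simp [hs.ne_empty]) (measure_ne_top _ _)

lemma gaussianReal_zero_one_Iic (u : ℝ) :
    (gaussianReal 0 1).real (Set.Iic u) =
      (Real.sqrt (2 * Real.pi))⁻¹ * ∫ t in Set.Iic u, Real.exp (-t ^ 2 / 2) := by
  rw [Measure.real, gaussianReal_apply_eq_integral _ (by norm_num), ENNReal.toReal_ofReal]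
  · rw [← integral_const_mul]
    simp [gaussianPDFReal]
  · exact integral_nonneg fun x => gaussianPDFReal_nonneg _ _ _

/-- Lévy's continuity theorem for the empirical distributions of arithmetic data. -/
lemma tendsto_card_le_of_tendsto_charSum (G : ℝ → ℕ → ℝ)
    (h : ∀ t : ℝ, Tendsto (fun x : ℝ =>
      (∑ n ∈ Finset.Icc 2 ⌊x⌋₊, Complex.exp (t * G x n * Complex.I)) / (x : ℂ)) atTop
      (nhds (Complex.exp (-(t : ℂ) ^ 2 / 2)))) (u : ℝ) :
    Tendsto (fun x : ℝ => (((Finset.Icc 2 ⌊x⌋₊).filter (fun n => G x n ≤ u)).card : ℝ) / x) atTop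
      (nhds ((Real.sqrt (2 * Real.pi))⁻¹ * ∫ t in Set.Iic u, Real.exp (-t ^ 2 / 2))) := by
  classical
  have hcard : Tendsto (fun x : ℝ => ((Finset.Icc 2 ⌊x⌋₊).card : ℝ) / x) atTop (nhds 1) := by
    have h1 : Tendsto (fun x : ℝ => (⌊x⌋₊ : ℝ) / x - 1 / x) atTop (nhds (1 - 0)) :=
      (tendsto_nat_floor_div_atTop (R := ℝ)).sub (tendsto_const_nhds.div_atTop tendsto_id)
    rw [sub_zero] at h1
    refine h1.congr' ?_
    filter_upwards [eventually_ge_atTop 2] with x hx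
    have : 2 ≤ ⌊x⌋₊ := Nat.le_floor hx
    rw [Nat.card_Icc, ← sub_div]
    congr 1
    rw [show ⌊x⌋₊ + 1 - 2 = ⌊x⌋₊ - 1 by omega, Nat.cast_sub (by omega)]
    simp
  refine tendsto_of_seq_tendsto fun xs hxs => ?_
  let γ : ProbabilityMeasure ℝ := ⟨gaussianReal 0 1, inferInstance⟩
  let μ : ℕ → ProbabilityMeasure ℝ := fun j =>
    if hj : (Finset.Icc 2 ⌊xs j⌋₊).Nonempty then
      ⟨empiricalMeasure _ (G (xs j)), isProbabilityMeasure_empiricalMeasure hj _⟩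
    else γ
  have hne : ∀ᶠ j in atTop, (Finset.Icc 2 ⌊xs j⌋₊).Nonempty := by
    filter_upwards [hxs.eventually_ge_atTop 2] with j hj
    exact Finset.nonempty_Icc.2 (Nat.le_floor hj)
  have hμ : ∀ᶠ j in atTop, (μ j : Measure ℝ) = empiricalMeasure (Finset.Icc 2 ⌊xs j⌋₊) (G (xs j)) := by
    filter_upwards [hne] with j hj
    simp [μ, hj]
  have hlim : Tendsto μ atTop (nhds γ) := by
    refine ProbabilityMeasure.tendsto_of_tendsto_charFun fun t => ?_
    have h2 := ((h t).comp hxs).div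
      ((Complex.continuous_ofReal.tendsto 1).comp (hcard.comp hxs)) (by simp)
    simp only [γ, ProbabilityMeasure.coe_mk, charFun_gaussianReal]
    have e : Complex.exp (t * ((0 : ℝ) : ℂ) * Complex.I - ((1 : NNReal) : ℝ) * (t : ℂ) ^ 2 / 2)
        = Complex.exp (-(t : ℂ) ^ 2 / 2) / ((1 : ℝ) : ℂ) := by
      simp [neg_div]
    rw [e]
    refine h2.congr' ?_
    filter_upwards [hμ, hxs.eventually_ge_atTop 2, hne] with j hj hj2 hj3
    rw [hj, charFun_empiricalMeasure]
    have hx0 : ((xs j : ℝ) : ℂ) ≠ 0 := by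
      exact_mod_cast (by linarith : (0:ℝ) < xs j).ne'
    have hc0 : ((Finset.Icc 2 ⌊xs j⌋₊).card : ℂ) ≠ 0 := by
      exact_mod_cast hj3.card_pos.ne'
    simp only [Pi.div_apply, Function.comp_apply, Complex.ofReal_div, Complex.ofReal_natCast]
    generalize ∑ n ∈ Finset.Icc 2 ⌊xs j⌋₊, Complex.exp (t * G (xs j) n * Complex.I) = E
    field_simp
  have hfr := ProbabilityMeasure.tendsto_measure_of_null_frontier_of_tendsto' hlim
    (E := Set.Iic u) (by
      have := nullSingletonClass_gaussianReal (μ := 0) (v := 1) (by norm_num)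
      change gaussianReal 0 1 (frontier (Set.Iic u)) = 0
      simp)
  have hfr2 := (ENNReal.tendsto_toReal (measure_ne_top (γ : Measure ℝ) _)).comp hfr
  have h3 := hfr2.mul (hcard.comp hxs)
  rw [mul_one] at h3
  rw [← gaussianReal_zero_one_Iic]
  refine h3.congr' ?_
  filter_upwards [hμ, hxs.eventually_ge_atTop 2, hne] with j hj hj2 hj3
  have := real_empiricalMeasure_Iic (Finset.Icc 2 ⌊xs j⌋₊) (G (xs j)) u
  rw [Measure.real] at this
  simp only [Function.comp_apply, hj]
  rw [this]
  have hc0 : ((Finset.Icc 2 ⌊xs j⌋₊).card : ℝ) ≠ 0 := by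
    exact_mod_cast hj3.card_pos.ne'
  have hx0 : xs j ≠ 0 := by linarith
  field_simp

end Probability

section Mertens
open Finset

lemma sum_factorization_factorial_mul_log (n : ℕ) :
    Real.log (n.factorial) =
      ∑ p ∈ (range (n + 1)).filter Nat.Prime, (n.factorial.factorization p : ℝ) * Real.log p := by
  have h := Nat.prod_factorization_pow_eq_self n.factorial_ne_zero
  rw [Finsupp.prod_of_support_subset (s := (range (n + 1)).filter Nat.Prime)] at h
  · have h' : ((n.factorial : ℕ) : ℝ) =
        ∏ p ∈ (range (n + 1)).filter Nat.Prime, (p : ℝ) ^ (n.factorial.factorization p) := by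
      conv_lhs => rw [← h]
      push_cast
      rfl
    rw [h', Real.log_prod]
    · simp
    · intro p hp
      have := (mem_filter.1 hp).2.pos
      positivity
  · intro p hp
    simp only [Nat.support_factorization, Nat.mem_primeFactors] at hp
    simp only [mem_filter, mem_range]
    exact ⟨Nat.lt_succ_of_le ((hp.1.dvd_factorial).1 hp.2.1), hp.1⟩
  · simp

lemma exists_sum_log_div_mul_le :
    ∃ C : ℝ, 0 ≤ C ∧ ∀ s : Finset ℕ, ∑ n ∈ s, Real.log n / (n * (n - 1)) ≤ C := by
  have hs : Summable fun n : ℕ => 4 * (1 / (n : ℝ) ^ (3 / 2 : ℝ)) :=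
    (Real.summable_one_div_nat_rpow.2 (by norm_num)).mul_left 4
  have hle : ∀ n : ℕ, Real.log n / (n * (n - 1)) ≤ 4 * (1 / (n : ℝ) ^ (3 / 2 : ℝ)) := by
    intro n
    rcases Nat.lt_or_ge n 2 with h | h
    · interval_cases n <;> simp
    have h2 : (2 : ℝ) ≤ n := by exact_mod_cast h
    have hlog : Real.log n ≤ 2 * (n : ℝ) ^ (1 / 2 : ℝ) := by
      have := Real.log_le_rpow_div (x := (n : ℝ)) (by positivity) (ε := 1 / 2) (by norm_num)
      linarith
    have e : (n : ℝ) ^ (2 : ℝ) = (n : ℝ) ^ (3 / 2 : ℝ) * (n : ℝ) ^ (1 / 2 : ℝ) := by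
      rw [← Real.rpow_add (by positivity)]; norm_num
    rw [Real.rpow_two] at e
    have hp1 : 0 < (n : ℝ) ^ (3 / 2 : ℝ) := by positivity
    have hp2 : 0 < (n : ℝ) ^ (1 / 2 : ℝ) := by positivity
    rw [mul_one_div, div_le_div_iff₀ (by nlinarith) hp1]
    nlinarith [mul_le_mul_of_nonneg_right hlog hp1.le]
  refine ⟨∑' n : ℕ, 4 * (1 / (n : ℝ) ^ (3 / 2 : ℝ)), tsum_nonneg fun n => by positivity, fun s => ?_⟩
  exact (sum_le_sum fun n _ => hle n).trans (hs.sum_le_tsum s fun n _ => by positivity)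

/-- **Mertens' first theorem.** -/
lemma exists_abs_sum_log_div_sub_log_le : ∃ C : ℝ, ∀ n : ℕ, 1 ≤ n →
    |∑ p ∈ (range (n + 1)).filter Nat.Prime, Real.log p / p - Real.log n| ≤ C := by
  obtain ⟨C, hC0, hC⟩ := exists_sum_log_div_mul_le
  refine ⟨C + 1 + Real.log 4, fun n hn => ?_⟩
  have hn0 : (0 : ℝ) < n := by exact_mod_cast hn
  have hfac := sum_factorization_factorial_mul_log n
  have hl4 : 0 < Real.log 4 := Real.log_pos (by norm_num)
  rw [abs_le]
  constructor
  · have h1 : (n : ℝ) * Real.log n - n ≤ Real.log n.factorial := by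
      have := Stirling.le_log_factorial_stirling (n := n) (by omega)
      have h3 : 0 ≤ Real.log n := Real.log_nonneg (by exact_mod_cast hn)
      have h4 : 0 ≤ Real.log (2 * Real.pi) := Real.log_nonneg (by nlinarith [Real.pi_gt_three])
      linarith
    have h2 : Real.log n.factorial ≤
        ∑ p ∈ (range (n + 1)).filter Nat.Prime,
          n * (Real.log p / p + Real.log p / (p * (p - 1))) := by
      rw [hfac]
      refine sum_le_sum fun p hp => ?_
      have hp' := (mem_filter.1 hp).2
      have hp2 : (2 : ℝ) ≤ p := by exact_mod_cast hp'.two_le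
      have h5 := Nat.sub_one_mul_factorization_factorial (n := n) hp'
      have h6 : (p - 1) * n.factorial.factorization p ≤ n := by rw [h5]; omega
      have h7 : ((p : ℝ) - 1) * n.factorial.factorization p ≤ n := by
        have := (Nat.cast_le (α := ℝ)).2 h6
        push_cast [hp'.one_le] at this
        exact this
      have h8 : (n.factorial.factorization p : ℝ) ≤ n / (p - 1) := by
        rw [le_div_iff₀ (by linarith)]; linarith
      have h9 : 0 ≤ Real.log p := Real.log_nonneg (by linarith)
      have h10 : (n : ℝ) * (Real.log p / p + Real.log p / (p * (p - 1))) = n / (p - 1) * Real.log p := by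
        have : (p : ℝ) - 1 ≠ 0 := by linarith
        field_simp
        ring
      rw [h10]
      exact mul_le_mul_of_nonneg_right h8 h9
    rw [← mul_sum, sum_add_distrib] at h2
    have h3 := hC ((range (n + 1)).filter Nat.Prime)
    have h4 : (n : ℝ) * (Real.log n - 1) ≤
      n * (∑ p ∈ (range (n + 1)).filter Nat.Prime, Real.log p / p + C) := by
      refine le_trans (by linarith) (h1.trans (h2.trans ?_))
      gcongr
    have := le_of_mul_le_mul_left h4 hn0
    linarith
  · have h1 : Real.log n.factorial ≤ n * Real.log n := by
      rw [← Real.log_pow]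
      refine Real.log_le_log (by exact_mod_cast n.factorial_pos) ?_
      exact_mod_cast Nat.factorial_le_pow n
    have h2 : ∑ p ∈ (range (n + 1)).filter Nat.Prime, ((n : ℝ) * (Real.log p / p) - Real.log p) ≤
        Real.log n.factorial := by
      rw [hfac]
      refine sum_le_sum fun p hp => ?_
      have hp' := (mem_filter.1 hp).2
      have hpn : p ≤ n := Nat.lt_succ_iff.1 (mem_range.1 (mem_filter.1 hp).1)
      have hp2 : (2 : ℝ) ≤ p := by exact_mod_cast hp'.two_le
      have h5 : n / p ≤ n.factorial.factorization p := by
        have h6 := Nat.factorization_factorial (n := n) (b := Nat.log p n + 1) hp' (Nat.lt_succ_self _)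
        rw [h6]
        refine le_trans ?_ (single_le_sum (f := fun i => n / p ^ i) (fun _ _ => Nat.zero_le _)
          (mem_Ico.2 ⟨le_refl 1, ?_⟩))
        · simp
        · have := Nat.log_pos hp'.one_lt hpn
          omega
      have h7 : (n : ℝ) / p - 1 ≤ n.factorial.factorization p := by
        have h8 : (n : ℝ) / p < (n / p : ℕ) + 1 := by
          rw [div_lt_iff₀ (by linarith)]
          have := Nat.lt_div_mul_add (a := n) hp'.pos
          have h9 : n < (n / p + 1) * p := by linarith
          exact_mod_cast h9
        have : ((n / p : ℕ) : ℝ) ≤ n.factorial.factorization p := by exact_mod_cast h5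
        linarith
      have h9 : 0 ≤ Real.log p := Real.log_nonneg (by linarith)
      calc (n : ℝ) * (Real.log p / p) - Real.log p = (n / p - 1) * Real.log p := by ring
        _ ≤ _ := mul_le_mul_of_nonneg_right h7 h9
    rw [sum_sub_distrib, ← mul_sum] at h2
    have h3 : ∑ p ∈ (range (n + 1)).filter Nat.Prime, Real.log p ≤ Real.log 4 * n := by
      have h4 := Chebyshev.theta_le_log4_mul_x (x := (n : ℝ)) hn0.le
      refine le_trans (le_of_eq ?_) h4
      rw [Chebyshev.theta_eq_sum_Icc]
      simp only [Nat.floor_natCast]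
      refine sum_congr ?_ fun _ _ => rfl
      ext p
      simp
    have h4 : (n : ℝ) * (∑ p ∈ (range (n + 1)).filter Nat.Prime, Real.log p / p) ≤
        n * (Real.log n + Real.log 4) := by linarith
    have := le_of_mul_le_mul_left h4 hn0
    linarith

/-- **Mertens' second theorem** at integers. -/
lemma exists_abs_sum_inv_sub_log_log_le_nat : ∃ C : ℝ, ∀ n : ℕ, 2 ≤ n →
    |∑ p ∈ (range (n + 1)).filter Nat.Prime, (1 : ℝ) / p - Real.log (Real.log n)| ≤ C := by
  obtain ⟨C, hC⟩ := exists_abs_sum_log_div_sub_log_le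
  have hC0 : 0 ≤ C := (abs_nonneg _).trans (hC 1 le_rfl)
  set T : ℕ → ℝ := fun n => ∑ p ∈ (range (n + 1)).filter Nat.Prime, (1 : ℝ) / p with hT
  set E : ℕ → ℝ := fun n =>
    ∑ p ∈ (range (n + 1)).filter Nat.Prime, Real.log p / p - Real.log n with hE
  set F : ℕ → ℝ := fun n => T n - Real.log (Real.log n) - E n / Real.log n with hF
  have hlog2 : 0 < Real.log 2 := Real.log_pos (by norm_num)
  have key : ∀ n : ℕ, 2 ≤ n → |F n| ≤ |F 2| + (C + 1) * (1 / Real.log 2 - 1 / Real.log n) := by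
    intro n hn
    induction n, hn using Nat.le_induction with
    | base => simp
    | succ n hn ih =>
      have hn2 : (2 : ℝ) ≤ n := by exact_mod_cast hn
      have hln : 0 < Real.log n := Real.log_pos (by linarith)
      have hle : Real.log n ≤ Real.log ((n + 1 : ℕ) : ℝ) := by
        refine Real.log_le_log (by linarith) ?_
        push_cast; linarith
      have hln' : 0 < Real.log ((n + 1 : ℕ) : ℝ) := hln.trans_le hle
      set u := Real.log n with hu
      set v := Real.log ((n + 1 : ℕ) : ℝ) with hv
      have hTE : (T (n + 1) - T n) * v = E (n + 1) - E n + (v - u) := by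
        simp only [hT, hE]
        rw [range_add_one (n := n + 1), filter_insert]
        split_ifs with hp
        · rw [sum_insert (by simp), sum_insert (by simp)]
          simp only [hv]
          ring
        · ring
      have hdiff : F (n + 1) - F n = E n * (1 / u - 1 / v) + ((v - u) / v - (Real.log v - Real.log u)) := by
        have hTE' : T (n + 1) - T n = (E (n + 1) - E n + (v - u)) / v := by
          rw [← hTE]; field_simp
        have : F (n + 1) - F n = (T (n + 1) - T n) - (Real.log v - Real.log u) - E (n + 1) / v + E n / u := by
          simp only [hF]; ring
        rw [this, hTE']
        field_simp
        ring
      have h1 : Real.log v - Real.log u ≤ (v - u) / u := by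
        rw [← Real.log_div hln'.ne' hln.ne']
        refine (Real.log_le_sub_one_of_pos (by positivity)).trans (le_of_eq ?_)
        field_simp
      have h2 : (v - u) / v ≤ Real.log v - Real.log u := by
        rw [← Real.log_div hln'.ne' hln.ne']
        refine le_trans (le_of_eq ?_) (Real.one_sub_inv_le_log_of_pos (by positivity))
        field_simp
      have hvu1 : v - u ≤ 1 := by
        rw [hu, hv, ← Real.log_div (by positivity) (by positivity)]
        refine (Real.log_le_sub_one_of_pos (by positivity)).trans ?_
        rw [sub_le_iff_le_add, div_le_iff₀ (by positivity)]
        push_cast; linarith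
      have hinv : 0 ≤ 1 / u - 1 / v := sub_nonneg.2 (one_div_le_one_div_of_le hln hle)
      have h3 : (v - u) / u - (v - u) / v ≤ 1 / u - 1 / v := by
        have : (v - u) / u - (v - u) / v = (v - u) * (1 / u - 1 / v) := by ring
        rw [this]
        nlinarith
      have hEn : |E n| ≤ C := hC n (by omega)
      have h4 : |F (n + 1) - F n| ≤ (C + 1) * (1 / u - 1 / v) := by
        rw [hdiff]
        refine (abs_add_le _ _).trans ?_
        rw [abs_mul, abs_of_nonneg hinv]
        have : |(v - u) / v - (Real.log v - Real.log u)| ≤ 1 / u - 1 / v := by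
          rw [abs_le]; constructor <;> linarith
        nlinarith [mul_le_mul_of_nonneg_right hEn hinv]
      have h5 : |F (n + 1)| ≤ |F n| + |F (n + 1) - F n| := by
        have := abs_add_le (F n) (F (n + 1) - F n)
        simpa using this
      calc |F (n + 1)| ≤ _ := h5
        _ ≤ |F 2| + (C + 1) * (1 / Real.log 2 - 1 / u) + (C + 1) * (1 / u - 1 / v) := add_le_add ih h4
        _ = _ := by ring
  refine ⟨|F 2| + (C + 1) * (1 / Real.log 2) + C / Real.log 2, fun n hn => ?_⟩
  have hn2 : (2 : ℝ) ≤ n := by exact_mod_cast hn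
  have hll : Real.log 2 ≤ Real.log n := Real.log_le_log (by norm_num) hn2
  have hln : 0 < Real.log n := hlog2.trans_le hll
  have h1 : T n - Real.log (Real.log n) = F n + E n / Real.log n := by simp only [hF]; ring
  change |T n - Real.log (Real.log n)| ≤ _
  rw [h1]
  refine (abs_add_le _ _).trans (add_le_add ((key n hn).trans ?_) ?_)
  · have : 0 ≤ 1 / Real.log n := by positivity
    nlinarith
  · rw [abs_div, abs_of_pos hln]
    have hEn : |E n| ≤ C := hC n (by omega)
    gcongr

/-- **Mertens' second theorem.** -/
lemma exists_abs_sum_inv_sub_log_log_le : ∃ C : ℝ, 0 < C ∧ ∀ v : ℝ, 2 ≤ v →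
    |∑ p ∈ (range (⌊v⌋₊ + 1)).filter Nat.Prime, (1 : ℝ) / p - Real.log (Real.log v)| ≤ C := by
  obtain ⟨C, hC⟩ := exists_abs_sum_inv_sub_log_log_le_nat
  have hC0 : 0 ≤ C := (abs_nonneg _).trans (hC 2 le_rfl)
  have hlog2 : 0 < Real.log 2 := Real.log_pos (by norm_num)
  refine ⟨C + Real.log 2, by positivity, fun v hv => ?_⟩
  have hfl : 2 ≤ ⌊v⌋₊ := Nat.le_floor hv
  have h1 := hC _ hfl
  have hfl2 : (2 : ℝ) ≤ ⌊v⌋₊ := by exact_mod_cast hfl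
  have hle : (⌊v⌋₊ : ℝ) ≤ v := Nat.floor_le (by linarith)
  have hlt : v < ⌊v⌋₊ + 1 := Nat.lt_floor_add_one v
  have hl1 : 0 < Real.log ⌊v⌋₊ := Real.log_pos (by linarith)
  have hl2 : Real.log ⌊v⌋₊ ≤ Real.log v := Real.log_le_log (by linarith) hle
  have hl3 : Real.log v ≤ 2 * Real.log ⌊v⌋₊ := by
    have : Real.log v ≤ Real.log ((⌊v⌋₊ : ℝ) ^ 2) := Real.log_le_log (by linarith) (by nlinarith)
    rwa [Real.log_pow] at this
  have hl4 : Real.log (Real.log ⌊v⌋₊) ≤ Real.log (Real.log v) := Real.log_le_log hl1 hl2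
  have hl5 : Real.log (Real.log v) ≤ Real.log 2 + Real.log (Real.log ⌊v⌋₊) := by
    rw [← Real.log_mul (by norm_num) hl1.ne']
    exact Real.log_le_log (by linarith) hl3
  rw [abs_le] at h1 ⊢
  constructor <;> linarith [h1.1, h1.2]

end Mertens

section Periodic
open Finset Function

lemma sum_range_mul_of_coprime {p q : ℕ} (hpq : p.Coprime q) (hp : 0 < p) (hq : 0 < q) {F G : ℕ → ℝ}
    (hF : Periodic F p) (hG : Periodic G q) :
    ∑ n ∈ range (p * q), F n * G n = (∑ r ∈ range p, F r) * ∑ r ∈ range q, G r := by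
  rw [sum_mul_sum, ← sum_product']
  refine sum_bij' (fun n _ => (n % p, n % q)) (fun z _ => (Nat.chineseRemainder hpq z.1 z.2 : ℕ))
    ?_ ?_ ?_ ?_ ?_
  · intro n _
    simp [Nat.mod_lt _ hp, Nat.mod_lt _ hq]
  · intro z _
    simpa using Nat.chineseRemainder_lt_mul hpq z.1 z.2 hp.ne' hq.ne'
  · intro n hn
    have h := (Nat.chineseRemainder hpq (n % p) (n % q)).2
    have h1 : Nat.ModEq (p * q) (Nat.chineseRemainder hpq (n % p) (n % q) : ℕ) n :=
      (Nat.modEq_and_modEq_iff_modEq_mul hpq).1 ⟨h.1.trans (Nat.mod_modEq _ _), h.2.trans (Nat.mod_modEq _ _)⟩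
    exact h1.eq_of_lt_of_lt (Nat.chineseRemainder_lt_mul hpq _ _ hp.ne' hq.ne') (mem_range.1 hn)
  · intro z hz
    simp only [mem_product, mem_range] at hz
    have h := (Nat.chineseRemainder hpq z.1 z.2).2
    ext
    · exact Eq.trans h.1 (Nat.mod_eq_of_lt hz.1)
    · exact Eq.trans h.2 (Nat.mod_eq_of_lt hz.2)
  · intro n _
    simp [hF.map_mod_nat, hG.map_mod_nat]

lemma periodic_prod {U : Finset ℕ} {g : ℕ → ℕ → ℝ} (hg : ∀ p ∈ U, Periodic (g p) p) :
    Periodic (fun n => ∏ p ∈ U, g p n) (∏ p ∈ U, p) := by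
  intro n
  refine prod_congr rfl fun p hp => ?_
  obtain ⟨c, hc⟩ := dvd_prod_of_mem (fun p => p) hp
  replace hc : ∏ p ∈ U, p = p * c := hc
  rw [hc, mul_comm]
  exact (hg p hp).nat_mul c n

lemma sum_range_prod_of_periodic {U : Finset ℕ} (hU : ∀ p ∈ U, p.Prime) {g : ℕ → ℕ → ℝ}
    (hg : ∀ p ∈ U, Periodic (g p) p) :
    ∑ n ∈ range (∏ p ∈ U, p), ∏ p ∈ U, g p n = ∏ p ∈ U, ∑ r ∈ range p, g p r := by
  induction U using Finset.induction_on with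
  | empty => simp
  | insert p U hp ih =>
    have hU' : ∀ q ∈ U, q.Prime := fun q hq => hU q (mem_insert_of_mem hq)
    have hg' : ∀ q ∈ U, Periodic (g q) q := fun q hq => hg q (mem_insert_of_mem hq)
    have hpp := hU p (mem_insert_self _ _)
    have hcop : p.Coprime (∏ q ∈ U, q) := by
      refine Nat.Coprime.prod_right fun q hq => ?_
      refine (Nat.coprime_primes hpp (hU' q hq)).2 ?_
      rintro rfl; exact hp hq
    simp only [prod_insert hp]
    rw [sum_range_mul_of_coprime hcop hpp.pos (prod_pos fun q hq => (hU' q hq).pos)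
      (hg p (mem_insert_self _ _)) (periodic_prod hg'), ih hU' hg']

lemma sum_range_add_of_periodic {F : ℕ → ℝ} {d : ℕ} (hF : Periodic F d) (a : ℕ) :
    ∑ r ∈ range d, F (a + r) = ∑ r ∈ range d, F r := by
  induction a with
  | zero => simp
  | succ a ih =>
    rw [← ih]
    have h := sum_range_succ (fun r => F (a + r)) d
    rw [sum_range_succ'] at h
    have e : F (a + d) = F (a + 0) := by simpa using hF a
    rw [e] at h
    have := add_right_cancel h
    rw [← this]
    refine sum_congr rfl fun r _ => ?_
    congr 1; ring

lemma sum_range_eq_of_periodic {F : ℕ → ℝ} {d : ℕ} (hF : Periodic F d) (a N : ℕ) :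
    ∑ n ∈ range N, F (a + n) = (N / d : ℕ) * ∑ r ∈ range d, F r +
      ∑ r ∈ range (N % d), F (a + (N / d) * d + r) := by
  have h : ∀ q : ℕ, ∑ n ∈ range (q * d), F (a + n) = q * ∑ r ∈ range d, F r := by
    intro q
    induction q with
    | zero => simp
    | succ q ih =>
      rw [add_mul, one_mul, sum_range_add, ih]
      have := sum_range_add_of_periodic hF (a + q * d)
      simp only [← add_assoc, this]
      push_cast; ring
  conv_lhs => rw [← Nat.div_add_mod' N d]
  rw [sum_range_add, h]
  simp only [add_assoc]

lemma abs_sum_range_le_of_periodic {F : ℕ → ℝ} {d : ℕ} (hd : 0 < d) (hF : Periodic F d)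
    (h1 : ∀ n, |F n| ≤ 1) (a N : ℕ) :
    |∑ n ∈ range N, F (a + n)| ≤ N * (|∑ r ∈ range d, F r| / d) + d := by
  rw [sum_range_eq_of_periodic hF]
  refine (abs_add_le _ _).trans (add_le_add ?_ ?_)
  · rw [abs_mul, Nat.abs_cast, mul_div_assoc', le_div_iff₀ (by exact_mod_cast hd), mul_right_comm]
    refine mul_le_mul_of_nonneg_right ?_ (abs_nonneg _)
    exact_mod_cast Nat.div_mul_le_self N d
  · refine (abs_sum_le_sum_abs _ _).trans ((sum_le_sum fun n _ => h1 _).trans ?_)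
    simp only [sum_const, card_range, nsmul_eq_mul, mul_one]
    exact_mod_cast (Nat.mod_lt N hd).le

lemma sum_range_le_of_periodic_of_nonneg {F : ℕ → ℝ} {d : ℕ} (hd : 0 < d) (hF : Periodic F d)
    (h0 : ∀ n, 0 ≤ F n) (N : ℕ) :
    ∑ n ∈ range N, F n ≤ ((N : ℝ) / d + 1) * ∑ r ∈ range d, F r := by
  have hT : 0 ≤ ∑ r ∈ range d, F r := sum_nonneg fun _ _ => h0 _
  have h := sum_range_eq_of_periodic hF 0 N
  simp only [zero_add] at h
  rw [h, add_mul, one_mul]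
  refine add_le_add (mul_le_mul_of_nonneg_right Nat.cast_div_le hT) ?_
  have h2 : ∀ r, F (N / d * d + r) = F r := fun r => by
    rw [add_comm]; exact hF.nat_mul (N / d) r
  simp only [h2]
  exact sum_le_sum_of_subset_of_nonneg (range_subset_range.2 (Nat.mod_lt N hd).le) fun _ _ _ => h0 _

end Periodic

section LargeSieve
open Finset Function

variable {ι : Type*}

/-- An elementary large sieve inequality for families of locally balanced periodic functions. -/
lemma large_sieve_of_periodic (𝒟 : Finset (Finset ℕ)) (Ω : Finset ι) (D : ℝ)
    (hprime : ∀ U ∈ 𝒟, ∀ p ∈ U, p.Prime) (hD : ∀ U ∈ 𝒟, ((∏ p ∈ U, p : ℕ) : ℝ) ≤ D)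
    (ξ : ℕ → ι → ℕ → ℝ) (hper : ∀ p w, Periodic (ξ p w) p) (hbd : ∀ p w n, |ξ p w n| ≤ 1)
    (hsum : ∀ p, ∀ w ∈ Ω, p.Prime → ∑ r ∈ range p, ξ p w r = 0)
    (c : Finset ℕ → ℝ) (a N : ℕ) :
    ∑ n ∈ range N, (∑ U ∈ 𝒟, c U * ∑ w ∈ Ω, ∏ p ∈ U, ξ p w (a + n)) ^ 2 ≤
      N * ∑ U ∈ 𝒟, c U ^ 2 * ∑ w₁ ∈ Ω, ∑ w₂ ∈ Ω, ∏ p ∈ U, (|∑ r ∈ range p, ξ p w₁ r * ξ p w₂ r| / p)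
        + ((∑ U ∈ 𝒟, |c U|) * Ω.card * D) ^ 2 := by
  classical
  set I := 𝒟 ×ˢ Ω with hI
  have hsq : ∀ n, (∑ U ∈ 𝒟, c U * ∑ w ∈ Ω, ∏ p ∈ U, ξ p w (a + n)) ^ 2 =
      ∑ i ∈ I, ∑ j ∈ I, c i.1 * c j.1 *
        ((∏ p ∈ i.1, ξ p i.2 (a + n)) * ∏ p ∈ j.1, ξ p j.2 (a + n)) := by
    intro n
    have : ∑ U ∈ 𝒟, c U * ∑ w ∈ Ω, ∏ p ∈ U, ξ p w (a + n) =
        ∑ i ∈ I, c i.1 * ∏ p ∈ i.1, ξ p i.2 (a + n) := by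
      rw [hI, sum_product]
      simp only [mul_sum]
    rw [this, sq, sum_mul_sum]
    refine sum_congr rfl fun i _ => sum_congr rfl fun j _ => ?_
    ring
  simp only [hsq]
  rw [sum_comm]
  have hterm : ∀ i ∈ I, ∀ j ∈ I,
      |∑ n ∈ range N, (∏ p ∈ i.1, ξ p i.2 (a + n)) * ∏ p ∈ j.1, ξ p j.2 (a + n)| ≤
        N * (if i.1 = j.1 then ∏ p ∈ i.1, (|∑ r ∈ range p, ξ p i.2 r * ξ p j.2 r| / p) else 0)
          + D ^ 2 := by
    intro i hi j hj
    simp only [hI, mem_product] at hi hj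
    set V := i.1 ∪ j.1 with hV
    set g : ℕ → ℕ → ℝ := fun p n =>
      (if p ∈ i.1 then ξ p i.2 n else 1) * (if p ∈ j.1 then ξ p j.2 n else 1) with hg
    have hfg : ∀ n, (∏ p ∈ i.1, ξ p i.2 n) * ∏ p ∈ j.1, ξ p j.2 n = ∏ p ∈ V, g p n := by
      intro n
      rw [hg, prod_mul_distrib, prod_ite_mem, prod_ite_mem]
      congr 2
      · rw [hV, inter_eq_right.2 subset_union_left]
      · rw [hV, inter_eq_right.2 subset_union_right]
    have hVp : ∀ p ∈ V, p.Prime := by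
      intro p hp
      rcases mem_union.1 hp with h | h
      · exact hprime _ hi.1 p h
      · exact hprime _ hj.1 p h
    have hgper : ∀ p ∈ V, Periodic (g p) p := by
      intro p _ n
      simp only [hg]
      rw [hper p i.2 n, hper p j.2 n]
    have hg1 : ∀ p n, |g p n| ≤ 1 := by
      intro p n
      simp only [hg, abs_mul]
      refine mul_le_one₀ ?_ (abs_nonneg _) ?_ <;> split_ifs <;> simp [hbd]
    have hdpos : 0 < ∏ p ∈ V, p := prod_pos fun p hp => (hVp p hp).pos
    have h := abs_sum_range_le_of_periodic hdpos (periodic_prod hgper)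
      (fun n => by
        rw [abs_prod]
        exact prod_le_one (fun _ _ => abs_nonneg _) (fun p _ => hg1 p n)) a N
    rw [sum_range_prod_of_periodic hVp hgper, abs_prod] at h
    simp only [hfg]
    refine h.trans (add_le_add ?_ ?_)
    · refine mul_le_mul_of_nonneg_left ?_ (Nat.cast_nonneg _)
      split_ifs with hij
      · have hV' : V = i.1 := by rw [hV, ← hij, union_self]
        rw [hV', prod_div_distrib]
        push_cast
        refine le_of_eq ?_
        congr 1
        refine prod_congr rfl fun p hp => ?_
        simp only [hg, hp, if_true, ← hij]
      · have : ∃ p ∈ V, ∑ r ∈ range p, g p r = 0 := by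
          by_contra hcon
          push Not at hcon
          apply hij
          ext p
          constructor
          · intro hp
            by_contra hp'
            refine hcon p (mem_union_left _ hp) ?_
            simp only [hg, hp, hp', if_true, if_false, mul_one]
            exact hsum p _ hi.2 (hprime _ hi.1 p hp)
          · intro hp
            by_contra hp'
            refine hcon p (mem_union_right _ hp) ?_
            simp only [hg, hp, hp', if_true, if_false, one_mul]
            exact hsum p _ hj.2 (hprime _ hj.1 p hp)
        obtain ⟨p, hp, hp0⟩ := this
        rw [prod_eq_zero hp (by rw [hp0, abs_zero])]
        simp
    · have hle : (∏ p ∈ V, p) ≤ (∏ p ∈ i.1, p) * ∏ p ∈ j.1, p := by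
        rw [← prod_union_inter]
        refine Nat.le_mul_of_pos_right _ (prod_pos fun p hp => ?_)
        exact (hVp p (mem_union_left _ (mem_inter.1 hp).1)).pos
      have hle' : ((∏ p ∈ V, p : ℕ) : ℝ) ≤ (∏ p ∈ i.1, p : ℕ) * (∏ p ∈ j.1, p : ℕ) := by
        exact_mod_cast hle
      refine hle'.trans ?_
      rw [sq]
      exact mul_le_mul (hD _ hi.1) (hD _ hj.1) (Nat.cast_nonneg _)
        ((Nat.cast_nonneg _).trans (hD _ hi.1))
  calc ∑ i ∈ I, ∑ n ∈ range N, ∑ j ∈ I, c i.1 * c j.1 *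
        ((∏ p ∈ i.1, ξ p i.2 (a + n)) * ∏ p ∈ j.1, ξ p j.2 (a + n))
      = ∑ i ∈ I, ∑ j ∈ I, c i.1 * c j.1 *
        ∑ n ∈ range N, ((∏ p ∈ i.1, ξ p i.2 (a + n)) * ∏ p ∈ j.1, ξ p j.2 (a + n)) := by
        refine sum_congr rfl fun i _ => ?_
        rw [sum_comm]
        refine sum_congr rfl fun j _ => ?_
        rw [mul_sum]
    _ ≤ ∑ i ∈ I, ∑ j ∈ I, |c i.1| * |c j.1| *
        (N * (if i.1 = j.1 then ∏ p ∈ i.1, (|∑ r ∈ range p, ξ p i.2 r * ξ p j.2 r| / p) else 0)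
          + D ^ 2) := by
        refine sum_le_sum fun i hi => sum_le_sum fun j hj => ?_
        refine (le_abs_self _).trans ?_
        rw [abs_mul, abs_mul]
        exact mul_le_mul_of_nonneg_left (hterm i hi j hj) (by positivity)
    _ = _ := by
        simp only [mul_add, sum_add_distrib]
        congr 1
        · rw [hI]
          simp only [sum_product, mul_sum]
          refine sum_congr rfl fun U hU => ?_
          refine sum_congr rfl fun w₁ _ => ?_
          rw [sum_eq_single U]
          · refine sum_congr rfl fun w₂ _ => ?_
            rw [if_pos rfl, abs_mul_abs_self]
            ring
          · intro U' _ hne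
            exact sum_eq_zero fun w₂ _ => by rw [if_neg (Ne.symm hne)]; simp
          · intro h; exact absurd hU h
        · simp only [← sum_mul, ← mul_sum]
          have : ∑ i ∈ I, |c i.1| = (∑ U ∈ 𝒟, |c U|) * Ω.card := by
            rw [hI, sum_product]
            simp only [sum_const, nsmul_eq_mul, sum_mul, mul_comm (Ω.card : ℝ)]
          rw [this]
          ring

end LargeSieve

section Sieve
open Finset Function

lemma sum_le_sum_of_maps_injOn {α β : Type*} {s : Finset α} {t : Finset β}
    {f : α → ℝ} {g : β → ℝ} (φ : α → β) (hφ : ∀ i ∈ s, φ i ∈ t) (hinj : Set.InjOn φ s)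
    (hfg : ∀ i ∈ s, f i ≤ g (φ i)) (hg : ∀ j ∈ t, 0 ≤ g j) : ∑ i ∈ s, f i ≤ ∑ j ∈ t, g j := by
  classical
  calc ∑ i ∈ s, f i ≤ ∑ i ∈ s, g (φ i) := sum_le_sum hfg
    _ = ∑ j ∈ s.image φ, g j := (sum_image hinj).symm
    _ ≤ _ := sum_le_sum_of_subset_of_nonneg (image_subset_iff.2 hφ) fun j hj _ => hg j hj

lemma log_add_one_le_sum_inv (n : ℕ) : Real.log (n + 1) ≤ ∑ i ∈ Icc 1 n, (1 : ℝ) / i := by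
  have := log_add_one_le_harmonic n
  rw [harmonic_eq_sum_Icc] at this
  push_cast at this
  simpa only [one_div] using this

lemma sum_inv_le_one_add_log (n : ℕ) : ∑ i ∈ Icc 1 n, (1 : ℝ) / i ≤ 1 + Real.log n := by
  have := harmonic_le_one_add_log n
  rw [harmonic_eq_sum_Icc] at this
  push_cast at this
  simpa only [one_div] using this

lemma log_add_one_le_two_mul_sum_squarefree (D : ℕ) :
    Real.log (D + 1) ≤ 2 * ∑ d ∈ (Icc 1 D).filter Squarefree, (1 : ℝ) / d := by
  refine (log_add_one_le_sum_inv D).trans ?_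
  choose u v huv hu using Nat.sq_mul_squarefree
  calc ∑ i ∈ Icc 1 D, (1 : ℝ) / i
      ≤ ∑ z ∈ ((Icc 1 D).filter Squarefree) ×ˢ (Ioo 0 (D + 1)),
        (1 : ℝ) / z.1 * ((z.2 : ℝ) ^ 2)⁻¹ := by
        refine sum_le_sum_of_maps_injOn (fun n => (u n, v n)) ?_ ?_ ?_ ?_
        · intro n hn
          rw [mem_Icc] at hn
          have h := huv n
          have hu0 : u n ≠ 0 := by rintro h0; rw [h0] at h; omega
          have hv0 : v n ≠ 0 := by rintro h0; rw [h0] at h; simp at h; omega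
          have h1 : u n ≤ n := by
            calc u n ≤ v n ^ 2 * u n := Nat.le_mul_of_pos_left _ (Nat.pos_of_ne_zero (pow_ne_zero 2 hv0))
              _ = n := h
          have h2 : v n ≤ n := by
            calc v n ≤ v n ^ 2 := Nat.le_self_pow (by norm_num) _
              _ ≤ v n ^ 2 * u n := Nat.le_mul_of_pos_right _ (by omega)
              _ = n := h
          simp only [mem_product, mem_filter, mem_Icc, mem_Ioo]
          exact ⟨⟨⟨by omega, by omega⟩, hu n⟩, by omega, by omega⟩
        · intro n _ m _ hnm
          simp only [Prod.mk.injEq] at hnm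
          rw [← huv n, ← huv m, hnm.1, hnm.2]
        · intro n _
          refine le_of_eq ?_
          conv_lhs => rw [← huv n]
          push_cast
          rw [one_div, mul_inv, one_div, mul_comm]
        · intro z _; positivity
    _ = (∑ d ∈ (Icc 1 D).filter Squarefree, (1 : ℝ) / d) * ∑ k ∈ Ioo 0 (D + 1), ((k : ℝ) ^ 2)⁻¹ := by
        rw [sum_product, sum_mul_sum]
    _ ≤ (∑ d ∈ (Icc 1 D).filter Squarefree, (1 : ℝ) / d) * 2 := by
        refine mul_le_mul_of_nonneg_left ?_ (sum_nonneg fun _ _ => by positivity)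
        simpa using sum_Ioo_inv_sq_le (α := ℝ) 0 (D + 1)
    _ = _ := mul_comm _ _

/-- Squarefree integers up to `D` that are coprime to `q`. -/
def squarefreeCoprime (D q : ℕ) : Finset ℕ :=
  (Icc 1 D).filter fun d => Squarefree d ∧ d.Coprime q

lemma log_add_one_le_three_mul_sum_squarefreeCoprime (D : ℕ) {q : ℕ} (hq : q = 1 ∨ q.Prime) :
    Real.log (D + 1) ≤ 3 * ∑ d ∈ squarefreeCoprime D q, (1 : ℝ) / d := by
  have h := log_add_one_le_two_mul_sum_squarefree D
  have h0 : 0 ≤ ∑ d ∈ squarefreeCoprime D q, (1 : ℝ) / d := sum_nonneg fun _ _ => by positivity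
  rcases hq with rfl | hq
  · have : squarefreeCoprime D 1 = (Icc 1 D).filter Squarefree := by
      ext; simp [squarefreeCoprime]
    rw [this] at h0 ⊢
    linarith
  · have h1 : ∑ d ∈ ((Icc 1 D).filter Squarefree).filter (fun d => d.Coprime q), (1 : ℝ) / d =
        ∑ d ∈ squarefreeCoprime D q, (1 : ℝ) / d := by
      rw [filter_filter]; rfl
    have hq2 : (2 : ℝ) ≤ q := by exact_mod_cast hq.two_le
    have h2 : ∑ d ∈ ((Icc 1 D).filter Squarefree).filter (fun d => ¬ d.Coprime q), (1 : ℝ) / d ≤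
        ∑ d ∈ squarefreeCoprime D q, 1 / 2 * ((1 : ℝ) / d) := by
      refine sum_le_sum_of_maps_injOn (fun d => d / q) ?_ ?_ ?_ ?_
      · intro d hd
        simp only [mem_filter, mem_Icc] at hd
        have hqd : q ∣ d := by
          by_contra hn
          exact hd.2 (((Nat.Prime.coprime_iff_not_dvd hq).2 hn).symm)
        obtain ⟨e, rfl⟩ := hqd
        rw [Nat.mul_div_cancel_left e hq.pos]
        have hsq := hd.1.2
        have he0 : e ≠ 0 := by rintro rfl; simp at hd
        simp only [squarefreeCoprime, mem_filter, mem_Icc]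
        refine ⟨⟨by omega, ?_⟩, hsq.of_mul_right, ?_⟩
        · exact (Nat.le_mul_of_pos_left e hq.pos).trans hd.1.1.2
        · exact (Nat.coprime_of_squarefree_mul hsq).symm
      · intro d hd d' hd' hdd
        simp only [coe_filter, mem_filter, mem_Icc, Set.mem_ofPred_eq] at hd hd'
        have hqd : q ∣ d := by
          by_contra hn
          exact hd.2 (((Nat.Prime.coprime_iff_not_dvd hq).2 hn).symm)
        have hqd' : q ∣ d' := by
          by_contra hn
          exact hd'.2 (((Nat.Prime.coprime_iff_not_dvd hq).2 hn).symm)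
        rw [← Nat.div_mul_cancel hqd, ← Nat.div_mul_cancel hqd']
        simp only at hdd
        rw [hdd]
      · intro d hd
        simp only [mem_filter, mem_Icc] at hd
        have hqd : q ∣ d := by
          by_contra hn
          exact hd.2 (((Nat.Prime.coprime_iff_not_dvd hq).2 hn).symm)
        obtain ⟨e, rfl⟩ := hqd
        rw [Nat.mul_div_cancel_left e hq.pos]
        push_cast
        rw [one_div, mul_inv, one_div, one_div]
        gcongr
      · intro d _; positivity
    rw [← mul_sum] at h2
    rw [← sum_filter_add_sum_filter_not _ (fun d => Nat.Coprime d q), h1] at h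
    linarith

lemma card_mul_sum_le_of_sieve {D N : ℕ} (hD : 1 ≤ D) (hDN : D ^ 4 ≤ N) (κ : ℕ → ℕ → ℝ)
    (hper : ∀ p, Periodic (κ p) p) (h0 : ∀ p n, 0 ≤ κ p n) (h1 : ∀ p n, κ p n ≤ 1)
    (ρ : ℕ → ℝ) (hρ0 : ∀ p, 0 ≤ ρ p) (hρ : ∀ p, p.Prime → ρ p ≤ ∑ r ∈ range p, κ p r)
    (a : ℕ) (Z : Finset ℕ) (hZ : Z ⊆ range N)
    (hav : ∀ n ∈ Z, ∀ p, p.Prime → p ≤ D → κ p (a + n) = 0) :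
    (Z.card : ℝ) * ∑ d ∈ (Icc 1 D).filter Squarefree, ∏ p ∈ d.primeFactors, (ρ p / p) ≤ 2 * N := by
  classical
  set S := (Icc 1 D).filter Squarefree with hS
  set 𝒟 : Finset (Finset ℕ) := S.image Nat.primeFactors with h𝒟
  set σ : ℕ → ℝ := fun p => ∑ r ∈ range p, κ p r with hσ
  set G := ∑ U ∈ 𝒟, ∏ p ∈ U, (σ p / p) with hG
  have hinj : Set.InjOn Nat.primeFactors (S : Set ℕ) := by
    intro d hd e he hde
    simp only [hS, coe_filter, Set.mem_ofPred_eq] at hd he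
    rw [← Nat.prod_primeFactors_of_squarefree hd.2, ← Nat.prod_primeFactors_of_squarefree he.2, hde]
  have hσ0 : ∀ p, 0 ≤ σ p := fun p => sum_nonneg fun r _ => h0 p r
  have hσle : ∀ p, σ p ≤ p := fun p => by
    refine (sum_le_sum fun r _ => h1 p r).trans ?_
    simp
  have hGle : ∑ d ∈ S, ∏ p ∈ d.primeFactors, (ρ p / p) ≤ G := by
    rw [hG, h𝒟, sum_image hinj]
    refine sum_le_sum fun d _ => prod_le_prod (fun p _ => ?_) fun p hp => ?_
    · exact div_nonneg (hρ0 p) (Nat.cast_nonneg _)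
    · exact div_le_div_of_nonneg_right (hρ p (Nat.prime_of_mem_primeFactors hp)) (Nat.cast_nonneg _)
  have hprime : ∀ U ∈ 𝒟, ∀ p ∈ U, p.Prime := by
    intro U hU p hp
    obtain ⟨d, _, rfl⟩ := mem_image.1 hU
    exact Nat.prime_of_mem_primeFactors hp
  have hprodle : ∀ U ∈ 𝒟, ((∏ p ∈ U, p : ℕ) : ℝ) ≤ D := by
    intro U hU
    obtain ⟨d, hd, rfl⟩ := mem_image.1 hU
    simp only [hS, mem_filter, mem_Icc] at hd
    rw [Nat.prod_primeFactors_of_squarefree hd.2]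
    exact_mod_cast hd.1.2
  have hple : ∀ U ∈ 𝒟, ∀ p ∈ U, p ≤ D := by
    intro U hU p hp
    obtain ⟨d, hd, rfl⟩ := mem_image.1 hU
    simp only [hS, mem_filter, mem_Icc] at hd
    exact (Nat.le_of_mem_primeFactors hp).trans hd.1.2
  have hcard : (𝒟.card : ℝ) ≤ D := by
    have h2 : 𝒟.card ≤ D := card_image_le.trans ((card_filter_le _ _).trans (by simp))
    exact_mod_cast h2
  have hfrac : ∀ p, 0 ≤ σ p / p ∧ σ p / p ≤ 1 := fun p =>
    ⟨div_nonneg (hσ0 p) (Nat.cast_nonneg _), div_le_one_of_le₀ (hσle p) (Nat.cast_nonneg _)⟩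
  have hG1 : 1 ≤ G := by
    have hmem : (∅ : Finset ℕ) ∈ 𝒟 :=
      mem_image.2 ⟨1, by simp [hS, hD], by simp⟩
    calc (1 : ℝ) = ∏ p ∈ (∅ : Finset ℕ), (σ p / p) := by simp
      _ ≤ G := single_le_sum (f := fun U : Finset ℕ => ∏ p ∈ U, (σ p / p))
          (fun U _ => prod_nonneg fun p _ => (hfrac p).1) hmem
  have hls := large_sieve_of_periodic 𝒟 ({()} : Finset Unit) D hprime hprodle
    (fun p _ n => κ p n - σ p / p) (fun p _ n => by simp [hper p n])
    (fun p _ n => by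
      have := hfrac p
      rw [abs_le]; constructor <;> linarith [h0 p n, h1 p n])
    (fun p _ _ hp => by
      have : (p : ℝ) ≠ 0 := by exact_mod_cast hp.ne_zero
      simp only [sum_sub_distrib, sum_const, card_range, nsmul_eq_mul]
      rw [mul_div_cancel₀ _ this, sub_self])
    (fun U => (-1) ^ U.card) a N
  have hlow : (Z.card : ℝ) * G ^ 2 ≤ ∑ n ∈ range N,
      (∑ U ∈ 𝒟, (-1) ^ U.card * ∑ w ∈ ({()} : Finset Unit), ∏ p ∈ U, (κ p (a + n) - σ p / p)) ^ 2 := by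
    refine le_trans ?_ (sum_le_sum_of_subset_of_nonneg hZ fun _ _ _ => sq_nonneg _)
    rw [← nsmul_eq_mul, ← sum_const]
    refine le_of_eq (sum_congr rfl fun n hn => ?_)
    congr 1
    refine sum_congr rfl fun U hU => ?_
    rw [sum_singleton]
    rw [← prod_const, ← prod_mul_distrib]
    refine prod_congr rfl fun p hp => ?_
    rw [hav n hn p (hprime U hU p hp) (hple U hU p hp)]
    ring
  have hup1 : ∑ U ∈ 𝒟, ((-1 : ℝ) ^ U.card) ^ 2 * ∑ w₁ ∈ ({()} : Finset Unit), ∑ w₂ ∈ ({()} : Finset Unit),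
      ∏ p ∈ U, (|∑ r ∈ range p, (κ p r - σ p / p) * (κ p r - σ p / p)| / p) ≤ G := by
    refine sum_le_sum fun U hU => ?_
    have h7 : ((-1 : ℝ) ^ U.card) ^ 2 = 1 := by rw [← pow_mul, mul_comm, pow_mul]; simp
    rw [h7, one_mul, sum_singleton, sum_singleton]
    refine prod_le_prod (fun p _ => div_nonneg (abs_nonneg _) (Nat.cast_nonneg _)) fun p hp => ?_
    refine div_le_div_of_nonneg_right ?_ (Nat.cast_nonneg _)
    rw [abs_of_nonneg (sum_nonneg fun r _ => mul_self_nonneg _)]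
    have hp0 : (p : ℝ) ≠ 0 := by exact_mod_cast (hprime U hU p hp).ne_zero
    have e : ∑ r ∈ range p, (κ p r - σ p / p) * (κ p r - σ p / p) =
        ∑ r ∈ range p, κ p r * κ p r - σ p ^ 2 / p := by
      have : ∀ r, (κ p r - σ p / p) * (κ p r - σ p / p) =
        κ p r * κ p r - 2 * (σ p / p) * κ p r + (σ p / p) ^ 2 := fun r => by ring
      simp only [this, sum_add_distrib, sum_sub_distrib, ← mul_sum, sum_const, card_range, nsmul_eq_mul]
      change _ - 2 * (σ p / p) * σ p + _ = _
      field_simp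
      ring
    rw [e]
    have h3 : ∑ r ∈ range p, κ p r * κ p r ≤ σ p :=
      sum_le_sum fun r _ => mul_le_of_le_one_left (h0 p r) (h1 p r)
    have : 0 ≤ σ p ^ 2 / p := by positivity
    linarith
  have hup2 : ((∑ U ∈ 𝒟, |(-1 : ℝ) ^ U.card|) * ({()} : Finset Unit).card * D) ^ 2 ≤ N := by
    have h4 : ∑ U ∈ 𝒟, |(-1 : ℝ) ^ U.card| = 𝒟.card := by simp
    rw [h4]
    simp only [card_singleton, Nat.cast_one, mul_one]
    have h5 : (𝒟.card : ℝ) * D ≤ D * D := mul_le_mul_of_nonneg_right hcard (Nat.cast_nonneg _)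
    calc ((𝒟.card : ℝ) * D) ^ 2 ≤ (D * D) ^ 2 := pow_le_pow_left₀ (by positivity) h5 2
      _ = ((D ^ 4 : ℕ) : ℝ) := by push_cast; ring
      _ ≤ N := by exact_mod_cast hDN
  have hfin : (Z.card : ℝ) * G ^ 2 ≤ N * G + N :=
    hlow.trans (hls.trans (add_le_add (mul_le_mul_of_nonneg_left hup1 (Nat.cast_nonneg _)) hup2))
  have h6 : (Z.card : ℝ) * G ≤ 2 * N := by
    have hN : (0 : ℝ) ≤ N := Nat.cast_nonneg _
    have : (Z.card : ℝ) * G * G ≤ 2 * N * G := by nlinarith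
    exact le_of_mul_le_mul_right this (by linarith)
  exact (mul_le_mul_of_nonneg_left hGle (Nat.cast_nonneg _)).trans h6

end Sieve

section SieveBounds
open Finset Function

lemma exists_lt_dvd_add_mul {p q : ℕ} (hp : p.Prime) (hq : ¬ p ∣ q) (r : ℕ) :
    ∃ t < p, p ∣ r + q * t := by
  have := Fact.mk hp
  have hq0 : (q : ZMod p) ≠ 0 := by rwa [Ne, ZMod.natCast_eq_zero_iff]
  refine ⟨(-(r : ZMod p) / q).val, ZMod.val_lt _, ?_⟩
  rw [← ZMod.natCast_eq_zero_iff]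
  push_cast
  rw [ZMod.natCast_zmod_val]
  field_simp
  ring

/-- Brun–Titchmarsh type bound from the elementary sieve. -/
lemma card_primes_modEq_mul_log_le {D Y q : ℕ} (r : ℕ) (hq : q = 1 ∨ q.Prime) (hD : 1 ≤ D)
    (hDY : D ^ 4 ≤ Y / q) :
    (((Icc 1 Y).filter fun P => P.Prime ∧ D < P ∧ P % q = r).card : ℝ) * Real.log (D + 1) ≤
      12 * ((Y : ℝ) / q) := by
  set T := (Icc 1 Y).filter fun P => P.Prime ∧ D < P ∧ P % q = r with hT
  have hq0 : 0 < q := by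
    rcases hq with rfl | h
    · exact one_pos
    · exact h.pos
  set κ : ℕ → ℕ → ℝ := fun p t => if p ∣ r + q * t ∧ ¬ p ∣ q then 1 else 0 with hκ
  have hinj : Set.InjOn (fun P => P / q) (T : Set ℕ) := by
    intro P hP P' hP' h
    simp only [hT, coe_filter, Set.mem_ofPred_eq] at hP hP' h
    rw [← Nat.div_add_mod P q, ← Nat.div_add_mod P' q, h, hP.2.2.2, hP'.2.2.2]
  have hY1 : 1 ≤ Y / q := le_trans (Nat.one_le_pow _ _ hD) hDY
  have hmain := card_mul_sum_le_of_sieve hD (N := Y / q + 1) (hDY.trans (Nat.le_succ _)) κ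
    (fun p t => by
      simp only [hκ]
      congr 2
      rw [mul_add, ← add_assoc, Nat.dvd_add_left (Dvd.intro_left q rfl)])
    (fun p t => by simp only [hκ]; split_ifs <;> norm_num)
    (fun p t => by simp only [hκ]; split_ifs <;> norm_num)
    (fun p => if p ∣ q then 0 else 1)
    (fun p => by split_ifs <;> norm_num)
    (fun p hp => by
      split_ifs with h
      · exact sum_nonneg fun t _ => by simp only [hκ]; split_ifs <;> norm_num
      · obtain ⟨t, ht, htd⟩ := exists_lt_dvd_add_mul hp h r
        refine le_trans ?_ (single_le_sum (f := fun t => κ p t)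
          (fun t _ => by simp only [hκ]; split_ifs <;> norm_num) (mem_range.2 ht))
        simp [hκ, htd, h])
    0 (T.image fun P => P / q)
    (fun t ht => by
      obtain ⟨P, hP, rfl⟩ := mem_image.1 ht
      simp only [hT, mem_filter, mem_Icc] at hP
      exact mem_range.2 (Nat.lt_succ_of_le (Nat.div_le_div_right hP.1.2)))
    (fun t ht p hp hpD => by
      obtain ⟨P, hP, rfl⟩ := mem_image.1 ht
      simp only [hT, mem_filter, mem_Icc] at hP
      have e : r + q * (0 + P / q) = P := by
        rw [zero_add, ← hP.2.2.2, Nat.mod_add_div]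
      simp only [hκ, e]
      rw [if_neg]
      rintro ⟨h1, _⟩
      have := (Nat.prime_dvd_prime_iff_eq hp hP.2.1).1 h1
      omega)
  rw [card_image_of_injOn hinj] at hmain
  have hG : ∑ d ∈ squarefreeCoprime D q, (1 : ℝ) / d ≤
      ∑ d ∈ (Icc 1 D).filter Squarefree, ∏ p ∈ d.primeFactors, ((if p ∣ q then (0 : ℝ) else 1) / p) := by
    refine sum_le_sum_of_maps_injOn id ?_ (Set.injOn_id _) ?_ ?_
    · intro d hd
      simp only [squarefreeCoprime, mem_filter] at hd
      simp [hd.1, hd.2.1, -mem_Icc]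
    · intro d hd
      simp only [squarefreeCoprime, mem_filter] at hd
      refine le_of_eq ?_
      have : ∏ p ∈ d.primeFactors, ((if p ∣ q then (0 : ℝ) else 1) / p) =
          ∏ p ∈ d.primeFactors, (1 / (p : ℝ)) := by
        refine prod_congr rfl fun p hp => ?_
        rw [if_neg]
        intro hpq
        exact (Nat.prime_of_mem_primeFactors hp).one_lt.ne'
          (Nat.eq_one_of_dvd_coprimes hd.2.2 (Nat.dvd_of_mem_primeFactors hp) hpq)
      rw [id, this, prod_div_distrib, prod_const_one]
      congr 1
      conv_lhs => rw [← Nat.prod_primeFactors_of_squarefree hd.2.1]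
      push_cast; rfl
    · intro d _
      exact prod_nonneg fun p _ => div_nonneg (by split_ifs <;> norm_num) (Nat.cast_nonneg _)
  have hlog := log_add_one_le_three_mul_sum_squarefreeCoprime D hq
  have hN : ((Y / q + 1 : ℕ) : ℝ) ≤ 2 * ((Y : ℝ) / q) := by
    have h1 : ((Y / q : ℕ) : ℝ) ≤ (Y : ℝ) / q := Nat.cast_div_le
    have h2 : (1 : ℝ) ≤ ((Y / q : ℕ) : ℝ) := by exact_mod_cast hY1
    push_cast; linarith
  have h3 := mul_le_mul_of_nonneg_left (hlog.trans (mul_le_mul_of_nonneg_left hG (by norm_num)))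
    (Nat.cast_nonneg (α := ℝ) T.card)
  linarith

/-- An upper bound for sets of primes avoiding one nonzero class modulo each prime of `𝒢`. -/
lemma card_primes_avoiding_mul_le {D N : ℕ} (hD : 1 ≤ D) (hDN : D ^ 4 ≤ N) (𝒢 : Finset ℕ)
    (h𝒢 : ∀ p ∈ 𝒢, p.Prime) (r : ℕ → ℕ) (hr : ∀ p ∈ 𝒢, ¬ p ∣ r p) (Z : Finset ℕ)
    (hZ : ∀ n ∈ Z, n ≤ N ∧ n.Prime ∧ D < n ∧ ∀ p ∈ 𝒢, n % p ≠ r p % p) :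
    (Z.card : ℝ) * ∑ p ∈ 𝒢, 1 / (p : ℝ) * Real.log ((D : ℝ) / p) ≤ 12 * N := by
  classical
  set κ : ℕ → ℕ → ℝ := fun p n => if p ∣ n ∨ (p ∈ 𝒢 ∧ n % p = r p % p) then 1 else 0 with hκ
  have hκ0 : ∀ p n, 0 ≤ κ p n := fun p n => by simp only [hκ]; split_ifs <;> norm_num
  have hN1 : 1 ≤ N := le_trans (Nat.one_le_pow _ _ hD) hDN
  have hmain := card_mul_sum_le_of_sieve hD (N := N + 1) (hDN.trans (Nat.le_succ _)) κ
    (fun p n => by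
      simp only [hκ, Nat.dvd_add_self_right, Nat.add_mod_right])
    hκ0
    (fun p n => by simp only [hκ]; split_ifs <;> norm_num)
    (fun p => if p ∈ 𝒢 then 2 else 1)
    (fun p => by split_ifs <;> norm_num)
    (fun p hp => by
      have h00 : κ p 0 = 1 := by simp [hκ]
      split_ifs with h
      · have hne : r p % p ≠ 0 := fun h' => hr p h (Nat.dvd_of_mod_eq_zero h')
        have h01 : κ p (r p % p) = 1 := by simp [hκ, h]
        calc (2 : ℝ) = ∑ n ∈ {0, r p % p}, κ p n := by
              rw [sum_pair hne.symm, h00, h01]; norm_num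
          _ ≤ _ := sum_le_sum_of_subset_of_nonneg (by
              intro n hn
              simp only [mem_insert, mem_singleton] at hn
              rcases hn with rfl | rfl
              · exact mem_range.2 hp.pos
              · exact mem_range.2 (Nat.mod_lt _ hp.pos)) fun n _ _ => hκ0 p n
      · rw [← h00]
        exact single_le_sum (f := fun n => κ p n) (fun n _ => hκ0 p n) (mem_range.2 hp.pos))
    0 Z
    (fun n hn => mem_range.2 (Nat.lt_succ_of_le (hZ n hn).1))
    (fun n hn p hp hpD => by
      obtain ⟨h1, h2, h3, h4⟩ := hZ n hn
      simp only [hκ, zero_add]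
      rw [if_neg]
      rintro (h | ⟨h, h'⟩)
      · have := (Nat.prime_dvd_prime_iff_eq hp h2).1 h
        omega
      · exact h4 p h h')
  have hG : ∑ p ∈ 𝒢, 1 / (p : ℝ) * Real.log ((D : ℝ) / p) ≤ 3 *
      ∑ d ∈ (Icc 1 D).filter Squarefree,
        ∏ p ∈ d.primeFactors, ((if p ∈ 𝒢 then (2 : ℝ) else 1) / p) := by
    have hd : ∀ d ∈ (Icc 1 D).filter Squarefree,
        ∑ p ∈ 𝒢, (if p ∣ d then (1 : ℝ) / d else 0) ≤
          ∏ p ∈ d.primeFactors, ((if p ∈ 𝒢 then (2 : ℝ) else 1) / p) := by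
      intro d hd
      simp only [mem_filter, mem_Icc] at hd
      rw [prod_div_distrib, ← sum_filter, sum_const, nsmul_eq_mul, mul_one_div]
      have e : (∏ p ∈ d.primeFactors, (p : ℝ)) = d := by
        conv_rhs => rw [← Nat.prod_primeFactors_of_squarefree hd.2]
        push_cast; rfl
      rw [e]
      refine div_le_div_of_nonneg_right ?_ (Nat.cast_nonneg _)
      rw [prod_ite, prod_const, prod_const_one, mul_one]
      have hsub : 𝒢.filter (· ∣ d) ⊆ d.primeFactors.filter (· ∈ 𝒢) := by
        intro p hp
        simp only [mem_filter, Nat.mem_primeFactors] at hp ⊢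
        exact ⟨⟨h𝒢 p hp.1, hp.2, by omega⟩, hp.1⟩
      have h1 : (𝒢.filter (· ∣ d)).card ≤ (d.primeFactors.filter (· ∈ 𝒢)).card := card_le_card hsub
      have h2 := (h1.trans (Nat.lt_two_pow_self (n := (d.primeFactors.filter (· ∈ 𝒢)).card)).le)
      exact_mod_cast h2
    refine le_trans ?_ (mul_le_mul_of_nonneg_left (sum_le_sum hd) (by norm_num))
    rw [sum_comm, mul_sum]
    refine sum_le_sum fun p hp => ?_
    have hpp := h𝒢 p hp
    have hp0 : (0 : ℝ) < p := by exact_mod_cast hpp.pos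
    have h1 : Real.log ((D : ℝ) / p) ≤ Real.log ((D / p : ℕ) + 1) := by
      rcases Nat.eq_zero_or_pos (D / p) with h0 | _
      · have : D < p := (Nat.div_eq_zero_iff_lt hpp.pos).1 h0
        rw [h0]
        simp only [Nat.cast_zero, zero_add, Real.log_one]
        exact Real.log_nonpos (by positivity) (by
          rw [div_le_one hp0]; exact_mod_cast this.le)
      · refine Real.log_le_log (div_pos (by exact_mod_cast hD) hp0) ?_
        rw [div_le_iff₀ hp0]
        have := Nat.lt_div_mul_add (a := D) hpp.pos
        have h9 : D ≤ (D / p + 1) * p := by linarith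
        exact_mod_cast h9
    have h2 := log_add_one_le_three_mul_sum_squarefreeCoprime (D / p) (Or.inr hpp)
    have h3 : ∑ e ∈ squarefreeCoprime (D / p) p, 1 / (p : ℝ) * ((1 : ℝ) / e) ≤
        ∑ d ∈ (Icc 1 D).filter Squarefree, (if p ∣ d then (1 : ℝ) / d else 0) := by
      refine sum_le_sum_of_maps_injOn (fun e => p * e) ?_ ?_ ?_ ?_
      · intro e he
        simp only [squarefreeCoprime, mem_filter, mem_Icc] at he
        simp only [mem_filter, mem_Icc]
        refine ⟨⟨Nat.mul_pos hpp.pos (by omega), ?_⟩, ?_⟩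
        · calc p * e ≤ p * (D / p) := Nat.mul_le_mul_left _ he.1.2
            _ ≤ D := Nat.mul_div_le _ _
        · exact (Nat.squarefree_mul he.2.2.symm).2 ⟨hpp.prime.squarefree, he.2.1⟩
      · intro e _ e' _ h
        exact Nat.eq_of_mul_eq_mul_left hpp.pos h
      · intro e _
        rw [if_pos (dvd_mul_right _ _)]
        push_cast
        rw [one_div_mul_one_div]
      · intro d _
        split_ifs <;> positivity
    rw [← mul_sum] at h3
    calc 1 / (p : ℝ) * Real.log ((D : ℝ) / p)
        ≤ 1 / (p : ℝ) * (3 * ∑ e ∈ squarefreeCoprime (D / p) p, (1 : ℝ) / e) :=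
          mul_le_mul_of_nonneg_left (h1.trans h2) (by positivity)
      _ = 3 * (1 / (p : ℝ) * ∑ e ∈ squarefreeCoprime (D / p) p, (1 : ℝ) / e) := by ring
      _ ≤ _ := mul_le_mul_of_nonneg_left h3 (by norm_num)
  have h3 := mul_le_mul_of_nonneg_left hG (Nat.cast_nonneg (α := ℝ) Z.card)
  have h4 : ((N + 1 : ℕ) : ℝ) ≤ 2 * N := by
    have : (1 : ℝ) ≤ N := by exact_mod_cast hN1
    push_cast; linarith
  linarith

end SieveBounds

section Bilinear
open Finset Function

/-- The balanced indicator function of a residue class modulo `p`. -/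
noncomputable def balancedIndicator (τ : ℕ → ℕ → ℕ) (p Q n : ℕ) : ℝ :=
  (if n % p = τ p Q % p then 1 else 0) - 1 / p

lemma balancedIndicator_periodic (τ : ℕ → ℕ → ℕ) (p Q : ℕ) : Periodic (balancedIndicator τ p Q) p := by
  intro n
  simp [balancedIndicator]

lemma abs_balancedIndicator_le (τ : ℕ → ℕ → ℕ) (p Q n : ℕ) : |balancedIndicator τ p Q n| ≤ 1 := by
  have h0 : (0 : ℝ) ≤ 1 / p := by positivity
  have h1 : (1 : ℝ) / p ≤ 1 := by
    rcases Nat.eq_zero_or_pos p with h | h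
    · simp [h]
    · rw [div_le_one (by exact_mod_cast h)]; exact_mod_cast h
  unfold balancedIndicator
  rw [abs_le]
  split_ifs <;> constructor <;> linarith

lemma sum_range_ite_mod {p : ℕ} (hp : 0 < p) (t : ℕ) :
    ∑ r ∈ range p, (if r % p = t % p then (1 : ℝ) else 0) = 1 := by
  rw [sum_eq_single (t % p)]
  · simp
  · intro b hb hne
    rw [if_neg]
    rwa [Nat.mod_eq_of_lt (mem_range.1 hb)]
  · intro h; exact absurd (mem_range.2 (Nat.mod_lt _ hp)) h

lemma sum_range_balancedIndicator (τ : ℕ → ℕ → ℕ) {p : ℕ} (hp : 0 < p) (Q : ℕ) :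
    ∑ r ∈ range p, balancedIndicator τ p Q r = 0 := by
  have : (p : ℝ) ≠ 0 := by exact_mod_cast hp.ne'
  simp only [balancedIndicator, sum_sub_distrib, sum_range_ite_mod hp]
  simp [this]

lemma abs_sum_range_balancedIndicator_mul_le (τ : ℕ → ℕ → ℕ) {p : ℕ} (hp : 0 < p) (Q₁ Q₂ : ℕ) :
    |∑ r ∈ range p, balancedIndicator τ p Q₁ r * balancedIndicator τ p Q₂ r| ≤
      (if τ p Q₂ % p = τ p Q₁ % p then 1 else 0) + 1 / p := by
  have hp0 : (p : ℝ) ≠ 0 := by exact_mod_cast hp.ne'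
  have h : ∑ r ∈ range p, balancedIndicator τ p Q₁ r * balancedIndicator τ p Q₂ r =
      (if τ p Q₂ % p = τ p Q₁ % p then 1 else 0) - 1 / p := by
    have h1 : ∀ r, balancedIndicator τ p Q₁ r * balancedIndicator τ p Q₂ r =
        (if τ p Q₂ % p = τ p Q₁ % p then 1 else 0) * (if r % p = τ p Q₁ % p then 1 else 0)
        - 1 / p * (if r % p = τ p Q₁ % p then 1 else 0)
        - 1 / p * balancedIndicator τ p Q₂ r := by
      intro r
      unfold balancedIndicator
      by_cases hr1 : r % p = τ p Q₁ % p
      · by_cases h12 : τ p Q₂ % p = τ p Q₁ % p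
        · simp [hr1, h12]; ring
        · have : ¬ (τ p Q₁ % p = τ p Q₂ % p) := fun h => h12 h.symm
          simp [hr1, h12, this]; ring
      · simp [hr1]
    simp only [h1, sum_sub_distrib, ← mul_sum, sum_range_ite_mod hp,
      sum_range_balancedIndicator τ hp]
    ring
  rw [h]
  have h0 : (0 : ℝ) ≤ 1 / p := by positivity
  split_ifs
  · rw [abs_le]; constructor <;> linarith [show (1 : ℝ) / p ≤ 1 by
      rw [div_le_one (by positivity)]; exact_mod_cast hp]
  · rw [zero_sub, abs_neg, zero_add, abs_of_nonneg h0]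

lemma prod_injOn_of_primes {𝒟 : Finset (Finset ℕ)} (h : ∀ U ∈ 𝒟, ∀ p ∈ U, p.Prime) :
    Set.InjOn (fun U : Finset ℕ => ∏ p ∈ U, p) (𝒟 : Set (Finset ℕ)) := by
  intro U hU V hV huv
  have := congrArg Nat.primeFactors huv
  simpa only [Nat.primeFactors_prod (h U hU), Nat.primeFactors_prod (h V hV)] using this

lemma sum_prod_abs_balancedIndicator_le (τ : ℕ → ℕ → ℕ) {U : Finset ℕ} {B k : ℕ}
    (hU : ∀ p ∈ U, p.Prime) (hk : U.card ≤ k) (hB : ∏ p ∈ U, p ≤ B) {𝒬 : Finset ℕ}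
    (h𝒬 : 𝒬 ⊆ range B)
    (hfib : ∀ p ∈ U, ∀ c, ∃ u v, ∀ Q ∈ 𝒬, τ p Q % p = c → Q % p = u % p ∨ Q % p = v % p) (Q₁ : ℕ) :
    ∑ Q₂ ∈ 𝒬, ∏ p ∈ U,
      (|∑ r ∈ range p, balancedIndicator τ p Q₁ r * balancedIndicator τ p Q₂ r| / p) ≤
      2 * B * 3 ^ k / ((∏ p ∈ U, p : ℕ) : ℝ) ^ 2 := by
  choose! u v huv using fun p (hp : p ∈ U) => hfib p hp (τ p Q₁ % p)
  set d := ∏ p ∈ U, p with hd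
  have hdpos : 0 < d := prod_pos fun p hp => (hU p hp).pos
  set F : ℕ → ℕ → ℝ := fun p n => (if n % p = u p % p then 1 else 0) +
    (if n % p = v p % p then 1 else 0) + 1 / p with hF
  have hF0 : ∀ p n, 0 ≤ F p n := fun p n => by
    simp only [hF]; positivity
  have hFper : ∀ p ∈ U, Periodic (F p) p := fun p _ n => by simp [hF]
  have hFs : ∀ p ∈ U, ∑ r ∈ range p, F p r = 3 := fun p hp => by
    have hp0 : 0 < p := (hU p hp).pos
    simp only [hF, sum_add_distrib, sum_range_ite_mod hp0]
    have : (p : ℝ) ≠ 0 := by exact_mod_cast hp0.ne'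
    simp [this]; norm_num
  have h1 : ∀ Q₂ ∈ 𝒬, ∏ p ∈ U,
      (|∑ r ∈ range p, balancedIndicator τ p Q₁ r * balancedIndicator τ p Q₂ r| / p) ≤
      (∏ p ∈ U, F p Q₂) / d := by
    intro Q₂ hQ₂
    rw [hd, Nat.cast_prod, ← prod_div_distrib]
    refine prod_le_prod (fun _ _ => by positivity) fun p hp => ?_
    refine div_le_div_of_nonneg_right ?_ (Nat.cast_nonneg _)
    refine (abs_sum_range_balancedIndicator_mul_le τ (hU p hp).pos Q₁ Q₂).trans ?_
    simp only [hF]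
    refine add_le_add ?_ le_rfl
    split_ifs with h h2 h3 h3 <;> norm_num
    rcases huv p hp Q₂ hQ₂ h with h' | h'
    · exact h2 h'
    · exact h3 h'
  refine (sum_le_sum h1).trans ?_
  rw [← sum_div]
  have h2 : ∑ Q ∈ 𝒬, ∏ p ∈ U, F p Q ≤ ∑ Q ∈ range B, ∏ p ∈ U, F p Q :=
    sum_le_sum_of_subset_of_nonneg h𝒬 fun _ _ _ => prod_nonneg fun _ _ => hF0 _ _
  have h3 := sum_range_le_of_periodic_of_nonneg hdpos (periodic_prod hFper)
    (fun n => prod_nonneg fun p _ => hF0 p n) B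
  rw [sum_range_prod_of_periodic hU hFper, prod_congr rfl hFs, prod_const] at h3
  have hd' : (0 : ℝ) < d := by exact_mod_cast hdpos
  have hdB : (1 : ℝ) ≤ B / d := by rw [le_div_iff₀ hd', one_mul]; exact_mod_cast hB
  have h4 : ∑ Q ∈ 𝒬, ∏ p ∈ U, F p Q ≤ (2 * (B / d)) * 3 ^ k := by
    refine h2.trans (h3.trans ?_)
    refine mul_le_mul (by linarith) ?_ (by positivity) (by positivity)
    exact pow_le_pow_right₀ (by norm_num) hk
  refine (div_le_div_of_nonneg_right h4 hd'.le).trans (le_of_eq ?_)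
  field_simp

lemma sum_abs_sum_sum_prod_balancedIndicator_le (τ : ℕ → ℕ → ℕ) (𝒟 : Finset (Finset ℕ)) {B D N k y : ℕ}
    (hprime : ∀ U ∈ 𝒟, ∀ p ∈ U, p.Prime) (hk : ∀ U ∈ 𝒟, U.card ≤ k) (hy : 0 < y)
    (hyp : ∀ U ∈ 𝒟, y < ∏ p ∈ U, p)
    (hD : ∀ U ∈ 𝒟, ∏ p ∈ U, p ≤ D) (hDB : D ≤ B) (hN : 0 < N) {𝒬 : Finset ℕ}
    (h𝒬 : 𝒬 ⊆ range B)
    (hfib : ∀ U ∈ 𝒟, ∀ p ∈ U, ∀ c, ∃ u v, ∀ Q ∈ 𝒬, τ p Q % p = c → Q % p = u % p ∨ Q % p = v % p)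
    (a : ℕ) (T : Finset ℕ) (hT : T ⊆ Ico a (a + N)) :
    ∑ U ∈ 𝒟, |∑ P ∈ T, ∑ Q ∈ 𝒬, ∏ p ∈ U, balancedIndicator τ p Q P| ≤
      N * B * Real.sqrt (2 * 3 ^ k / y + D ^ 4 / N) := by
  set c : Finset ℕ → ℝ := fun U => if 0 ≤ ∑ P ∈ T, ∑ Q ∈ 𝒬, ∏ p ∈ U, balancedIndicator τ p Q P
    then 1 else -1 with hc
  have hcabs : ∀ U, |c U| = 1 := fun U => by simp only [hc]; split_ifs <;> simp
  have hcsq : ∀ U, c U ^ 2 = 1 := fun U => by simp only [hc]; split_ifs <;> simp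
  have hNr : (0 : ℝ) < N := by exact_mod_cast hN
  set G : ℕ → ℝ := fun P => ∑ U ∈ 𝒟, c U * ∑ Q ∈ 𝒬, ∏ p ∈ U, balancedIndicator τ p Q P with hG
  have h1 : ∑ U ∈ 𝒟, |∑ P ∈ T, ∑ Q ∈ 𝒬, ∏ p ∈ U, balancedIndicator τ p Q P| = ∑ P ∈ T, G P := by
    rw [hG, sum_comm]
    refine sum_congr rfl fun U _ => ?_
    rw [← mul_sum]
    simp only [hc]
    split_ifs with h
    · rw [abs_of_nonneg h, one_mul]
    · rw [abs_of_neg (not_le.1 h), neg_one_mul]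
  have h2 : (∑ P ∈ T, G P) ^ 2 ≤ N * ∑ n ∈ range N, (G (a + n)) ^ 2 := by
    refine (sq_sum_le_card_mul_sum_sq (s := T) (f := G)).trans ?_
    have hcard : T.card ≤ N := by simpa using card_le_card hT
    refine mul_le_mul (by exact_mod_cast hcard) ?_ (sum_nonneg fun _ _ => sq_nonneg _) hNr.le
    refine (sum_le_sum_of_subset_of_nonneg hT fun _ _ _ => sq_nonneg _).trans ?_
    rw [sum_Ico_eq_sum_range, Nat.add_sub_cancel_left]
  have h3 := large_sieve_of_periodic 𝒟 𝒬 D hprime (fun U hU => by exact_mod_cast hD U hU)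
    (balancedIndicator τ) (balancedIndicator_periodic τ) (abs_balancedIndicator_le τ)
    (fun p Q _ hp => sum_range_balancedIndicator τ hp.pos Q) c a N
  have hinj := prod_injOn_of_primes hprime
  have hmaps : ∀ U ∈ 𝒟, ∏ p ∈ U, p ∈ Ioc y D := fun U hU => mem_Ioc.2 ⟨hyp U hU, hD U hU⟩
  have hcard𝒟 : (𝒟.card : ℝ) ≤ D := by
    have h := card_le_card_of_injOn _ hmaps hinj
    rw [Nat.card_Ioc] at h
    exact_mod_cast h.trans (Nat.sub_le _ _)
  have hcard𝒬 : (𝒬.card : ℝ) ≤ B := by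
    have := card_le_card h𝒬
    rw [card_range] at this
    exact_mod_cast this
  have h4 : ∑ U ∈ 𝒟, (1 : ℝ) / ((∏ p ∈ U, p : ℕ) : ℝ) ^ 2 ≤ 1 / y := by
    refine (sum_le_sum_of_maps_injOn (fun U : Finset ℕ => ∏ p ∈ U, p) hmaps hinj
      (g := fun d : ℕ => 1 / (d : ℝ) ^ 2) (fun U _ => le_rfl) (fun _ _ => by positivity)).trans ?_
    rcases le_or_gt y D with h | h
    · have := sum_Ioc_inv_sq_le_sub (α := ℝ) hy.ne' h
      simp only [one_div]
      have h0 : (0 : ℝ) ≤ (D : ℝ)⁻¹ := by positivity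
      linarith
    · rw [Ioc_eq_empty (by omega)]; simp
  have h5 : ∑ U ∈ 𝒟, c U ^ 2 * ∑ w₁ ∈ 𝒬, ∑ w₂ ∈ 𝒬, ∏ p ∈ U,
      (|∑ r ∈ range p, balancedIndicator τ p w₁ r * balancedIndicator τ p w₂ r| / p) ≤
      (B : ℝ) ^ 2 * (2 * 3 ^ k / y) := by
    calc _ ≤ ∑ U ∈ 𝒟, ((B : ℝ) ^ 2 * (2 * 3 ^ k)) * (1 / ((∏ p ∈ U, p : ℕ) : ℝ) ^ 2) := by
          refine sum_le_sum fun U hU => ?_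
          rw [hcsq, one_mul]
          refine (sum_le_sum fun w₁ _ => sum_prod_abs_balancedIndicator_le τ (hprime U hU) (hk U hU)
            ((hD U hU).trans hDB) h𝒬 (hfib U hU) w₁).trans ?_
          rw [sum_const, nsmul_eq_mul]
          refine (mul_le_mul_of_nonneg_right hcard𝒬 (by positivity)).trans (le_of_eq ?_)
          ring
      _ ≤ ((B : ℝ) ^ 2 * (2 * 3 ^ k)) * (1 / y) := by
          rw [← mul_sum]
          exact mul_le_mul_of_nonneg_left h4 (by positivity)
      _ = _ := by ring
  have h6 : ((∑ U ∈ 𝒟, |c U|) * 𝒬.card * D) ^ 2 ≤ (B : ℝ) ^ 2 * D ^ 4 := by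
    simp only [hcabs, sum_const, nsmul_eq_mul, mul_one]
    have : (𝒟.card : ℝ) * 𝒬.card * D ≤ D * B * D := by gcongr
    calc _ ≤ ((D : ℝ) * B * D) ^ 2 := by gcongr
      _ = _ := by ring
  rw [h1]
  refine (le_abs_self _).trans (abs_le_of_sq_le_sq ?_ (by positivity))
  refine h2.trans ?_
  rw [mul_pow, Real.sq_sqrt (by positivity)]
  have h7 : ∑ n ∈ range N, (G (a + n)) ^ 2 ≤ N * ((B : ℝ) ^ 2 * (2 * 3 ^ k / y)) + (B : ℝ) ^ 2 * D ^ 4 :=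
    h3.trans (add_le_add (mul_le_mul_of_nonneg_left h5 hNr.le) h6)
  refine (mul_le_mul_of_nonneg_left h7 hNr.le).trans (le_of_eq ?_)
  field_simp

end Bilinear

section Truncation
open Finset

lemma norm_one_add_pow_sub_sum_le {z : ℂ} (hz : ‖1 + z‖ = 1) (N k : ℕ) :
    ‖(1 + z) ^ N - ∑ j ∈ range k, (N.choose j : ℂ) * z ^ j‖ ≤ N.choose k * ‖z‖ ^ k := by
  induction N generalizing k with
  | zero =>
    cases k with
    | zero => simp
    | succ k => rw [sum_range_succ']; simp
  | succ N ih =>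
    cases k with
    | zero => simp [hz]
    | succ k =>
      have h : (1 + z) ^ (N + 1) - ∑ j ∈ range (k + 1), ((N + 1).choose j : ℂ) * z ^ j =
          (1 + z) * ((1 + z) ^ N - ∑ j ∈ range (k + 1), (N.choose j : ℂ) * z ^ j) +
            N.choose k * z ^ (k + 1) := by
        have h1 : ∑ j ∈ range (k + 1), ((N + 1).choose j : ℂ) * z ^ j =
            ∑ j ∈ range k, (N.choose j : ℂ) * z ^ (j + 1) +
              ∑ j ∈ range (k + 1), (N.choose j : ℂ) * z ^ j := by
          rw [sum_range_succ', sum_range_succ' (fun j => (N.choose j : ℂ) * z ^ j)]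
          simp only [Nat.choose_succ_succ', Nat.cast_add, add_mul, sum_add_distrib,
            Nat.choose_zero_right]
          ring
        have h2 : z * ∑ j ∈ range (k + 1), (N.choose j : ℂ) * z ^ j =
            ∑ j ∈ range k, (N.choose j : ℂ) * z ^ (j + 1) + N.choose k * z ^ (k + 1) := by
          rw [sum_range_succ, mul_add, mul_sum]
          congr 1
          · exact sum_congr rfl fun j _ => by ring
          · ring
        rw [h1]
        linear_combination h2
      rw [h]
      refine (norm_add_le _ _).trans ?_
      rw [norm_mul, hz, one_mul, norm_mul, norm_pow, Nat.choose_succ_succ', Nat.cast_add, add_mul,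
        add_comm]
      refine add_le_add ?_ (ih (k + 1))
      simp

lemma sum_powersetCard_prod_ite (𝒮 : Finset ℕ) (E : ℕ → Prop) [DecidablePred E] (j : ℕ) :
    ∑ S ∈ 𝒮.powersetCard j, ∏ p ∈ S, (if E p then (1 : ℝ) else 0) = (#(𝒮.filter E)).choose j := by
  have h : ∀ S : Finset ℕ, ∏ p ∈ S, (if E p then (1 : ℝ) else 0) = if ∀ p ∈ S, E p then 1 else 0 := by
    intro S
    rw [prod_ite_zero]; simp
  simp only [h]
  rw [sum_boole, ← card_powersetCard]
  congr 2
  ext S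
  simp only [mem_filter, mem_powersetCard]
  constructor
  · rintro ⟨⟨h1, h2⟩, h3⟩
    exact ⟨fun p hp => mem_filter.2 ⟨h1 hp, h3 p hp⟩, h2⟩
  · rintro ⟨h1, h2⟩
    exact ⟨⟨fun p hp => (mem_filter.1 (h1 hp)).1, h2⟩, fun p hp => (mem_filter.1 (h1 hp)).2⟩

lemma sum_filter_card_powerset {β : Type*} [AddCommMonoid β] (𝒮 : Finset ℕ) (k : ℕ) (g : Finset ℕ → β) :
    ∑ S ∈ 𝒮.powerset.filter (fun S => #S < k), g S = ∑ j ∈ range k, ∑ S ∈ 𝒮.powersetCard j, g S := by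
  rw [← sum_fiberwise_of_maps_to (s := 𝒮.powerset.filter (fun S => #S < k)) (t := range k)
    (g := fun S => #S) (fun S hS => mem_range.2 (mem_filter.1 hS).2)]
  refine sum_congr rfl fun j hj => ?_
  refine sum_congr ?_ fun _ _ => rfl
  ext S
  simp only [mem_filter, mem_powerset, mem_powersetCard]
  constructor
  · rintro ⟨⟨h1, _⟩, h3⟩; exact ⟨h1, h3⟩
  · rintro ⟨h1, h2⟩; exact ⟨⟨h1, h2 ▸ mem_range.1 hj⟩, h2⟩

/-- Comparison of an average of `(1 + z) ^ W`, where `W` counts events indexed by `p`, with the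
product expected if the events were independent of probability `1 / p`. -/
lemma norm_sum_one_add_pow_sub_le {ι : Type*} (J : Finset ι) (𝒮 : Finset ℕ) (E : ℕ → ι → Prop)
    [∀ p i, Decidable (E p i)] {z : ℂ} (hz : ‖1 + z‖ = 1) (hz1 : ‖z‖ ≤ 1) (k : ℕ) :
    ‖∑ i ∈ J, ((1 + z) ^ #(𝒮.filter (fun p => E p i)) - ∏ p ∈ 𝒮, (1 + z / p))‖ ≤
      (∏ p ∈ 𝒮, (1 + 1 / (p : ℝ))) * (∑ U ∈ 𝒮.powerset.filter (fun U => U.Nonempty ∧ #U ≤ k),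
        |∑ i ∈ J, ∏ p ∈ U, ((if E p i then 1 else 0) - 1 / (p : ℝ))|) +
      2 * #J * ∑ S ∈ 𝒮.powerset.filter (fun S => k ≤ #S), ∏ p ∈ S, 1 / (p : ℝ) := by
  set v : Finset ℕ → ℝ := fun S => ∏ p ∈ S, 1 / (p : ℝ) with hv
  set e : Finset ℕ → ι → ℝ := fun S i => ∏ p ∈ S, (if E p i then (1 : ℝ) else 0) with he
  set EU : Finset ℕ → ℝ := fun U =>
    |∑ i ∈ J, ∏ p ∈ U, ((if E p i then 1 else 0) - 1 / (p : ℝ))| with hEU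
  have hv0 : ∀ S, 0 ≤ v S := fun S => prod_nonneg fun _ _ => by positivity
  have he0 : ∀ S i, 0 ≤ e S i := fun S i => prod_nonneg fun _ _ => by positivity
  set δ : Finset ℕ → ℝ := fun S => ∑ U ∈ S.powerset.filter (fun U => U.Nonempty), EU U * v (S \ U) with hδ
  set t := ∑ S ∈ 𝒮.powerset.filter (fun S => k ≤ #S), v S with ht
  have hW : ∀ i ∈ J, ‖(1 + z) ^ #(𝒮.filter (fun p => E p i)) -
      ∑ S ∈ 𝒮.powerset.filter (fun S => #S < k), z ^ #S * (e S i : ℂ)‖ ≤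
      ∑ S ∈ 𝒮.powersetCard k, e S i := by
    intro i _
    have h1 := norm_one_add_pow_sub_sum_le hz #(𝒮.filter (fun p => E p i)) k
    rw [sum_filter_card_powerset]
    have h2 : ∀ j, ∑ S ∈ 𝒮.powersetCard j, z ^ #S * (e S i : ℂ) =
        ((#(𝒮.filter (fun p => E p i))).choose j : ℂ) * z ^ j := by
      intro j
      have h := sum_powersetCard_prod_ite 𝒮 (fun p => E p i) j
      rw [mul_comm, ← Complex.ofReal_natCast, ← h, Complex.ofReal_sum, mul_sum]
      exact sum_congr rfl fun S hS => by rw [(mem_powersetCard.1 hS).2]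
    simp only [h2]
    refine h1.trans ?_
    rw [sum_powersetCard_prod_ite 𝒮 (fun p => E p i) k]
    exact mul_le_of_le_one_right (Nat.cast_nonneg _) (pow_le_one₀ (norm_nonneg _) hz1)
  have hM : ∏ p ∈ 𝒮, (1 + z / p) = ∑ S ∈ 𝒮.powerset, z ^ #S * (v S : ℂ) := by
    rw [prod_one_add]
    refine sum_congr rfl fun S _ => ?_
    simp only [hv, div_eq_mul_one_div z, prod_mul_distrib, prod_const]
    push_cast; rfl
  have hδS : ∀ S, |∑ i ∈ J, e S i - #J * v S| ≤ δ S := by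
    intro S
    have h1 : ∀ i, e S i = ∑ U ∈ S.powerset,
        (∏ p ∈ U, ((if E p i then 1 else 0) - 1 / (p : ℝ))) * v (S \ U) := by
      intro i
      rw [hv, ← prod_add]
      simp [he]
    have h2 : ∑ i ∈ J, e S i - #J * v S = ∑ U ∈ S.powerset.filter (fun U => U.Nonempty),
        (∑ i ∈ J, ∏ p ∈ U, ((if E p i then 1 else 0) - 1 / (p : ℝ))) * v (S \ U) := by
      simp only [h1]
      rw [sum_comm]
      have h3 : S.powerset = insert ∅ (S.powerset.filter (fun U => U.Nonempty)) := by
        ext U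
        simp only [mem_powerset, mem_insert, mem_filter]
        rcases U.eq_empty_or_nonempty with h | h
        · simp [h]
        · simp [h, h.ne_empty]
      conv_lhs => rw [h3]
      rw [sum_insert (by simp)]
      simp only [prod_empty, one_mul, sdiff_empty, sum_const, nsmul_eq_mul, add_sub_cancel_left,
        ← sum_mul]
    rw [h2]
    refine (abs_sum_le_sum_abs _ _).trans (le_of_eq ?_)
    refine sum_congr rfl fun U _ => ?_
    rw [abs_mul, abs_of_nonneg (hv0 _)]
  have hsumδ : ∑ S ∈ 𝒮.powerset.filter (fun S => #S ≤ k), δ S ≤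
      (∏ p ∈ 𝒮, (1 + 1 / (p : ℝ))) *
        ∑ U ∈ 𝒮.powerset.filter (fun U => U.Nonempty ∧ #U ≤ k), EU U := by
    have hswap : ∑ S ∈ 𝒮.powerset.filter (fun S => #S ≤ k), δ S =
        ∑ U ∈ 𝒮.powerset.filter (fun U => U.Nonempty ∧ #U ≤ k),
          ∑ S ∈ 𝒮.powerset.filter (fun S => #S ≤ k ∧ U ⊆ S), EU U * v (S \ U) := by
      refine sum_comm' fun S U => ?_
      simp only [mem_filter, mem_powerset]
      constructor
      · rintro ⟨⟨h1, h2⟩, h3, h4⟩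
        exact ⟨⟨h1, h2, h3⟩, h3.trans h1, h4, (card_le_card h3).trans h2⟩
      · rintro ⟨⟨h1, h2, h3⟩, _, h4, _⟩
        exact ⟨⟨h1, h2⟩, h3, h4⟩
    rw [hswap, mul_sum]
    refine sum_le_sum fun U _ => ?_
    rw [← mul_sum, mul_comm, prod_one_add]
    refine mul_le_mul_of_nonneg_right ?_ (abs_nonneg _)
    refine sum_le_sum_of_maps_injOn (fun S => S \ U) ?_ ?_ (fun _ _ => le_rfl) fun S _ => hv0 S
    · intro S hS
      exact mem_powerset.2 (sdiff_subset.trans (mem_powerset.1 (mem_filter.1 hS).1))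
    · intro S hS S' hS' h
      have h1 := (mem_filter.1 hS).2.2
      have h2 := (mem_filter.1 hS').2.2
      rw [← sdiff_union_of_subset h1, ← sdiff_union_of_subset h2]
      exact congrArg (· ∪ U) h
  have hsub1 : 𝒮.powersetCard k ⊆ 𝒮.powerset.filter (fun S => k ≤ #S) := fun S hS => by
    rw [mem_powersetCard] at hS
    exact mem_filter.2 ⟨mem_powerset.2 hS.1, hS.2.ge⟩
  -- the main comparison
  have key : ∑ i ∈ J, ((1 + z) ^ #(𝒮.filter (fun p => E p i)) - ∏ p ∈ 𝒮, (1 + z / p)) =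
      ∑ i ∈ J, ((1 + z) ^ #(𝒮.filter (fun p => E p i)) -
        ∑ S ∈ 𝒮.powerset.filter (fun S => #S < k), z ^ #S * (e S i : ℂ)) +
      (∑ S ∈ 𝒮.powerset.filter (fun S => #S < k), z ^ #S * ((∑ i ∈ J, e S i - #J * v S : ℝ) : ℂ) -
        #J * ∑ S ∈ 𝒮.powerset.filter (fun S => k ≤ #S), z ^ #S * (v S : ℂ)) := by
    have h1 := sum_filter_add_sum_filter_not 𝒮.powerset (fun S => #S < k)
      (fun S => z ^ #S * (v S : ℂ))
    simp only [not_lt] at h1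
    rw [hM, ← h1, sum_sub_distrib, sum_sub_distrib, sum_const, nsmul_eq_mul, sum_comm]
    push_cast
    simp only [mul_sub, sum_sub_distrib, mul_sum, mul_add]
    have h2 : ∀ S : Finset ℕ, z ^ #S * ((#J : ℂ) * (v S : ℂ)) = #J * (z ^ #S * (v S : ℂ)) :=
      fun S => by ring
    simp only [h2]
    ring
  have hzS : ∀ S : Finset ℕ, ‖z ^ #S‖ ≤ 1 := fun S => by
    rw [norm_pow]; exact pow_le_one₀ (norm_nonneg _) hz1
  have hb1 : ‖∑ i ∈ J, ((1 + z) ^ #(𝒮.filter (fun p => E p i)) -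
        ∑ S ∈ 𝒮.powerset.filter (fun S => #S < k), z ^ #S * (e S i : ℂ))‖ ≤
      ∑ S ∈ 𝒮.powersetCard k, δ S + #J * t := by
    refine (norm_sum_le _ _).trans ((sum_le_sum hW).trans ?_)
    rw [sum_comm]
    have h1 : ∀ S ∈ 𝒮.powersetCard k, ∑ i ∈ J, e S i ≤ δ S + #J * v S := fun S _ => by
      linarith [(abs_le.1 (hδS S)).2]
    refine (sum_le_sum h1).trans ?_
    rw [sum_add_distrib, ← mul_sum]
    refine add_le_add le_rfl (mul_le_mul_of_nonneg_left ?_ (Nat.cast_nonneg _))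
    exact sum_le_sum_of_subset_of_nonneg hsub1 fun S _ _ => hv0 S
  have hb2 : ‖∑ S ∈ 𝒮.powerset.filter (fun S => #S < k),
      z ^ #S * ((∑ i ∈ J, e S i - #J * v S : ℝ) : ℂ)‖ ≤
      ∑ S ∈ 𝒮.powerset.filter (fun S => #S < k), δ S := by
    refine norm_sum_le_of_le _ fun S _ => ?_
    rw [norm_mul, Complex.norm_real]
    exact (mul_le_of_le_one_left (norm_nonneg _) (hzS S)).trans (hδS S)
  have hb3 : ‖(#J : ℂ) * ∑ S ∈ 𝒮.powerset.filter (fun S => k ≤ #S), z ^ #S * (v S : ℂ)‖ ≤ #J * t := by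
    rw [norm_mul, Complex.norm_natCast]
    refine mul_le_mul_of_nonneg_left (norm_sum_le_of_le _ fun S _ => ?_) (Nat.cast_nonneg _)
    rw [norm_mul, Complex.norm_real, Real.norm_of_nonneg (hv0 S)]
    exact mul_le_of_le_one_left (hv0 S) (hzS S)
  have hb4 : ∑ S ∈ 𝒮.powersetCard k, δ S + ∑ S ∈ 𝒮.powerset.filter (fun S => #S < k), δ S =
      ∑ S ∈ 𝒮.powerset.filter (fun S => #S ≤ k), δ S := by
    have h : 𝒮.powerset.filter (fun S => #S ≤ k) = 𝒮.powerset.filter (fun S => #S < k + 1) := by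
      simp only [Nat.lt_succ_iff]
    rw [h, sum_filter_card_powerset, sum_filter_card_powerset, sum_range_succ, add_comm]
  rw [key]
  refine (norm_add_le _ _).trans ?_
  have := norm_sub_le (∑ S ∈ 𝒮.powerset.filter (fun S => #S < k),
      z ^ #S * ((∑ i ∈ J, e S i - #J * v S : ℝ) : ℂ))
    ((#J : ℂ) * ∑ S ∈ 𝒮.powerset.filter (fun S => k ≤ #S), z ^ #S * (v S : ℂ))
  linarith

lemma sum_filter_card_prod_le (𝒮 : Finset ℕ) {β μ : ℝ} (hβ : 1 ≤ β) (k : ℕ)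
    (hμ : ∑ p ∈ 𝒮, 1 / (p : ℝ) ≤ μ) :
    ∑ S ∈ 𝒮.powerset.filter (fun S => k ≤ #S), ∏ p ∈ S, 1 / (p : ℝ) ≤
      Real.exp (β * μ) / β ^ k := by
  have hβ0 : 0 < β := by linarith
  rw [le_div_iff₀ (by positivity), sum_mul]
  calc ∑ S ∈ 𝒮.powerset.filter (fun S => k ≤ #S), (∏ p ∈ S, 1 / (p : ℝ)) * β ^ k
      ≤ ∑ S ∈ 𝒮.powerset.filter (fun S => k ≤ #S), ∏ p ∈ S, (β * (1 / (p : ℝ))) := by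
        refine sum_le_sum fun S hS => ?_
        rw [prod_mul_distrib, prod_const, mul_comm]
        exact mul_le_mul_of_nonneg_right (pow_le_pow_right₀ hβ (mem_filter.1 hS).2)
          (prod_nonneg fun _ _ => by positivity)
    _ ≤ ∑ S ∈ 𝒮.powerset, ∏ p ∈ S, (β * (1 / (p : ℝ))) :=
        sum_le_sum_of_subset_of_nonneg (filter_subset _ _)
          fun _ _ _ => prod_nonneg fun _ _ => by positivity
    _ = ∏ p ∈ 𝒮, (1 + β * (1 / (p : ℝ))) := (prod_one_add _).symm
    _ ≤ ∏ p ∈ 𝒮, Real.exp (β * (1 / (p : ℝ))) := by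
        refine prod_le_prod (fun _ _ => by positivity) fun p _ => ?_
        rw [add_comm]; exact Real.add_one_le_exp _
    _ = Real.exp (β * ∑ p ∈ 𝒮, 1 / (p : ℝ)) := by rw [← Real.exp_sum, mul_sum]
    _ ≤ Real.exp (β * μ) := by gcongr

end Truncation

section Block
open Finset

/-- The relative error in the block estimate. -/
noncomputable def blockError (k y D N : ℕ) (β μ : ℝ) : ℝ :=
  Real.exp μ * Real.sqrt (2 * 3 ^ k / y + D ^ 4 / N) + 2 * (Real.exp (β * μ) / β ^ k)

lemma blockError_nonneg (k y D N : ℕ) {β : ℝ} (hβ : 1 ≤ β) (μ : ℝ) : 0 ≤ blockError k y D N β μ := by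
  unfold blockError; positivity

lemma norm_sum_block_sub_le (τ : ℕ → ℕ → ℕ) {B D N k y : ℕ} (𝒮 : Finset ℕ)
    (hprime : ∀ p ∈ 𝒮, p.Prime) (hy : 0 < y) (hyp : ∀ p ∈ 𝒮, y < p)
    (hD : ∀ U ⊆ 𝒮, #U ≤ k → ∏ p ∈ U, p ≤ D) (hDB : D ≤ B) (hN : 0 < N) {𝒬 : Finset ℕ}
    (h𝒬 : 𝒬 ⊆ range B)
    (hfib : ∀ p ∈ 𝒮, ∀ c, ∃ u v, ∀ Q ∈ 𝒬, τ p Q % p = c → Q % p = u % p ∨ Q % p = v % p)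
    (a : ℕ) (T : Finset ℕ) (hT : T ⊆ Ico a (a + N)) {β μ : ℝ} (hβ : 1 ≤ β)
    (hμ : ∑ p ∈ 𝒮, 1 / (p : ℝ) ≤ μ) {z : ℂ} (hz : ‖1 + z‖ = 1) (hz1 : ‖z‖ ≤ 1) :
    ‖∑ i ∈ T ×ˢ 𝒬, ((1 + z) ^ #(𝒮.filter (fun p => i.1 % p = τ p i.2 % p)) - ∏ p ∈ 𝒮, (1 + z / p))‖ ≤
      N * B * blockError k y D N β μ := by
  have hNr : (0 : ℝ) < N := by exact_mod_cast hN
  have h := norm_sum_one_add_pow_sub_le (T ×ˢ 𝒬) 𝒮 (fun p i => i.1 % p = τ p i.2 % p) hz hz1 k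
  refine h.trans ?_
  have hsub : ∀ U ∈ 𝒮.powerset.filter (fun U => U.Nonempty ∧ #U ≤ k), U ⊆ 𝒮 ∧ U.Nonempty ∧ #U ≤ k :=
    fun U hU => by simpa only [mem_filter, mem_powerset] using hU
  have h1 := sum_abs_sum_sum_prod_balancedIndicator_le τ
    (𝒮.powerset.filter (fun U => U.Nonempty ∧ #U ≤ k)) (B := B) (D := D) (N := N) (k := k) (y := y)
    (fun U hU p hp => hprime p ((hsub U hU).1 hp)) (fun U hU => (hsub U hU).2.2) hy
    (fun U hU => by
      obtain ⟨p, hp⟩ := (hsub U hU).2.1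
      refine (hyp p ((hsub U hU).1 hp)).trans_le ?_
      exact single_le_prod' (f := fun p => p) (fun q hq => (hprime q ((hsub U hU).1 hq)).one_le) hp)
    (fun U hU => hD U (hsub U hU).1 (hsub U hU).2.2) hDB hN h𝒬
    (fun U hU p hp => hfib p ((hsub U hU).1 hp)) a T hT
  have h2 := sum_filter_card_prod_le 𝒮 hβ k hμ
  have hcT : (#T : ℝ) ≤ N := by
    have := card_le_card hT
    simp only [Nat.card_Ico, Nat.add_sub_cancel_left] at this
    exact_mod_cast this
  have hcQ : (#𝒬 : ℝ) ≤ B := by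
    have := card_le_card h𝒬
    rw [card_range] at this
    exact_mod_cast this
  have h3 : ∏ p ∈ 𝒮, (1 + 1 / (p : ℝ)) ≤ Real.exp μ := by
    calc _ ≤ ∏ p ∈ 𝒮, Real.exp (1 / (p : ℝ)) := by
          refine prod_le_prod (fun _ _ => by positivity) fun p _ => ?_
          rw [add_comm]; exact Real.add_one_le_exp _
      _ ≤ _ := by rw [← Real.exp_sum]; gcongr
  have h4 : (∏ p ∈ 𝒮, (1 + 1 / (p : ℝ))) * (∑ U ∈ 𝒮.powerset.filter (fun U => U.Nonempty ∧ #U ≤ k),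
        |∑ i ∈ T ×ˢ 𝒬, ∏ p ∈ U, ((if i.1 % p = τ p i.2 % p then 1 else 0) - 1 / (p : ℝ))|) ≤
      Real.exp μ * (N * B * Real.sqrt (2 * 3 ^ k / y + D ^ 4 / N)) := by
    refine mul_le_mul h3 ?_ (sum_nonneg fun _ _ => abs_nonneg _) (Real.exp_pos _).le
    simp only [sum_product]
    exact h1
  have h5 : (2 : ℝ) * #(T ×ˢ 𝒬) * ∑ S ∈ 𝒮.powerset.filter (fun S => k ≤ #S), ∏ p ∈ S, 1 / (p : ℝ) ≤
      2 * (N * B) * (Real.exp (β * μ) / β ^ k) := by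
    rw [card_product, Nat.cast_mul]
    refine mul_le_mul (by gcongr) h2 (sum_nonneg fun _ _ => prod_nonneg fun _ _ => by positivity)
      (by positivity)
  refine (add_le_add h4 h5).trans (le_of_eq ?_)
  unfold blockError
  ring

end Block

section BiAffine

lemma exists_fibre_of_det_ne_zero {K : Type*} [Field K] {α β γ : K} (h : α * γ - β ^ 2 ≠ 0) (c : K) :
    ∃ u v : K, ∀ q, -(β * q + γ) * (α * q + β)⁻¹ = c → q = u ∨ q = v := by
  refine ⟨-β / α, -(γ + c * β) / (β + c * α), fun q hq => ?_⟩
  by_cases h0 : α * q + β = 0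
  · left
    have hα : α ≠ 0 := by
      rintro rfl
      apply h
      have : β = 0 := by simpa using h0
      simp [this]
    rw [eq_div_iff hα]
    linear_combination h0
  · right
    have h1 : -(β * q + γ) = c * (α * q + β) := by
      rw [← hq, mul_assoc, inv_mul_cancel₀ h0, mul_one]
    have hne : β + c * α ≠ 0 := by
      intro h2
      apply h
      have hβ : β = -(c * α) := by linear_combination h2
      have h3 : γ + c * β = 0 := by linear_combination (-1 : K) * h1 - q * h2
      linear_combination α * h3 - β * h2
    rw [eq_div_iff hne]
    linear_combination (-1 : K) * h1

/-- The residue class of `P` modulo `p` for which `p` divides `P * a (m * Q) + b (m * Q)`. -/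
noncomputable def fibreResidue (α β γ : ℤ) (p Q : ℕ) : ℕ :=
  (-((β : ZMod p) * Q + γ) * ((α : ZMod p) * Q + β)⁻¹).val

lemma exists_fibreResidue_eq {α β γ : ℤ} {p : ℕ} (hp : p.Prime) (h : ¬ (p : ℤ) ∣ α * γ - β ^ 2) (c : ℕ) :
    ∃ u v : ℕ, ∀ Q : ℕ, fibreResidue α β γ p Q % p = c → Q % p = u % p ∨ Q % p = v % p := by
  have := Fact.mk hp
  have h' : (α : ZMod p) * γ - (β : ZMod p) ^ 2 ≠ 0 := by
    intro h0
    apply h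
    rw [← ZMod.intCast_zmod_eq_zero_iff_dvd]
    push_cast
    exact h0
  obtain ⟨u, v, huv⟩ := exists_fibre_of_det_ne_zero h' (c : ZMod p)
  refine ⟨u.val, v.val, fun Q hQ => ?_⟩
  have h1 := huv Q (by
    rw [← hQ, ZMod.natCast_mod, fibreResidue, ZMod.natCast_zmod_val])
  have conv : ∀ w : ZMod p, (Q : ZMod p) = w → Q % p = w.val % p := by
    intro w hw
    rw [Nat.mod_eq_of_lt (ZMod.val_lt w), ← hw, ZMod.val_natCast]
  exact h1.imp (conv _) (conv _)

lemma dvd_iff_mod_eq_fibreResidue {α β γ δ aQ bQ : ℤ} {p P Q : ℕ} (hp : p.Prime)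
    (h : ¬ (p : ℤ) ∣ α * γ - β ^ 2) (hδ : ¬ (p : ℤ) ∣ δ) (hP : ¬ p ∣ P)
    (h1 : δ * aQ = α * Q + β) (h2 : δ * bQ = β * Q + γ) :
    (p : ℤ) ∣ P * aQ + bQ ↔ P % p = fibreResidue α β γ p Q % p := by
  have := Fact.mk hp
  have h' : (α : ZMod p) * γ - (β : ZMod p) ^ 2 ≠ 0 := by
    intro h0
    apply h
    rw [← ZMod.intCast_zmod_eq_zero_iff_dvd]
    push_cast
    exact h0
  have hδ' : (δ : ZMod p) ≠ 0 := by
    intro h0; exact hδ ((ZMod.intCast_zmod_eq_zero_iff_dvd _ _).1 h0)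
  have hP' : (P : ZMod p) ≠ 0 := by
    intro h0; exact hP ((ZMod.natCast_eq_zero_iff _ _).1 h0)
  have e1 : (δ : ZMod p) * aQ = α * Q + β := by exact_mod_cast congrArg (Int.cast : ℤ → ZMod p) h1
  have e2 : (δ : ZMod p) * bQ = β * Q + γ := by exact_mod_cast congrArg (Int.cast : ℤ → ZMod p) h2
  have e3 : P % p = fibreResidue α β γ p Q % p ↔
      (P : ZMod p) = -((β : ZMod p) * Q + γ) * ((α : ZMod p) * Q + β)⁻¹ := by
    rw [← ZMod.natCast_eq_natCast_iff', fibreResidue, ZMod.natCast_zmod_val]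
  rw [e3, ← ZMod.intCast_zmod_eq_zero_iff_dvd]
  push_cast
  have e4 : (P : ZMod p) * aQ + bQ = 0 ↔ (P : ZMod p) * (α * Q + β) + (β * Q + γ) = 0 := by
    rw [← e1, ← e2]
    constructor
    · intro h0; linear_combination (δ : ZMod p) * h0
    · intro h0
      have : (δ : ZMod p) * (P * aQ + bQ) = 0 := by linear_combination h0
      exact (mul_eq_zero.1 this).resolve_left hδ'
  rw [e4]
  by_cases h0 : (α : ZMod p) * Q + β = 0
  · rw [h0, inv_zero, mul_zero, mul_zero, zero_add]
    refine iff_of_false ?_ hP'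
    intro h3
    apply h'
    linear_combination (α : ZMod p) * h3 - (β : ZMod p) * h0
  · rw [eq_mul_inv_iff_mul_eq₀ h0]
    constructor <;> intro h3 <;> linear_combination h3

variable {f a b : ℕ → ℤ}

/-- For fixed `m`, the values `a (m * Q)` and `b (m * Q)` at primes `Q` are affine in `Q`. -/
lemma affine_of_recursion
    (hrec : ∀ m : ℕ, 0 < m → ∀ P : ℕ, P.Prime → ¬ P ∣ m → f (m * P) = (P : ℤ) * a m + b m)
    {m R₁ R₂ Q : ℕ} (hm : 0 < m) (hR₁ : R₁.Prime) (hR₂ : R₂.Prime) (hQ : Q.Prime) (hne : R₁ ≠ R₂)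
    (hR₁m : ¬ R₁ ∣ m) (hR₂m : ¬ R₂ ∣ m) (hQm : ¬ Q ∣ m) :
    ((R₁ : ℤ) - R₂) * a (m * Q) = (a (m * R₁) - a (m * R₂)) * Q + (b (m * R₁) - b (m * R₂)) ∧
    ((R₁ : ℤ) - R₂) * b (m * Q) =
      (b (m * R₁) - b (m * R₂)) * Q + (R₁ * b (m * R₂) - R₂ * b (m * R₁)) := by
  have swap : ∀ P Q : ℕ, P.Prime → Q.Prime → P ≠ Q → ¬ P ∣ m → ¬ Q ∣ m →
      (Q : ℤ) * a (m * P) + b (m * P) = P * a (m * Q) + b (m * Q) := by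
    intro P Q hP hQ hPQ hPm hQm
    rw [← hrec (m * P) (Nat.mul_pos hm hP.pos) Q hQ, ← hrec (m * Q) (Nat.mul_pos hm hQ.pos) P hP]
    · rw [mul_right_comm]
    · rw [hP.dvd_mul, Nat.prime_dvd_prime_iff_eq hP hQ]; tauto
    · rw [hQ.dvd_mul, Nat.prime_dvd_prime_iff_eq hQ hP]; tauto
  have h12 := swap R₁ R₂ hR₁ hR₂ hne hR₁m hR₂m
  by_cases h1 : Q = R₁
  · subst h1
    exact ⟨by linear_combination -h12, by ring⟩
  by_cases h2 : Q = R₂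
  · subst h2
    exact ⟨by linear_combination -h12, by ring⟩
  have hq1 := swap R₁ Q hR₁ hQ (Ne.symm h1) hR₁m hQm
  have hq2 := swap R₂ Q hR₂ hQ (Ne.symm h2) hR₂m hQm
  constructor
  · linear_combination hq2 - hq1
  · linear_combination (R₂ : ℤ) * hq1 - (R₁ : ℤ) * hq2 - (Q : ℤ) * h12

lemma det_of_recursion
    (hrec : ∀ m : ℕ, 0 < m → ∀ P : ℕ, P.Prime → ¬ P ∣ m → f (m * P) = (P : ℤ) * a m + b m)
    {m R₁ R₂ : ℕ} (hm : 0 < m) (hR₁ : R₁.Prime) (hR₂ : R₂.Prime) (hne : R₁ ≠ R₂)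
    (hR₁m : ¬ R₁ ∣ m) (hR₂m : ¬ R₂ ∣ m) :
    (a (m * R₁) - a (m * R₂)) * (R₁ * b (m * R₂) - R₂ * b (m * R₁)) -
      (b (m * R₁) - b (m * R₂)) ^ 2 =
      ((R₁ : ℤ) - R₂) * (a (m * R₁) * b (m * R₂) - a (m * R₂) * b (m * R₁)) := by
  have h := (affine_of_recursion hrec hm hR₁ hR₂ hR₂ hne hR₁m hR₂m hR₂m).1
  linear_combination (b (m * R₁) - b (m * R₂)) * h

end BiAffine

section PairSums
open Finset

lemma card_filter_modEq_le {p N : ℕ} (hp : 0 < p) (hpN : p ≤ N) (r : ℕ) :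
    (#((Icc 1 N).filter (fun n => n % p = r)) : ℝ) ≤ 2 * (N / p) := by
  have h1 : #((Icc 1 N).filter (fun n => n % p = r)) ≤ N / p + 1 := by
    have : #((Icc 1 N).filter (fun n => n % p = r)) ≤ #(range (N / p + 1)) := by
      refine card_le_card_of_injOn (fun n => n / p) ?_ ?_
      · intro n hn
        simp only [coe_filter, mem_Icc, Set.mem_ofPred_eq] at hn
        exact mem_coe.2 (mem_range.2 (Nat.lt_succ_of_le (Nat.div_le_div_right hn.1.2)))
      · intro n hn n' hn' h
        simp only [coe_filter, Set.mem_ofPred_eq] at hn hn'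
        rw [← Nat.div_add_mod n p, ← Nat.div_add_mod n' p, hn.2, hn'.2]
        simp only at h
        rw [h]
    simpa using this
  have hp' : (0 : ℝ) < p := by exact_mod_cast hp
  have h2 : (1 : ℝ) ≤ N / p := by rw [le_div_iff₀ hp', one_mul]; exact_mod_cast hpN
  have h3 : ((N / p : ℕ) : ℝ) ≤ N / p := Nat.cast_div_le
  have h4 : (#((Icc 1 N).filter (fun n => n % p = r)) : ℝ) ≤ (N / p : ℕ) + 1 := by exact_mod_cast h1
  linarith

lemma norm_one_add_div_le_one {z : ℂ} (hz : ‖1 + z‖ = 1) {p : ℕ} (hp : 0 < p) : ‖1 + z / p‖ ≤ 1 := by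
  have hp0 : (p : ℂ) ≠ 0 := by exact_mod_cast hp.ne'
  have hp' : (0 : ℝ) < p := by exact_mod_cast hp
  have h1 : (1 : ℝ) / p ≤ 1 := by rw [div_le_one hp']; exact_mod_cast hp
  have h : 1 + z / p = ((1 - 1 / p : ℝ) : ℂ) + ((1 / p : ℝ) : ℂ) * (1 + z) := by
    push_cast; field_simp; ring
  rw [h]
  refine (norm_add_le _ _).trans ?_
  rw [norm_mul, hz, Complex.norm_real, Complex.norm_real, Real.norm_of_nonneg (by linarith),
    Real.norm_of_nonneg (by positivity)]
  linarith

lemma norm_prod_sub_one_le (s : Finset ℕ) (u : ℕ → ℂ) (hu : ∀ p ∈ s, ‖u p‖ ≤ 1) :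
    ‖∏ p ∈ s, u p - 1‖ ≤ ∑ p ∈ s, ‖u p - 1‖ := by
  induction s using Finset.induction_on with
  | empty => simp
  | insert p s hp ih =>
    rw [prod_insert hp, sum_insert hp]
    have h : u p * ∏ q ∈ s, u q - 1 = u p * (∏ q ∈ s, u q - 1) + (u p - 1) := by ring
    rw [h]
    refine (norm_add_le _ _).trans ?_
    rw [norm_mul, add_comm]
    refine add_le_add le_rfl ?_
    exact (mul_le_of_le_one_left (norm_nonneg _) (hu p (mem_insert_self _ _))).trans
      (ih fun q hq => hu q (mem_insert_of_mem hq))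

lemma norm_prod_sub_prod_filter_le {z : ℂ} (hz : ‖1 + z‖ = 1) (hz1 : ‖z‖ ≤ 1) {y nb : ℕ} (hy : 0 < y)
    (𝒮 : Finset ℕ) (hyp : ∀ p ∈ 𝒮, y < p) (G : ℕ → Prop) [DecidablePred G]
    (hnb : #(𝒮.filter (fun p => ¬ G p)) ≤ nb) :
    ‖∏ p ∈ 𝒮.filter G, (1 + z / p) - ∏ p ∈ 𝒮, (1 + z / p)‖ ≤ nb / y := by
  have hy' : (0 : ℝ) < y := by exact_mod_cast hy
  have hle : ∀ p ∈ 𝒮, ‖1 + z / p‖ ≤ 1 := fun p hp =>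
    norm_one_add_div_le_one hz (hy.trans (hyp p hp))
  rw [← prod_filter_mul_prod_filter_not 𝒮 G, ← mul_one_sub, norm_mul]
  have h1 : ‖∏ p ∈ 𝒮.filter G, (1 + z / p)‖ ≤ 1 := by
    rw [norm_prod]
    exact prod_le_one (fun _ _ => norm_nonneg _) fun p hp => hle p (mem_filter.1 hp).1
  refine (mul_le_of_le_one_left (norm_nonneg _) h1).trans ?_
  rw [norm_sub_rev]
  refine (norm_prod_sub_one_le _ _ fun p hp => hle p (mem_filter.1 hp).1).trans ?_
  have h2 : ∀ p ∈ 𝒮.filter (fun p => ¬ G p), ‖1 + z / p - 1‖ ≤ 1 / y := by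
    intro p hp
    rw [add_sub_cancel_left, norm_div, Complex.norm_natCast]
    have : (y : ℝ) < p := by exact_mod_cast hyp p (mem_filter.1 hp).1
    exact div_le_div₀ zero_le_one hz1 hy' this.le
  refine (sum_le_sum h2).trans ?_
  rw [sum_const, nsmul_eq_mul, mul_one_div]
  exact div_le_div_of_nonneg_right (by exact_mod_cast hnb) hy'.le

/-- Cutting the hyperbolic region `m * P * Q ≤ X` into rectangles. -/
lemma norm_sum_hyperbola_le {X A H D m : ℕ} (hm : 0 < m) (hH : 0 < H) (hDA : D ≤ A)
    (𝒫' 𝒬 : Finset ℕ) (h𝒬 : ∀ Q ∈ 𝒬, A < Q) {η : ℝ} (hη : 0 ≤ η)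
    (g : ℕ × ℕ → ℂ) (hg : ∀ i, ‖g i‖ ≤ 2)
    (hblock : ∀ a B : ℕ, ∀ T ⊆ 𝒫', T ⊆ Ico a (a + H) → D ≤ B →
      ‖∑ i ∈ T ×ˢ (𝒬.filter (fun Q => Q < B)), g i‖ ≤ H * B * η) :
    ‖∑ i ∈ (𝒫' ×ˢ 𝒬).filter (fun i => m * i.1 * i.2 ≤ X), g i‖ ≤
      X / m * (2 * (1 + Real.log (X + 1)) * η) +
      2 * #((𝒫' ×ˢ 𝒬).filter (fun i => m * i.1 * i.2 ≤ X ∧ X < m * i.2 * ((i.1 / H + 1) * H))) := by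
  set J := (𝒫' ×ˢ 𝒬).filter (fun i => m * i.1 * i.2 ≤ X) with hJ
  have hm' : (0 : ℝ) < m := by exact_mod_cast hm
  have hH' : (0 : ℝ) < H := by exact_mod_cast hH
  rw [← sum_filter_add_sum_filter_not J (fun i => m * i.2 * ((i.1 / H + 1) * H) ≤ X)]
  refine (norm_add_le _ _).trans (add_le_add ?_ ?_)
  · set C := J.filter (fun i => m * i.2 * ((i.1 / H + 1) * H) ≤ X) with hC
    have hmaps : ∀ i ∈ C, i.1 / H ∈ range (X + 1) := by
      intro i hi
      simp only [hC, hJ, mem_filter, mem_product] at hi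
      have hQ : 0 < i.2 := lt_of_le_of_lt (Nat.zero_le _) (h𝒬 _ hi.1.1.2)
      refine mem_range.2 (Nat.lt_succ_of_le ((Nat.div_le_self _ _).trans ?_))
      refine le_trans ?_ hi.1.2
      calc i.1 = 1 * i.1 * 1 := by ring
        _ ≤ m * i.1 * i.2 := by gcongr <;> omega
    rw [← sum_fiberwise_of_maps_to hmaps]
    have hfib : ∀ j, C.filter (fun i => i.1 / H = j) =
        (𝒫'.filter (fun P => P / H = j)) ×ˢ
          (𝒬.filter (fun Q => Q < X / (m * ((j + 1) * H)) + 1)) := by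
      intro j
      ext ⟨P, Q⟩
      simp only [hC, hJ, mem_filter, mem_product, Nat.lt_succ_iff]
      rw [Nat.le_div_iff_mul_le (by positivity)]
      constructor
      · rintro ⟨⟨⟨⟨h1, h2⟩, h3⟩, h4⟩, h5⟩
        subst h5
        exact ⟨⟨h1, rfl⟩, h2, by rw [← mul_assoc, mul_comm Q m]; exact h4⟩
      · rintro ⟨⟨h1, h5⟩, h2, h4⟩
        subst h5
        have h6 : m * Q * ((P / H + 1) * H) ≤ X := by rw [← mul_assoc, mul_comm Q m] at h4; exact h4
        refine ⟨⟨⟨⟨h1, h2⟩, le_trans ?_ h6⟩, h6⟩, rfl⟩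
        rw [mul_right_comm]
        refine Nat.mul_le_mul le_rfl ?_
        have := Nat.lt_div_mul_add (a := P) hH
        rw [add_mul, one_mul]; exact this.le
    have hterm : ∀ j ∈ range (X + 1), ‖∑ i ∈ C.filter (fun i => i.1 / H = j), g i‖ ≤
        (X / m * 2 * η) * (1 / ((j : ℝ) + 1)) := by
      intro j _
      rw [hfib]
      set B := X / (m * ((j + 1) * H)) with hB
      rcases (𝒬.filter (fun Q => Q < B + 1)).eq_empty_or_nonempty with h0 | ⟨Q, hQ⟩
      · rw [h0]; simp; positivity
      · rw [mem_filter] at hQ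
        have hAB : A < B := (h𝒬 Q hQ.1).trans_le (Nat.lt_succ_iff.1 hQ.2)
        refine (hblock (j * H) (B + 1) _ (filter_subset _ _) ?_ (by omega)).trans ?_
        · intro P hP
          rw [mem_filter] at hP
          rw [mem_Ico, ← hP.2]
          exact ⟨Nat.div_mul_le_self _ _, Nat.lt_div_mul_add hH⟩
        · have h1 : ((B + 1 : ℕ) : ℝ) ≤ 2 * (X / (m * ((j + 1) * H))) := by
            have h2 : (B : ℝ) ≤ X / (m * ((j + 1) * H)) := by
              have := Nat.cast_div_le (α := ℝ) (m := X) (n := m * ((j + 1) * H))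
              push_cast at this
              exact this
            have h3 : (1 : ℝ) ≤ B := by exact_mod_cast (show 1 ≤ B by omega)
            push_cast; linarith
          calc (H : ℝ) * ((B + 1 : ℕ) : ℝ) * η ≤ H * (2 * (X / (m * ((j + 1) * H)))) * η := by gcongr
            _ = _ := by field_simp
    refine (norm_sum_le _ _).trans ((sum_le_sum hterm).trans ?_)
    rw [← mul_sum]
    have h1 := sum_inv_le_one_add_log (X + 1)
    have h2 : ∑ j ∈ range (X + 1), 1 / ((j : ℝ) + 1) = ∑ i ∈ Icc 1 (X + 1), (1 : ℝ) / i := by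
      rw [range_eq_Ico, ← Ico_add_one_right_eq_Icc, sum_Ico_eq_sum_range, sum_Ico_eq_sum_range]
      simp [add_comm]
    rw [h2]
    push_cast at h1
    calc _ ≤ (X / m * 2 * η) * (1 + Real.log (X + 1)) := by gcongr
      _ = _ := by ring
  · refine (norm_sum_le_of_le _ (fun i _ => hg i)).trans (le_of_eq ?_)
    rw [sum_const, nsmul_eq_mul, mul_comm, hJ, filter_filter]
    simp only [not_le]

end PairSums

section Pairs
open Finset

/-- Pairs of primes `(P, Q)` from `𝒜`, not dividing `m`, with `m * P * Q ≤ X` and such that no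
prime of `𝒮` divides both `a (m * Q)` and `b (m * Q)`. -/
def goodPairs (a b : ℕ → ℤ) (𝒜 𝒮 : Finset ℕ) (X m : ℕ) : Finset (ℕ × ℕ) :=
  ((𝒜.filter (fun P => ¬ P ∣ m)) ×ˢ
    (𝒜.filter (fun Q => ¬ Q ∣ m ∧ ∀ p ∈ 𝒮, ¬ ((p : ℤ) ∣ a (m * Q) ∧ (p : ℤ) ∣ b (m * Q))))).filter
      (fun i => m * i.1 * i.2 ≤ X)

/-- The pairs lying close to the hyperbola `m * P * Q = X`. -/
def boundaryPairs (a b : ℕ → ℤ) (𝒜 𝒮 : Finset ℕ) (X H m : ℕ) : Finset (ℕ × ℕ) :=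
  (goodPairs a b 𝒜 𝒮 X m).filter (fun i => X < m * i.2 * ((i.1 / H + 1) * H))

lemma mem_goodPairs {a b : ℕ → ℤ} {𝒜 𝒮 : Finset ℕ} {X m : ℕ} {i : ℕ × ℕ} :
    i ∈ goodPairs a b 𝒜 𝒮 X m ↔ (i.1 ∈ 𝒜 ∧ ¬ i.1 ∣ m) ∧ (i.2 ∈ 𝒜 ∧ ¬ i.2 ∣ m ∧
      ∀ p ∈ 𝒮, ¬ ((p : ℤ) ∣ a (m * i.2) ∧ (p : ℤ) ∣ b (m * i.2))) ∧ m * i.1 * i.2 ≤ X := by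
  simp only [goodPairs, mem_filter, mem_product, and_assoc]

lemma card_le_sum_of_forall_fibre_le {s : Finset (ℕ × ℕ)} {t : Finset ℕ} (hs : ∀ i ∈ s, i.2 ∈ t)
    {F : ℕ → ℝ} (hF : ∀ Q ∈ t, (#(s.filter (fun i => i.2 = Q)) : ℝ) ≤ F Q) :
    (#s : ℝ) ≤ ∑ Q ∈ t, F Q := by
  rw [card_eq_sum_card_fiberwise (f := Prod.snd) (t := t) (fun i hi => hs i hi)]
  push_cast
  exact sum_le_sum hF

variable {f a b : ℕ → ℤ}

lemma card_goodPairs_le {𝒜 𝒮 : Finset ℕ} {X m : ℕ} (hm : 0 < m) (h𝒜 : ∀ P ∈ 𝒜, P.Prime)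
    {S : ℝ} (hS : ∑ P ∈ 𝒜, 1 / (P : ℝ) ≤ S) :
    (#(goodPairs a b 𝒜 𝒮 X m) : ℝ) ≤ X / m * S := by
  have hm' : (0 : ℝ) < m := by exact_mod_cast hm
  refine (card_le_sum_of_forall_fibre_le (t := 𝒜) (fun i hi => (mem_goodPairs.1 hi).2.1.1)
    (F := fun Q => X / m * (1 / (Q : ℝ))) ?_).trans ?_
  · intro Q hQ
    have h0 : 0 < Q := (h𝒜 Q hQ).pos
    have h1 : #((goodPairs a b 𝒜 𝒮 X m).filter (fun i => i.2 = Q)) ≤ #(Icc 1 (X / (m * Q))) := by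
      refine card_le_card_of_injOn Prod.fst ?_ ?_
      · intro i hi
        rw [mem_coe, mem_filter, mem_goodPairs] at hi
        obtain ⟨⟨h1, _, h3⟩, h4⟩ := hi
        subst h4
        refine mem_coe.2 (mem_Icc.2 ⟨(h𝒜 _ h1.1).pos, ?_⟩)
        rw [Nat.le_div_iff_mul_le (by positivity)]
        calc i.1 * (m * i.2) = m * i.1 * i.2 := by ring
          _ ≤ X := h3
      · intro i hi j hj h
        rw [mem_coe, mem_filter] at hi hj
        exact Prod.ext h (hi.2.trans hj.2.symm)
    rw [Nat.card_Icc, Nat.add_sub_cancel] at h1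
    calc (#((goodPairs a b 𝒜 𝒮 X m).filter (fun i => i.2 = Q)) : ℝ) ≤ ((X / (m * Q) : ℕ) : ℝ) := by
          exact_mod_cast h1
      _ ≤ X / (m * Q : ℕ) := Nat.cast_div_le
      _ = _ := by push_cast; field_simp
  · rw [← mul_sum]
    exact mul_le_mul_of_nonneg_left hS (by positivity)

lemma card_diagonal_le {𝒜 𝒮 : Finset ℕ} {X A m : ℕ} (hm : 0 < m) (hA : 0 < A)
    (h𝒜 : ∀ P ∈ 𝒜, P.Prime ∧ A < P) {S : ℝ} (hS : ∑ P ∈ 𝒜, 1 / (P : ℝ) ≤ S) :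
    (#((goodPairs a b 𝒜 𝒮 X m).filter (fun i => i.1 = i.2)) : ℝ) ≤ X / m * (S / A) := by
  have hm' : (0 : ℝ) < m := by exact_mod_cast hm
  have hA' : (0 : ℝ) < A := by exact_mod_cast hA
  refine (card_le_sum_of_forall_fibre_le (t := 𝒜)
    (fun i hi => (mem_goodPairs.1 (mem_filter.1 hi).1).2.1.1)
    (F := fun Q => X / m / A * (1 / (Q : ℝ))) ?_).trans ?_
  · intro Q hQ
    have hQA : (A : ℝ) < Q := by exact_mod_cast (h𝒜 Q hQ).2
    have hQ0 : (0 : ℝ) < Q := hA'.trans hQA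
    set s := ((goodPairs a b 𝒜 𝒮 X m).filter (fun i => i.1 = i.2)).filter (fun i => i.2 = Q) with hs
    rcases s.eq_empty_or_nonempty with h0 | ⟨i, hi⟩
    · rw [h0]; simp; positivity
    · have h1 : #s ≤ 1 := by
        refine card_le_one.2 fun i hi j hj => ?_
        simp only [hs, mem_filter] at hi hj
        exact Prod.ext (by rw [hi.1.2, hj.1.2, hi.2, hj.2]) (hi.2.trans hj.2.symm)
      simp only [hs, mem_filter, mem_goodPairs] at hi
      obtain ⟨⟨⟨_, _, h3⟩, h4⟩, h5⟩ := hi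
      rw [h4, h5] at h3
      have h6 : (m : ℝ) * Q * Q ≤ X := by exact_mod_cast h3
      calc (#s : ℝ) ≤ 1 := by exact_mod_cast h1
        _ ≤ X / m / A * (1 / Q) := by
          rw [div_div, div_mul_div_comm, mul_one, one_le_div (by positivity)]
          calc (m : ℝ) * A * Q ≤ m * Q * Q := by gcongr
            _ ≤ X := h6
  · rw [← mul_sum]
    calc _ ≤ X / m / A * S := mul_le_mul_of_nonneg_left hS (by positivity)
      _ = _ := by ring

lemma card_dvd_value_le
    (hrec : ∀ m : ℕ, 0 < m → ∀ P : ℕ, P.Prime → ¬ P ∣ m → f (m * P) = (P : ℤ) * a m + b m)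
    {𝒜 𝒮 : Finset ℕ} {X A m p y : ℕ} (hm : 0 < m) (hy : 0 < y) (hp : p ∈ 𝒮) (hpp : p.Prime)
    (hyp : y < p) (hpA : p ≤ A)
    (h𝒜 : ∀ P ∈ 𝒜, P.Prime ∧ A < P) {S : ℝ} (hS : ∑ P ∈ 𝒜, 1 / (P : ℝ) ≤ S) :
    (#((goodPairs a b 𝒜 𝒮 X m).filter (fun i => i.1 ≠ i.2 ∧ (p : ℤ) ∣ f (m * i.1 * i.2))) : ℝ) ≤
      X / m * (2 * S / y) := by
  have hm' : (0 : ℝ) < m := by exact_mod_cast hm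
  have hy' : (0 : ℝ) < y := by exact_mod_cast hy
  have hp' : (y : ℝ) < p := by exact_mod_cast hyp
  refine (card_le_sum_of_forall_fibre_le (t := 𝒜)
    (fun i hi => (mem_goodPairs.1 (mem_filter.1 hi).1).2.1.1)
    (F := fun Q => X / m * (2 / y) * (1 / (Q : ℝ))) ?_).trans ?_
  · intro Q hQ
    have hQ0 : 0 < Q := (h𝒜 Q hQ).1.pos
    set s := ((goodPairs a b 𝒜 𝒮 X m).filter
      (fun i => i.1 ≠ i.2 ∧ (p : ℤ) ∣ f (m * i.1 * i.2))).filter (fun i => i.2 = Q) with hs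
    have hmem : ∀ i ∈ s, (i.1.Prime ∧ A < i.1) ∧ i.2 = Q ∧ i.1 * (m * Q) ≤ X ∧
        (p : ℤ) ∣ i.1 * a (m * Q) + b (m * Q) ∧ ¬ (p : ℤ) ∣ a (m * Q) := by
      intro i hi
      simp only [hs, mem_filter, mem_goodPairs] at hi
      obtain ⟨⟨⟨h1, h2, h3⟩, h4, h5⟩, rfl⟩ := hi
      have hP := h𝒜 _ h1.1
      have h6 : f (m * i.1 * i.2) = (i.1 : ℤ) * a (m * i.2) + b (m * i.2) := by
        rw [mul_right_comm, hrec _ (Nat.mul_pos hm hQ0) _ hP.1]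
        rw [hP.1.dvd_mul, Nat.prime_dvd_prime_iff_eq hP.1 (h𝒜 _ hQ).1]
        exact fun h => h.elim h1.2 h4
      rw [h6] at h5
      refine ⟨hP, rfl, by rw [show i.1 * (m * i.2) = m * i.1 * i.2 by ring]; exact h3, h5, ?_⟩
      intro h7
      exact h2.2.2 p hp ⟨h7, (Int.dvd_add_right (dvd_mul_of_dvd_right h7 _)).1 h5⟩
    rcases s.eq_empty_or_nonempty with h0 | ⟨i₀, hi₀⟩
    · rw [h0]; simp; positivity
    · have h0 := hmem i₀ hi₀
      have hpN : p ≤ X / (m * Q) := by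
        rw [Nat.le_div_iff_mul_le (by positivity)]
        exact le_trans (Nat.mul_le_mul_right _ (hpA.trans h0.1.2.le)) h0.2.2.1
      have hcard : #s ≤ #((Icc 1 (X / (m * Q))).filter (fun n => n % p = i₀.1 % p)) := by
        refine card_le_card_of_injOn Prod.fst ?_ ?_
        · intro i hi
          have hi' := hmem i (mem_coe.1 hi)
          refine mem_coe.2 (mem_filter.2 ⟨mem_Icc.2 ⟨hi'.1.1.pos, ?_⟩, ?_⟩)
          · rw [Nat.le_div_iff_mul_le (by positivity)]
            exact hi'.2.2.1
          · have h7 : (p : ℤ) ∣ ((i₀.1 : ℤ) - i.1) * a (m * Q) := by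
              have := Int.dvd_sub h0.2.2.2.1 hi'.2.2.2.1
              convert this using 1; ring
            have h8 := ((Nat.prime_iff_prime_int.1 hpp).dvd_or_dvd h7).resolve_right hi'.2.2.2.2
            exact (Nat.modEq_iff_dvd).2 h8
        · intro i hi j hj h
          exact Prod.ext h ((hmem i hi).2.1.trans (hmem j hj).2.1.symm)
      calc (#s : ℝ) ≤ #((Icc 1 (X / (m * Q))).filter (fun n => n % p = i₀.1 % p)) := by
            exact_mod_cast hcard
        _ ≤ 2 * ((X / (m * Q) : ℕ) / p) := card_filter_modEq_le hpp.pos hpN _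
        _ ≤ 2 * ((X / (m * Q : ℕ)) / y) := by
            have := Nat.cast_div_le (α := ℝ) (m := X) (n := m * Q)
            gcongr
        _ = _ := by push_cast; field_simp
  · rw [← mul_sum]
    calc _ ≤ X / m * (2 / y) * S := mul_le_mul_of_nonneg_left hS (by positivity)
      _ = _ := by ring

lemma norm_sum_goodPairs_le_of_det_ne_zero
    (hrec : ∀ m : ℕ, 0 < m → ∀ P : ℕ, P.Prime → ¬ P ∣ m → f (m * P) = (P : ℤ) * a m + b m)
    {X A H D y k nb m : ℕ} (hm : 0 < m) (hH : 0 < H) (hy : 0 < y) (hDA : D ≤ A) (hA : 0 < A)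
    {𝒜 𝒮 : Finset ℕ} (h𝒜 : ∀ P ∈ 𝒜, P.Prime ∧ A < P) (h𝒮 : ∀ p ∈ 𝒮, p.Prime ∧ y < p ∧ p ≤ A)
    (hD : ∀ U ⊆ 𝒮, #U ≤ k → ∏ p ∈ U, p ≤ D) {S : ℝ} (hS : ∑ P ∈ 𝒜, 1 / (P : ℝ) ≤ S)
    {β μ : ℝ} (hβ : 1 ≤ β) (hμ : ∑ p ∈ 𝒮, 1 / (p : ℝ) ≤ μ) {z : ℂ} (hz : ‖1 + z‖ = 1) (hz1 : ‖z‖ ≤ 1)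
    {R₁ R₂ : ℕ} (hR₁ : R₁.Prime) (hR₂ : R₂.Prime) (hne : R₁ ≠ R₂) (hR₁m : ¬ R₁ ∣ m) (hR₂m : ¬ R₂ ∣ m)
    (hnb : #(𝒮.filter (fun p : ℕ => ¬ ¬ (p : ℤ) ∣ ((R₁ : ℤ) - R₂) *
      (a (m * R₁) * b (m * R₂) - a (m * R₂) * b (m * R₁)))) ≤ nb) :
    ‖∑ i ∈ (goodPairs a b 𝒜 𝒮 X m).filter (fun i => i.1 ≠ i.2),
      ((1 + z) ^ #(𝒮.filter (fun p : ℕ => (p : ℤ) ∣ f (m * i.1 * i.2))) - ∏ p ∈ 𝒮, (1 + z / p))‖ ≤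
      X / m * (2 * (1 + Real.log (X + 1)) * blockError k y D H β μ + 2 * (S / A) + 5 * nb * S / y) +
      2 * #(boundaryPairs a b 𝒜 𝒮 X H m) := by
  have hm' : (0 : ℝ) < m := by exact_mod_cast hm
  have hy' : (0 : ℝ) < y := by exact_mod_cast hy
  set Δ := ((R₁ : ℤ) - R₂) * (a (m * R₁) * b (m * R₂) - a (m * R₂) * b (m * R₁)) with hΔ
  set α := a (m * R₁) - a (m * R₂) with hα
  set β' := b (m * R₁) - b (m * R₂) with hβ'
  set γ := (R₁ : ℤ) * b (m * R₂) - R₂ * b (m * R₁) with hγ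
  have hdet : α * γ - β' ^ 2 = Δ := det_of_recursion hrec hm hR₁ hR₂ hne hR₁m hR₂m
  set 𝒮' := 𝒮.filter (fun p : ℕ => ¬ (p : ℤ) ∣ Δ) with h𝒮'
  set τ := fibreResidue α β' γ with hτ
  set J := goodPairs a b 𝒜 𝒮 X m with hJ
  set M := ∏ p ∈ 𝒮, (1 + z / p) with hM
  set M' := ∏ p ∈ 𝒮', (1 + z / p) with hM'
  set W : ℕ × ℕ → ℕ := fun i => #(𝒮.filter (fun p : ℕ => (p : ℤ) ∣ f (m * i.1 * i.2))) with hW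
  set W' : ℕ × ℕ → ℕ := fun i => #(𝒮'.filter (fun p => i.1 % p = τ p i.2 % p)) with hW'
  set g : ℕ × ℕ → ℂ := fun i => (1 + z) ^ W' i - M' with hg
  have hS0 : 0 ≤ S := le_trans (sum_nonneg fun _ _ => by positivity) hS
  have hM'1 : ‖M'‖ ≤ 1 := by
    rw [hM', norm_prod]
    exact prod_le_one (fun _ _ => norm_nonneg _) fun p hp =>
      norm_one_add_div_le_one hz (h𝒮 p (mem_filter.1 hp).1).1.pos
  have hpow : ∀ n : ℕ, ‖(1 + z) ^ n‖ = 1 := fun n => by rw [norm_pow, hz, one_pow]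
  have hg2 : ∀ i, ‖g i‖ ≤ 2 := fun i => by
    refine (norm_sub_le _ _).trans ?_
    rw [hpow]; linarith
  have hMM : ‖M' - M‖ ≤ nb / y :=
    norm_prod_sub_prod_filter_le hz hz1 hy 𝒮 (fun p hp => (h𝒮 p hp).2.1) _ hnb
  have hη := blockError_nonneg k y D H hβ μ
  -- the full sum of `g`
  have hB1 : ‖∑ i ∈ J, g i‖ ≤ X / m * (2 * (1 + Real.log (X + 1)) * blockError k y D H β μ) +
      2 * #(boundaryPairs a b 𝒜 𝒮 X H m) := by
    have hbd : boundaryPairs a b 𝒜 𝒮 X H m = ((𝒜.filter (fun P => ¬ P ∣ m)) ×ˢ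
        (𝒜.filter (fun Q => ¬ Q ∣ m ∧ ∀ p ∈ 𝒮, ¬ ((p : ℤ) ∣ a (m * Q) ∧ (p : ℤ) ∣ b (m * Q))))).filter
        (fun i => m * i.1 * i.2 ≤ X ∧ X < m * i.2 * ((i.1 / H + 1) * H)) := by
      rw [boundaryPairs, goodPairs, filter_filter]
    rw [hbd]
    refine norm_sum_hyperbola_le hm hH hDA _ _ (fun Q hQ => (h𝒜 Q (mem_filter.1 hQ).1).2) hη g hg2 ?_
    intro a₀ B T _ hT hDB
    refine norm_sum_block_sub_le τ 𝒮' (fun p hp => (h𝒮 p (mem_filter.1 hp).1).1) hy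
      (fun p hp => (h𝒮 p (mem_filter.1 hp).1).2.1)
      (fun U hU => hD U (hU.trans (filter_subset _ _))) hDB hH ?_ ?_ a₀ T hT hβ ?_ hz hz1
    · intro Q hQ
      exact mem_range.2 (mem_filter.1 hQ).2
    · intro p hp c
      obtain ⟨u, v, huv⟩ := exists_fibreResidue_eq (α := α) (β := β') (γ := γ)
        (h𝒮 p (mem_filter.1 hp).1).1 (by rw [hdet]; exact (mem_filter.1 hp).2) c
      exact ⟨u, v, fun Q _ => huv Q⟩
    · exact (sum_le_sum_of_subset_of_nonneg (filter_subset _ _) fun _ _ _ => by positivity).trans hμ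
  have hB2 : ‖∑ i ∈ J.filter (fun i => i.1 = i.2), g i‖ ≤ 2 * (X / m * (S / A)) := by
    refine (norm_sum_le_of_le _ fun i _ => hg2 i).trans ?_
    rw [sum_const, nsmul_eq_mul, mul_comm]
    exact mul_le_mul_of_nonneg_left (card_diagonal_le hm hA h𝒜 hS) zero_le_two
  have hgood : ∀ i ∈ J.filter (fun i => i.1 ≠ i.2), ∀ p ∈ 𝒮', ((p : ℤ) ∣ f (m * i.1 * i.2) ↔
      i.1 % p = τ p i.2 % p) := by
    intro i hi p hp
    rw [mem_filter, mem_goodPairs] at hi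
    obtain ⟨⟨h1, h2, h3⟩, h4⟩ := hi
    have hP := h𝒜 _ h1.1
    have hQ := h𝒜 _ h2.1
    have hp' := h𝒮 p (mem_filter.1 hp).1
    have hpΔ : ¬ (p : ℤ) ∣ Δ := (mem_filter.1 hp).2
    have h6 : f (m * i.1 * i.2) = (i.1 : ℤ) * a (m * i.2) + b (m * i.2) := by
      rw [mul_right_comm, hrec _ (Nat.mul_pos hm hQ.1.pos) _ hP.1]
      rw [hP.1.dvd_mul, Nat.prime_dvd_prime_iff_eq hP.1 hQ.1]
      exact fun h => h.elim h1.2 h4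
    have haff := affine_of_recursion hrec hm hR₁ hR₂ hQ.1 hne hR₁m hR₂m h2.2.1
    rw [h6]
    refine dvd_iff_mod_eq_fibreResidue hp'.1 (by rw [hdet]; exact hpΔ)
      (fun h => hpΔ (dvd_mul_of_dvd_left h _)) ?_ haff.1 haff.2
    rw [Nat.prime_dvd_prime_iff_eq hp'.1 hP.1]
    omega
  have hB3 : ‖∑ i ∈ J.filter (fun i => i.1 ≠ i.2), ((1 + z) ^ W i - (1 + z) ^ W' i)‖ ≤
      2 * (nb * (X / m * (2 * S / y))) := by
    have hpt : ∀ i ∈ J.filter (fun i => i.1 ≠ i.2), ‖(1 + z) ^ W i - (1 + z) ^ W' i‖ ≤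
        ∑ p ∈ 𝒮.filter (fun p : ℕ => ¬ ¬ (p : ℤ) ∣ Δ),
          2 * (if (p : ℤ) ∣ f (m * i.1 * i.2) then (1 : ℝ) else 0) := by
      intro i hi
      by_cases hex : ∃ p ∈ 𝒮.filter (fun p : ℕ => ¬ ¬ (p : ℤ) ∣ Δ), (p : ℤ) ∣ f (m * i.1 * i.2)
      · obtain ⟨p, hp, hpf⟩ := hex
        have h1 : ‖(1 + z) ^ W i - (1 + z) ^ W' i‖ ≤ 2 := by
          refine (norm_sub_le _ _).trans ?_
          rw [hpow, hpow]; norm_num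
        refine h1.trans ?_
        have h2 := single_le_sum (f := fun p : ℕ => 2 * (if (p : ℤ) ∣ f (m * i.1 * i.2) then (1 : ℝ) else 0))
          (fun q _ => by positivity) hp
        simpa [hpf] using h2
      · have hWW : W i = W' i := by
          simp only [hW, hW']
          congr 1
          ext p
          simp only [h𝒮', mem_filter]
          constructor
          · rintro ⟨h1, h2⟩
            have h3 : ¬ (p : ℤ) ∣ Δ := fun h => hex ⟨p, mem_filter.2 ⟨h1, not_not.2 h⟩, h2⟩
            exact ⟨⟨h1, h3⟩, (hgood i hi p (mem_filter.2 ⟨h1, h3⟩)).1 h2⟩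
          · rintro ⟨⟨h1, h3⟩, h2⟩
            exact ⟨h1, (hgood i hi p (mem_filter.2 ⟨h1, h3⟩)).2 h2⟩
        rw [hWW, sub_self, norm_zero]
        exact sum_nonneg fun _ _ => by positivity
    refine (norm_sum_le_of_le _ hpt).trans ?_
    rw [sum_comm]
    simp only [← mul_sum]
    refine mul_le_mul_of_nonneg_left ?_ zero_le_two
    calc _ ≤ ∑ p ∈ 𝒮.filter (fun p : ℕ => ¬ ¬ (p : ℤ) ∣ Δ), X / m * (2 * S / y) := by
          refine sum_le_sum fun p hp => ?_
          rw [sum_boole, filter_filter]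
          have hp' := h𝒮 p (mem_filter.1 hp).1
          exact card_dvd_value_le hrec hm hy (mem_filter.1 hp).1 hp'.1 hp'.2.1 hp'.2.2 h𝒜 hS
      _ ≤ _ := by
          rw [sum_const, nsmul_eq_mul]
          exact mul_le_mul_of_nonneg_right (by exact_mod_cast hnb) (by positivity)
  have hB4 : ‖∑ i ∈ J.filter (fun i => i.1 ≠ i.2), (M' - M)‖ ≤ (X / m * S) * (nb / y) := by
    rw [sum_const, nsmul_eq_mul, norm_mul, Complex.norm_natCast]
    refine mul_le_mul ?_ hMM (norm_nonneg _) (by positivity)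
    refine le_trans ?_ (card_goodPairs_le (a := a) (b := b) (𝒮 := 𝒮) hm (fun P hP => (h𝒜 P hP).1) hS)
    exact_mod_cast card_filter_le _ _
  have hsplit : ∑ i ∈ J.filter (fun i => i.1 ≠ i.2), ((1 + z) ^ W i - M) =
      (∑ i ∈ J, g i - ∑ i ∈ J.filter (fun i => i.1 = i.2), g i) +
      ∑ i ∈ J.filter (fun i => i.1 ≠ i.2), ((1 + z) ^ W i - (1 + z) ^ W' i) +
      ∑ i ∈ J.filter (fun i => i.1 ≠ i.2), (M' - M) := by
    rw [← sum_filter_add_sum_filter_not J (fun i => i.1 = i.2) g, add_sub_cancel_left,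
      ← sum_add_distrib, ← sum_add_distrib]
    refine sum_congr rfl fun i _ => ?_
    simp only [hg]; ring
  rw [hsplit]
  refine (norm_add₃_le).trans ?_
  have := norm_sub_le (∑ i ∈ J, g i) (∑ i ∈ J.filter (fun i => i.1 = i.2), g i)
  have e : X / m * (2 * (1 + Real.log (X + 1)) * blockError k y D H β μ + 2 * (S / A) + 5 * nb * S / y) =
    X / m * (2 * (1 + Real.log (X + 1)) * blockError k y D H β μ) + 2 * (X / m * (S / A)) +
      2 * (nb * (X / m * (2 * S / y))) + (X / m * S) * (nb / y) := by
    field_simp; ring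
  rw [e]
  linarith

end Pairs

section Pairs
open Finset

variable {f a b : ℕ → ℤ}

lemma card_le_sum_of_forall_fst_fibre_le {s : Finset (ℕ × ℕ)} {t : Finset ℕ} (hs : ∀ i ∈ s, i.1 ∈ t)
    {F : ℕ → ℝ} (hF : ∀ P ∈ t, (#(s.filter (fun i => i.1 = P)) : ℝ) ≤ F P) :
    (#s : ℝ) ≤ ∑ P ∈ t, F P := by
  rw [card_eq_sum_card_fiberwise (f := Prod.fst) (t := t) (fun i hi => hs i hi)]
  push_cast
  exact sum_le_sum hF

lemma card_goodPairs_le_of_det_eq_zero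
    (hrec : ∀ m : ℕ, 0 < m → ∀ P : ℕ, P.Prime → ¬ P ∣ m → f (m * P) = (P : ℤ) * a m + b m)
    {X A D m nb : ℕ} (hm : 0 < m) (hD1 : 1 ≤ D) (hDA : D ^ 4 ≤ A)
    {𝒜 𝒮 : Finset ℕ} (h𝒜 : ∀ P ∈ 𝒜, P.Prime ∧ A < P) (h𝒮 : ∀ p ∈ 𝒮, p.Prime)
    {S : ℝ} (hS : ∑ P ∈ 𝒜, 1 / (P : ℝ) ≤ S) {G : ℝ} (hG0 : 0 < G)
    (hG : ∀ 𝒢 ⊆ 𝒮, #(𝒮 \ 𝒢) ≤ nb → G ≤ ∑ p ∈ 𝒢, 1 / (p : ℝ) * Real.log ((D : ℝ) / p))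
    {R₁ R₂ : ℕ} (hR₁ : R₁.Prime) (hR₂ : R₂.Prime) (hne : R₁ ≠ R₂) (hR₁m : ¬ R₁ ∣ m) (hR₂m : ¬ R₂ ∣ m)
    (hdet : a (m * R₁) * b (m * R₂) - a (m * R₂) * b (m * R₁) = 0)
    (hnb : #(𝒮.filter (fun p : ℕ => (p : ℤ) ∣ ((R₁ : ℤ) - R₂) * (a (m * R₁) - a (m * R₂)) *
      (b (m * R₁) - b (m * R₂)))) ≤ nb) :
    (#(goodPairs a b 𝒜 𝒮 X m) : ℝ) ≤ X / m * (12 * S / G) := by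
  have hm' : (0 : ℝ) < m := by exact_mod_cast hm
  have haff := fun (P : ℕ) (hP : P.Prime) (hPm : ¬ P ∣ m) =>
    affine_of_recursion hrec hm hR₁ hR₂ hP hne hR₁m hR₂m hPm
  have hdet₀ := det_of_recursion hrec hm hR₁ hR₂ hne hR₁m hR₂m
  rw [hdet, mul_zero] at hdet₀
  generalize (R₁ : ℤ) - R₂ = δ at *
  generalize a (m * R₁) - a (m * R₂) = α at *
  generalize b (m * R₁) - b (m * R₂) = β at *
  generalize (R₁ : ℤ) * b (m * R₂) - R₂ * b (m * R₁) = γ at *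
  have hdet' : α * γ - β ^ 2 = 0 := by
    exact hdet₀
  set 𝒢 := 𝒮.filter (fun p : ℕ => ¬ (p : ℤ) ∣ δ * α * β) with h𝒢
  have hG' := hG 𝒢 (filter_subset _ _) (by
    rw [h𝒢, ← filter_not]
    simpa only [not_not] using hnb)
  set r : ℕ → ℕ := fun p => (-(β : ZMod p) * (α : ZMod p)⁻¹).val with hr
  have hrp : ∀ p ∈ 𝒢, ¬ p ∣ r p := by
    intro p hp hdvd
    rw [mem_filter] at hp
    have := Fact.mk (h𝒮 p hp.1)
    have hα0 : (α : ZMod p) ≠ 0 := fun h => hp.2 (dvd_mul_of_dvd_left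
      (dvd_mul_of_dvd_right ((ZMod.intCast_zmod_eq_zero_iff_dvd _ _).1 h) _) _)
    have hβ0 : (β : ZMod p) ≠ 0 := fun h => hp.2 (dvd_mul_of_dvd_right
      ((ZMod.intCast_zmod_eq_zero_iff_dvd _ _).1 h) _)
    rw [← ZMod.natCast_eq_zero_iff, hr, ZMod.natCast_zmod_val] at hdvd
    exact mul_ne_zero (neg_ne_zero.2 hβ0) (inv_ne_zero hα0) hdvd
  refine (card_le_sum_of_forall_fst_fibre_le (t := 𝒜) (fun i hi => (mem_goodPairs.1 hi).1.1)
    (F := fun P => X / m * (12 / G) * (1 / (P : ℝ))) ?_).trans ?_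
  · intro P hP
    have hP0 : 0 < P := (h𝒜 P hP).1.pos
    set s := (goodPairs a b 𝒜 𝒮 X m).filter (fun i => i.1 = P) with hs
    rcases s.eq_empty_or_nonempty with h0 | ⟨i₀, hi₀⟩
    · rw [h0]; simp; positivity
    have hmem : ∀ i ∈ s, i.2 ≤ X / (m * P) ∧ i.2.Prime ∧ A < i.2 ∧ i.1 = P ∧ ¬ i.2 ∣ m ∧
        ∀ p ∈ 𝒮, ¬ ((p : ℤ) ∣ a (m * i.2) ∧ (p : ℤ) ∣ b (m * i.2)) := by
      intro i hi
      simp only [hs, mem_filter, mem_goodPairs] at hi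
      obtain ⟨⟨h1, h2, h3⟩, rfl⟩ := hi
      refine ⟨?_, (h𝒜 _ h2.1).1, (h𝒜 _ h2.1).2, rfl, h2.2.1, h2.2.2⟩
      rw [Nat.le_div_iff_mul_le (by positivity), mul_comm]
      exact h3
    have hN : D ^ 4 ≤ X / (m * P) := by
      have := hmem i₀ hi₀
      omega
    have hDA' : D ≤ A := (Nat.le_self_pow (by norm_num) D).trans hDA
    have key := card_primes_avoiding_mul_le hD1 hN 𝒢 (fun p hp => h𝒮 p (mem_filter.1 hp).1) r hrp
      (s.image Prod.snd) (by
        intro Q hQ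
        obtain ⟨i, hi, rfl⟩ := mem_image.1 hQ
        obtain ⟨h1, h2, h3, h4, h5, h6⟩ := hmem i hi
        refine ⟨h1, h2, by omega, fun p hp hmod => ?_⟩
        rw [mem_filter] at hp
        have := Fact.mk (h𝒮 p hp.1)
        have hα0 : (α : ZMod p) ≠ 0 := fun h => hp.2 (dvd_mul_of_dvd_left
          (dvd_mul_of_dvd_right ((ZMod.intCast_zmod_eq_zero_iff_dvd _ _).1 h) _) _)
        have hδ0 : (δ : ZMod p) ≠ 0 := fun h => hp.2 (dvd_mul_of_dvd_left
          (dvd_mul_of_dvd_left ((ZMod.intCast_zmod_eq_zero_iff_dvd _ _).1 h) _) _)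
        have e1 : (δ : ZMod p) * (a (m * i.2) : ℤ) = α * (i.2 : ℕ) + β := by
          exact_mod_cast congrArg (Int.cast : ℤ → ZMod p) (haff _ h2 h5).1
        have e2 : (δ : ZMod p) * (b (m * i.2) : ℤ) = β * (i.2 : ℕ) + γ := by
          exact_mod_cast congrArg (Int.cast : ℤ → ZMod p) (haff _ h2 h5).2
        have e3 : (α : ZMod p) * γ - (β : ZMod p) ^ 2 = 0 := by
          exact_mod_cast congrArg (Int.cast : ℤ → ZMod p) hdet'
        have e4 : ((i.2 : ℕ) : ZMod p) = -(β : ZMod p) * (α : ZMod p)⁻¹ := by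
          rw [← ZMod.natCast_zmod_val (-(β : ZMod p) * (α : ZMod p)⁻¹)]
          exact (ZMod.natCast_eq_natCast_iff' _ _ _).2 hmod
        have e5 : (α : ZMod p) * (i.2 : ℕ) + β = 0 := by
          rw [e4]; field_simp; ring
        refine h6 p hp.1 ⟨?_, ?_⟩
        · rw [← ZMod.intCast_zmod_eq_zero_iff_dvd]
          rw [e5] at e1
          exact (mul_eq_zero.1 e1).resolve_left hδ0
        · rw [← ZMod.intCast_zmod_eq_zero_iff_dvd]
          have : (α : ZMod p) * ((δ : ZMod p) * (b (m * i.2) : ℤ)) = 0 := by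
            rw [e2]
            linear_combination (β : ZMod p) * e5 + e3
          exact (mul_eq_zero.1 ((mul_eq_zero.1 this).resolve_left hα0)).resolve_left hδ0)
    rw [card_image_of_injOn (fun i hi j hj h => Prod.ext
      ((hmem i hi).2.2.2.1.trans (hmem j hj).2.2.2.1.symm) h)] at key
    have h1 : (#s : ℝ) * G ≤ 12 * (X / (m * P : ℕ)) := by
      refine (mul_le_mul_of_nonneg_left hG' (Nat.cast_nonneg _)).trans (key.trans ?_)
      gcongr
      exact Nat.cast_div_le
    calc (#s : ℝ) ≤ 12 * (X / (m * P : ℕ)) / G := by rwa [le_div_iff₀ hG0]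
      _ = _ := by push_cast; field_simp
  · rw [← mul_sum]
    calc _ ≤ X / m * (12 / G) * S := mul_le_mul_of_nonneg_left hS (by positivity)
      _ = _ := by ring

lemma norm_sum_goodPairs_le
    (ha0 : ∀ m : ℕ, 1 < m → a m ≠ 0) (hb0 : ∀ m : ℕ, 1 < m → b m ≠ 0)
    (hrec : ∀ m : ℕ, 0 < m → ∀ P : ℕ, P.Prime → ¬ P ∣ m → f (m * P) = (P : ℤ) * a m + b m)
    {X A H D D' y k nb m : ℕ} (hm : 0 < m) (hH : 0 < H) (hy : 0 < y) (hDA : D ≤ A) (hA : 0 < A)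
    (hD1 : 1 ≤ D') (hDA' : D' ^ 4 ≤ A)
    {𝒜 𝒮 : Finset ℕ} (h𝒜 : ∀ P ∈ 𝒜, P.Prime ∧ A < P) (h𝒮 : ∀ p ∈ 𝒮, p.Prime ∧ y < p ∧ p ≤ A)
    (hD : ∀ U ⊆ 𝒮, #U ≤ k → ∏ p ∈ U, p ≤ D) {S : ℝ} (hS : ∑ P ∈ 𝒜, 1 / (P : ℝ) ≤ S)
    {β μ : ℝ} (hβ : 1 ≤ β) (hμ : ∑ p ∈ 𝒮, 1 / (p : ℝ) ≤ μ) {z : ℂ} (hz : ‖1 + z‖ = 1) (hz1 : ‖z‖ ≤ 1)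
    {G : ℝ} (hG0 : 0 < G)
    (hG : ∀ 𝒢 ⊆ 𝒮, #(𝒮 \ 𝒢) ≤ nb → G ≤ ∑ p ∈ 𝒢, 1 / (p : ℝ) * Real.log ((D' : ℝ) / p))
    {V : ℝ} (haV : ∀ n : ℕ, 1 < n → n ≤ X → (|a n| : ℝ) ≤ V) (hbV : ∀ n : ℕ, 1 < n → n ≤ X → (|b n| : ℝ) ≤ V)
    (hnb : ∀ v : ℤ, v ≠ 0 → (|v| : ℝ) ≤ 4 * X * V ^ 2 → #(𝒮.filter (fun p : ℕ => (p : ℤ) ∣ v)) ≤ nb) :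
    ‖∑ i ∈ (goodPairs a b 𝒜 𝒮 X m).filter (fun i => i.1 ≠ i.2),
      ((1 + z) ^ #(𝒮.filter (fun p : ℕ => (p : ℤ) ∣ f (m * i.1 * i.2))) - ∏ p ∈ 𝒮, (1 + z / p))‖ ≤
      X / m * (2 * (1 + Real.log (X + 1)) * blockError k y D H β μ + 2 * (S / A) + 5 * nb * S / y +
        24 * S / G) + 2 * #(boundaryPairs a b 𝒜 𝒮 X H m) := by
  have hm' : (0 : ℝ) < m := by exact_mod_cast hm
  have hy' : (0 : ℝ) < y := by exact_mod_cast hy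
  have hA' : (0 : ℝ) < A := by exact_mod_cast hA
  have hS0 : 0 ≤ S := le_trans (sum_nonneg fun _ _ => by positivity) hS
  have hη := blockError_nonneg k y D H hβ μ
  have hlog : 0 ≤ Real.log ((X : ℝ) + 1) := Real.log_nonneg (by linarith [Nat.cast_nonneg (α := ℝ) X])
  have hmain : 0 ≤ 2 * (1 + Real.log ((X : ℝ) + 1)) * blockError k y D H β μ + 2 * (S / A) +
      5 * nb * S / y := by positivity
  rcases ((goodPairs a b 𝒜 𝒮 X m).filter (fun i => i.1 ≠ i.2)).eq_empty_or_nonempty with h0 | ⟨⟨R₁, R₂⟩, hi⟩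
  · rw [h0, sum_empty, norm_zero]
    have : 0 ≤ 24 * S / G := by positivity
    positivity
  · rw [mem_filter, mem_goodPairs] at hi
    obtain ⟨⟨⟨h1, h1'⟩, ⟨h2, h2', -⟩, h3⟩, hne⟩ := hi
    simp only at h1 h1' h2 h2' h3 hne
    have hR₁ := (h𝒜 _ h1).1
    have hR₂ := (h𝒜 _ h2).1
    have hmR₁ : 1 < m * R₁ := lt_of_lt_of_le hR₁.one_lt (Nat.le_mul_of_pos_left _ hm)
    have hmR₂ : 1 < m * R₂ := lt_of_lt_of_le hR₂.one_lt (Nat.le_mul_of_pos_left _ hm)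
    have hX₁ : m * R₁ ≤ X := (Nat.le_mul_of_pos_right _ hR₂.pos).trans h3
    have hX₂ : m * R₂ ≤ X := by
      rw [mul_right_comm] at h3
      exact (Nat.le_mul_of_pos_right _ hR₁.pos).trans h3
    have hA₁ := haV _ hmR₁ hX₁
    have hA₂ := haV _ hmR₂ hX₂
    have hB₁ := hbV _ hmR₁ hX₁
    have hB₂ := hbV _ hmR₂ hX₂
    have hV0 : 0 ≤ V := (abs_nonneg _).trans hA₁
    have hδ0 : (R₁ : ℤ) - R₂ ≠ 0 := sub_ne_zero.2 (by exact_mod_cast hne)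
    have hδX : |(R₁ : ℝ) - R₂| ≤ X := by
      have e1 : (R₁ : ℝ) ≤ X := by exact_mod_cast (Nat.le_mul_of_pos_left _ hm).trans hX₁
      have e2 : (R₂ : ℝ) ≤ X := by exact_mod_cast (Nat.le_mul_of_pos_left _ hm).trans hX₂
      rw [abs_le]
      constructor <;> linarith [Nat.cast_nonneg (α := ℝ) R₁, Nat.cast_nonneg (α := ℝ) R₂]
    by_cases hdet : a (m * R₁) * b (m * R₂) - a (m * R₂) * b (m * R₁) = 0
    · have hdet' := det_of_recursion hrec hm hR₁ hR₂ hne h1' h2'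
      rw [hdet, mul_zero] at hdet'
      have haff := affine_of_recursion hrec hm hR₁ hR₂ hR₁ hne h1' h2' h1'
      have hα0 : a (m * R₁) - a (m * R₂) ≠ 0 := by
        intro h
        rw [h, zero_mul, zero_sub, neg_eq_zero, sq_eq_zero_iff] at hdet'
        rw [h, hdet', zero_mul, zero_add] at haff
        exact (mul_ne_zero hδ0 (ha0 _ hmR₁)) haff.1
      have hβ0 : b (m * R₁) - b (m * R₂) ≠ 0 := by
        intro h
        rw [h, zero_pow two_ne_zero, sub_zero] at hdet'
        have := (mul_eq_zero.1 hdet').resolve_left hα0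
        rw [h, this, zero_mul, zero_add] at haff
        exact (mul_ne_zero hδ0 (hb0 _ hmR₁)) haff.2
      have hcard := card_goodPairs_le_of_det_eq_zero (X := X) hrec hm hD1 hDA' h𝒜
        (fun p hp => (h𝒮 p hp).1) hS hG0 hG hR₁ hR₂ hne h1' h2' hdet
        (hnb _ (mul_ne_zero (mul_ne_zero hδ0 hα0) hβ0) (by
          push_cast
          rw [abs_mul, abs_mul]
          have e1 : |(a (m * R₁) : ℝ) - a (m * R₂)| ≤ 2 * V := (abs_sub _ _).trans (by linarith)
          have e2 : |(b (m * R₁) : ℝ) - b (m * R₂)| ≤ 2 * V := (abs_sub _ _).trans (by linarith)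
          calc _ ≤ (X : ℝ) * (2 * V) * (2 * V) := by gcongr
            _ = _ := by ring))
      have hM1 : ‖∏ p ∈ 𝒮, (1 + z / p)‖ ≤ 1 := by
        rw [norm_prod]
        exact prod_le_one (fun _ _ => norm_nonneg _) fun p hp =>
          norm_one_add_div_le_one hz (h𝒮 p hp).1.pos
      have hpt : ∀ i ∈ (goodPairs a b 𝒜 𝒮 X m).filter (fun i => i.1 ≠ i.2),
          ‖(1 + z) ^ #(𝒮.filter (fun p : ℕ => (p : ℤ) ∣ f (m * i.1 * i.2))) -
            ∏ p ∈ 𝒮, (1 + z / p)‖ ≤ (2 : ℝ) := by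
        intro i _
        refine (norm_sub_le _ _).trans ?_
        rw [norm_pow, hz, one_pow]; linarith
      refine (norm_sum_le_of_le _ hpt).trans ?_
      · rw [sum_const, nsmul_eq_mul]
        have hle : (#((goodPairs a b 𝒜 𝒮 X m).filter (fun i => i.1 ≠ i.2)) : ℝ) ≤
            #(goodPairs a b 𝒜 𝒮 X m) := by exact_mod_cast card_filter_le _ _
        have hb : (0 : ℝ) ≤ #(boundaryPairs a b 𝒜 𝒮 X H m) := Nat.cast_nonneg _
        have hX : (0 : ℝ) ≤ X / m := by positivity
        have h5 := mul_nonneg hX hmain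
        have h6 : X / m * (24 * S / G) = X / m * (12 * S / G) * 2 := by ring
        rw [mul_add, h6]
        linarith
    · have h := norm_sum_goodPairs_le_of_det_ne_zero (X := X) hrec hm hH hy hDA hA h𝒜 h𝒮 hD hS hβ hμ
        hz hz1 hR₁ hR₂ hne h1' h2' (nb := nb) (by
          simp only [not_not]
          refine hnb _ (mul_ne_zero hδ0 hdet) ?_
          push_cast
          rw [abs_mul]
          have e1 : |(a (m * R₁) : ℝ) * b (m * R₂) - a (m * R₂) * b (m * R₁)| ≤ 2 * V ^ 2 := by
            refine (abs_sub _ _).trans ?_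
            rw [abs_mul, abs_mul]
            have e2 : |(a (m * R₁) : ℝ)| * |(b (m * R₂) : ℝ)| ≤ V * V := by gcongr
            have e3 : |(a (m * R₂) : ℝ)| * |(b (m * R₁) : ℝ)| ≤ V * V := by gcongr
            linarith
          calc _ ≤ (X : ℝ) * (2 * V ^ 2) := by gcongr
            _ ≤ _ := by nlinarith [mul_nonneg (Nat.cast_nonneg (α := ℝ) X) (sq_nonneg V)])
      refine h.trans (add_le_add (mul_le_mul_of_nonneg_left ?_ (by positivity)) le_rfl)
      have : 0 ≤ 24 * S / G := by positivity
      linarith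

end Pairs

section Averaging
open Finset

lemma sum_filter_dvd_eq_sum_mul {E : Type*} [AddCommMonoid E] (X : ℕ) {d : ℕ} (hd : 0 < d) (h : ℕ → E) :
    ∑ n ∈ (Icc 1 X).filter (fun n => d ∣ n), h n = ∑ m ∈ (Icc 1 X).filter (fun m => m * d ≤ X), h (m * d) := by
  refine (sum_nbij' (fun m => m * d) (fun n => n / d) ?_ ?_ ?_ ?_ ?_).symm
  · intro m hm
    simp only [mem_filter, mem_Icc] at hm ⊢
    exact ⟨⟨Nat.mul_pos hm.1.1 hd, hm.2⟩, dvd_mul_left _ _⟩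
  · intro n hn
    simp only [mem_filter, mem_Icc] at hn ⊢
    obtain ⟨⟨h1, h2⟩, k, rfl⟩ := hn
    rw [Nat.mul_div_cancel_left _ hd]
    refine ⟨⟨Nat.pos_of_ne_zero fun h => by simp [h] at h1, (Nat.le_mul_of_pos_left _ hd).trans h2⟩, ?_⟩
    rwa [mul_comm]
  · intro m _
    exact Nat.mul_div_cancel _ hd
  · intro n hn
    exact Nat.div_mul_cancel (mem_filter.1 hn).2
  · intro _ _; rfl

lemma card_filter_dvd_eq_div (X : ℕ) (d : ℕ) : #((Icc 1 X).filter (fun n => d ∣ n)) = X / d := by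
  rw [← Nat.Ioc_filter_dvd_card_eq_div]; rfl

lemma sum_card_filter_dvd_eq (𝒜 : Finset ℕ) (X : ℕ) :
    ∑ n ∈ Icc 1 X, (#(𝒜.filter (· ∣ n)) : ℝ) = ∑ P ∈ 𝒜, ((X / P : ℕ) : ℝ) := by
  simp_rw [card_filter, Nat.cast_sum]
  rw [sum_comm]
  refine sum_congr rfl fun P _ => ?_
  rw [← card_filter_dvd_eq_div, card_filter, Nat.cast_sum]

/-- The Turán–Kubilius inequality for the number of prime factors in a set `𝒜`. -/
lemma sum_sq_card_filter_dvd_sub_le {𝒜 : Finset ℕ} {X : ℕ} (h𝒜 : ∀ P ∈ 𝒜, P.Prime ∧ P ≤ X) {S : ℝ}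
    (hS : ∑ P ∈ 𝒜, 1 / (P : ℝ) = S) :
    ∑ n ∈ Icc 1 X, ((#(𝒜.filter (· ∣ n)) : ℝ) - S) ^ 2 ≤ 3 * X * S := by
  have hS0 : 0 ≤ S := hS ▸ sum_nonneg fun _ _ => by positivity
  have h1 : ∑ n ∈ Icc 1 X, (#(𝒜.filter (· ∣ n)) : ℝ) ≤ X * S := by
    rw [sum_card_filter_dvd_eq, ← hS, mul_sum]
    refine sum_le_sum fun P _ => Nat.cast_div_le.trans (le_of_eq (by ring))
  have h2 : X * S - X ≤ ∑ n ∈ Icc 1 X, (#(𝒜.filter (· ∣ n)) : ℝ) := by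
    rw [sum_card_filter_dvd_eq, ← hS, mul_sum]
    have hc : (#𝒜 : ℝ) ≤ X := by
      have : #𝒜 ≤ #(Icc 1 X) := card_le_card fun P hP => mem_Icc.2 ⟨(h𝒜 P hP).1.pos, (h𝒜 P hP).2⟩
      rw [Nat.card_Icc, Nat.add_sub_cancel] at this
      exact_mod_cast this
    have : ∑ P ∈ 𝒜, ((X : ℝ) * (1 / P) - 1) ≤ ∑ P ∈ 𝒜, ((X / P : ℕ) : ℝ) := by
      refine sum_le_sum fun P hP => ?_
      have := Nat.lt_floor_add_one ((X : ℝ) / P)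
      rw [Nat.floor_div_natCast, Nat.floor_natCast] at this
      rw [mul_one_div]; linarith
    rw [sum_sub_distrib, sum_const, nsmul_eq_mul, mul_one] at this
    linarith
  have h3 : ∑ n ∈ Icc 1 X, (#(𝒜.filter (· ∣ n)) : ℝ) ^ 2 ≤ X * S + X * S ^ 2 := by
    have e1 : ∀ n ∈ Icc 1 X, (#(𝒜.filter (· ∣ n)) : ℝ) ^ 2 =
        ∑ P ∈ 𝒜, ∑ Q ∈ 𝒜, if P ∣ n ∧ Q ∣ n then (1 : ℝ) else 0 := by
      intro n _
      rw [sq, card_filter, Nat.cast_sum, sum_mul_sum]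
      refine sum_congr rfl fun P _ => sum_congr rfl fun Q _ => ?_
      by_cases hP : P ∣ n <;> by_cases hQ : Q ∣ n <;> simp [hP, hQ]
    rw [sum_congr rfl e1, sum_comm]
    have e2 : ∀ P ∈ 𝒜, ∑ n ∈ Icc 1 X, ∑ Q ∈ 𝒜, (if P ∣ n ∧ Q ∣ n then (1 : ℝ) else 0) ≤
        X * (1 / (P : ℝ)) + ∑ Q ∈ 𝒜, (X : ℝ) * (1 / (P : ℝ)) * (1 / (Q : ℝ)) := by
      intro P hP
      rw [sum_comm, ← add_sum_erase _ _ hP]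
      refine add_le_add ?_ ?_
      · simp only [and_self]
        rw [sum_boole, card_filter_dvd_eq_div]
        exact Nat.cast_div_le.trans (le_of_eq (by ring))
      · refine (sum_le_sum (g := fun Q : ℕ => X * (1 / (P : ℝ)) * (1 / Q)) fun Q hQ => ?_).trans
          (sum_le_sum_of_subset_of_nonneg (erase_subset _ _) fun _ _ _ => by positivity)
        have hcop : Nat.Coprime P Q := (Nat.coprime_primes (h𝒜 P hP).1 (h𝒜 Q (mem_of_mem_erase hQ)).1).2
          (ne_of_mem_erase hQ).symm
        have : ∀ n, (P ∣ n ∧ Q ∣ n) ↔ P * Q ∣ n := fun n =>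
          ⟨fun h => hcop.mul_dvd_of_dvd_of_dvd h.1 h.2,
            fun h => ⟨(dvd_mul_right _ _).trans h, (dvd_mul_left _ _).trans h⟩⟩
        simp_rw [this]
        rw [sum_boole, card_filter_dvd_eq_div]
        refine Nat.cast_div_le.trans (le_of_eq ?_)
        push_cast
        rw [mul_assoc, one_div_mul_one_div, mul_one_div]
    refine (sum_le_sum e2).trans (le_of_eq ?_)
    rw [sum_add_distrib]
    have : ∑ P ∈ 𝒜, ∑ Q ∈ 𝒜, (X : ℝ) * (1 / (P : ℝ)) * (1 / (Q : ℝ)) = X * S ^ 2 := by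
      simp_rw [← mul_sum, hS, ← sum_mul, ← mul_sum, hS]
      ring
    rw [this, ← mul_sum, hS]
  have h4 : ∑ n ∈ Icc 1 X, ((#(𝒜.filter (· ∣ n)) : ℝ) - S) ^ 2 =
      ∑ n ∈ Icc 1 X, (#(𝒜.filter (· ∣ n)) : ℝ) ^ 2 - 2 * S * ∑ n ∈ Icc 1 X, (#(𝒜.filter (· ∣ n)) : ℝ) +
        X * S ^ 2 := by
    simp_rw [sub_sq, sum_add_distrib, sum_sub_distrib, mul_sum, sum_const, Nat.card_Icc, nsmul_eq_mul]
    congr 2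
    exact sum_congr rfl fun _ _ => by ring
  rw [h4]
  nlinarith [mul_le_mul_of_nonneg_left h2 hS0]

lemma sum_abs_sq_sub_card_mul_le {𝒜 : Finset ℕ} {X : ℕ} (h𝒜 : ∀ P ∈ 𝒜, P.Prime ∧ P ≤ X) {S : ℝ}
    (hS : ∑ P ∈ 𝒜, 1 / (P : ℝ) = S) :
    ∑ n ∈ Icc 1 X, |S ^ 2 - (#(𝒜.filter (· ∣ n)) : ℝ) * (#(𝒜.filter (· ∣ n)) - 1)| ≤
      X * (4 * S * √S + 4 * S) := by
  have hS0 : 0 ≤ S := hS ▸ sum_nonneg fun _ _ => by positivity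
  have h1 := sum_sq_card_filter_dvd_sub_le h𝒜 hS
  have h2 : ∑ n ∈ Icc 1 X, (#(𝒜.filter (· ∣ n)) : ℝ) ≤ X * S := by
    rw [sum_card_filter_dvd_eq, ← hS, mul_sum]
    refine sum_le_sum fun P _ => Nat.cast_div_le.trans (le_of_eq (by ring))
  have h3 : ∑ n ∈ Icc 1 X, |(#(𝒜.filter (· ∣ n)) : ℝ) - S| ≤ X * (2 * √S) := by
    have := sq_sum_le_card_mul_sum_sq (s := Icc 1 X) (f := fun n => |(#(𝒜.filter (· ∣ n)) : ℝ) - S|)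
    simp only [sq_abs, Nat.card_Icc, Nat.add_sub_cancel] at this
    refine abs_le_of_sq_le_sq' (this.trans ?_) (by positivity) |>.2
    rw [mul_pow, mul_pow, Real.sq_sqrt hS0]
    calc (X : ℝ) * _ ≤ X * (3 * X * S) := by gcongr
      _ ≤ _ := by nlinarith [mul_nonneg (sq_nonneg (X : ℝ)) hS0]
  have h4 : ∀ n ∈ Icc 1 X, |S ^ 2 - (#(𝒜.filter (· ∣ n)) : ℝ) * (#(𝒜.filter (· ∣ n)) - 1)| ≤
      2 * S * |(#(𝒜.filter (· ∣ n)) : ℝ) - S| + ((#(𝒜.filter (· ∣ n)) : ℝ) - S) ^ 2 +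
        #(𝒜.filter (· ∣ n)) := by
    intro n _
    generalize hw : (#(𝒜.filter (· ∣ n)) : ℝ) = w
    have hw0 : 0 ≤ w := hw ▸ Nat.cast_nonneg _
    have : S ^ 2 - w * (w - 1) = -(2 * S * (w - S)) + -(w - S) ^ 2 + w := by ring
    rw [this]
    refine (abs_add_three _ _ _).trans (le_of_eq ?_)
    rw [abs_neg, abs_mul, abs_of_nonneg hw0, abs_of_nonneg (by positivity : 0 ≤ 2 * S),
      abs_neg, abs_of_nonneg (sq_nonneg (w - S))]
  refine (sum_le_sum h4).trans ?_
  rw [sum_add_distrib, sum_add_distrib, ← mul_sum]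
  have := mul_le_mul_of_nonneg_left h3 (by positivity : 0 ≤ 2 * S)
  nlinarith

lemma sum_card_mul_eq_sum_sum_offDiag {𝒜 : Finset ℕ} {X : ℕ} (h𝒜 : ∀ P ∈ 𝒜, P.Prime) (g : ℕ → ℂ) :
    ∑ n ∈ Icc 1 X, ((#(𝒜.filter (· ∣ n)) : ℂ) * (#(𝒜.filter (· ∣ n)) - 1)) * g n =
      ∑ m ∈ Icc 1 X, ∑ i ∈ 𝒜.offDiag.filter (fun i => m * i.1 * i.2 ≤ X), g (m * i.1 * i.2) := by
  have e1 : ∀ n ∈ Icc 1 X, ((#(𝒜.filter (· ∣ n)) : ℂ) * (#(𝒜.filter (· ∣ n)) - 1)) * g n =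
      ∑ i ∈ 𝒜.offDiag, if i.1 * i.2 ∣ n then g n else 0 := by
    intro n _
    rw [← sum_filter, sum_const, nsmul_eq_mul]
    congr 1
    have : 𝒜.offDiag.filter (fun i => i.1 * i.2 ∣ n) = (𝒜.filter (· ∣ n)).offDiag := by
      ext ⟨P, Q⟩
      simp only [mem_filter, mem_offDiag]
      constructor
      · rintro ⟨⟨h1, h2, h3⟩, h4⟩
        exact ⟨⟨h1, (dvd_mul_right _ _).trans h4⟩, ⟨h2, (dvd_mul_left _ _).trans h4⟩, h3⟩
      · rintro ⟨⟨h1, h2⟩, ⟨h3, h4⟩, h5⟩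
        exact ⟨⟨h1, h3, h5⟩, ((Nat.coprime_primes (h𝒜 P h1) (h𝒜 Q h3)).2 h5).mul_dvd_of_dvd_of_dvd h2 h4⟩
    rw [this, offDiag_card, Nat.cast_sub (Nat.le_mul_self _)]
    push_cast; ring
  rw [sum_congr rfl e1, sum_comm]
  simp_rw [sum_filter]
  rw [sum_comm (s := Icc 1 X)]
  refine sum_congr rfl fun i hi => ?_
  rw [mem_offDiag] at hi
  rw [← sum_filter, sum_filter_dvd_eq_sum_mul X (Nat.mul_pos (h𝒜 _ hi.1).pos (h𝒜 _ hi.2.1).pos), sum_filter]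
  exact sum_congr rfl fun m _ => by rw [mul_assoc]

lemma sum_card_filter_fst_dvd_le {𝒜 : Finset ℕ} {X A : ℕ} (hA : 0 < A)
    (h𝒜 : ∀ P ∈ 𝒜, P.Prime ∧ A < P) {S : ℝ} (hS : ∑ P ∈ 𝒜, 1 / (P : ℝ) = S) :
    ∑ m ∈ Icc 1 X, (#((𝒜 ×ˢ 𝒜).filter (fun i => i.1 ∣ m ∧ m * i.1 * i.2 ≤ X)) : ℝ) ≤ X * (S ^ 2 / A) := by
  have hA' : (0 : ℝ) < A := by exact_mod_cast hA
  simp_rw [card_filter, Nat.cast_sum]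
  rw [sum_comm]
  have h1 : ∀ i ∈ 𝒜 ×ˢ 𝒜, ∑ m ∈ Icc 1 X, (((if i.1 ∣ m ∧ m * i.1 * i.2 ≤ X then 1 else 0 : ℕ)) : ℝ) ≤
      X / A * ((1 / (i.1 : ℝ)) * (1 / (i.2 : ℝ))) := by
    rintro ⟨P, Q⟩ hi
    rw [mem_product] at hi
    have hP := h𝒜 _ hi.1
    have hQ := h𝒜 _ hi.2
    simp only at hP hQ ⊢
    have hPA : (A : ℝ) < P := by exact_mod_cast hP.2
    have hP0 : (0 : ℝ) < P := hA'.trans hPA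
    have hQ0 : (0 : ℝ) < Q := by exact_mod_cast hQ.1.pos
    have hc : #((Icc 1 X).filter (fun m => P ∣ m ∧ m * P * Q ≤ X)) ≤ #((Icc 1 X).filter (fun n => P * P * Q ∣ n)) := by
      refine card_le_card_of_injOn (fun m => m * P * Q) ?_ ?_
      · intro m hm
        simp only [coe_filter, mem_Icc, Set.mem_ofPred_eq] at hm ⊢
        exact ⟨⟨Nat.mul_pos (Nat.mul_pos hm.1.1 hP.1.pos) hQ.1.pos, hm.2.2⟩,
          mul_dvd_mul_right (mul_dvd_mul_right hm.2.1 _) _⟩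
      · intro m _ m' _ h
        exact Nat.eq_of_mul_eq_mul_right hP.1.pos (Nat.eq_of_mul_eq_mul_right hQ.1.pos h)
    rw [card_filter_dvd_eq_div] at hc
    rw [← Nat.cast_sum, ← card_filter]
    calc (#((Icc 1 X).filter (fun m => P ∣ m ∧ m * P * Q ≤ X)) : ℝ) ≤ ((X / (P * P * Q) : ℕ) : ℝ) := by
          exact_mod_cast hc
      _ ≤ X / (P * P * Q : ℕ) := Nat.cast_div_le
      _ ≤ X / (A * P * Q : ℝ) := by push_cast; gcongr
      _ = _ := by field_simp
  refine (sum_le_sum h1).trans (le_of_eq ?_)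
  have h2 := sum_mul_sum 𝒜 𝒜 (fun P : ℕ => 1 / (P : ℝ)) (fun P : ℕ => 1 / (P : ℝ))
  rw [← mul_sum, sum_product, ← h2, hS]
  ring

end Averaging

section AveragingBounds
open Finset

lemma sum_sum_ite_mul_le_eq {𝒜 : Finset ℕ} {X : ℕ} (h𝒜 : ∀ P ∈ 𝒜, P.Prime) (h : ℕ → ℝ) :
    ∑ m ∈ Icc 1 X, ∑ Q ∈ 𝒜, (if m * Q ≤ X then h (m * Q) else 0) =
      ∑ n ∈ Icc 1 X, (#(𝒜.filter (· ∣ n)) : ℝ) * h n := by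
  rw [sum_comm]
  have e1 : ∀ n ∈ Icc 1 X, (#(𝒜.filter (· ∣ n)) : ℝ) * h n = ∑ Q ∈ 𝒜, if Q ∣ n then h n else 0 := by
    intro n _
    rw [← sum_filter, sum_const, nsmul_eq_mul]
  rw [sum_congr rfl e1, sum_comm (s := Icc 1 X)]
  refine sum_congr rfl fun Q hQ => ?_
  rw [← sum_filter, ← sum_filter, sum_filter_dvd_eq_sum_mul X (h𝒜 Q hQ).pos]

lemma sum_card_filter_mul_le {𝒜 : Finset ℕ} {X : ℕ} (h𝒜 : ∀ P ∈ 𝒜, P.Prime) {K W : ℝ} (hK0 : 0 ≤ K)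
    (hK : ∀ Y : ℕ, (#(𝒜.filter (· ≤ Y)) : ℝ) ≤ K * Y)
    (hW : ∀ n ∈ Icc 1 X, (#(𝒜.filter (· ∣ n)) : ℝ) ≤ W) (B : ℕ → Prop) [DecidablePred B] :
    ∑ m ∈ Icc 1 X, (#((𝒜 ×ˢ 𝒜).filter (fun i => B (m * i.2) ∧ m * i.1 * i.2 ≤ X)) : ℝ) ≤
      X * (K * W * ∑ n ∈ (Ioo 1 X).filter B, 1 / (n : ℝ)) := by
  have e1 : ∀ m ∈ Icc 1 X, (#((𝒜 ×ˢ 𝒜).filter (fun i => B (m * i.2) ∧ m * i.1 * i.2 ≤ X)) : ℝ) ≤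
      ∑ Q ∈ 𝒜, (if m * Q ≤ X then (if B (m * Q) ∧ 1 < m * Q ∧ m * Q < X then K * X * (1 / ((m * Q : ℕ) : ℝ)) else 0)
        else 0) := by
    intro m hm
    have hm1 := (mem_Icc.1 hm).1
    refine card_le_sum_of_forall_fibre_le (fun i hi => (mem_product.1 (mem_filter.1 hi).1).2) ?_
    intro Q hQ
    set s := ((𝒜 ×ˢ 𝒜).filter (fun i => B (m * i.2) ∧ m * i.1 * i.2 ≤ X)).filter (fun i => i.2 = Q) with hs
    rcases s.eq_empty_or_nonempty with h0 | ⟨i, hi⟩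
    · rw [h0, card_empty, Nat.cast_zero]
      split_ifs <;> positivity
    · simp only [hs, mem_filter, mem_product] at hi
      obtain ⟨⟨⟨h1, _⟩, h2, h3⟩, rfl⟩ := hi
      have hP := (h𝒜 _ h1).two_le
      have hQ2 := (h𝒜 _ hQ).two_le
      have h4 : 1 < m * i.2 := by nlinarith
      have h5 : m * i.2 < X := by
        refine lt_of_lt_of_le ?_ h3
        rw [mul_right_comm]
        nlinarith
      rw [if_pos h5.le, if_pos ⟨h2, h4, h5⟩]
      have hc : #s ≤ #(𝒜.filter (· ≤ X / (m * i.2))) := by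
        refine card_le_card_of_injOn Prod.fst ?_ ?_
        · intro j hj
          simp only [hs, coe_filter, mem_filter, mem_product, Set.mem_ofPred_eq] at hj ⊢
          obtain ⟨⟨⟨g1, _⟩, _, g3⟩, g4⟩ := hj
          refine ⟨g1, ?_⟩
          rw [Nat.le_div_iff_mul_le (by omega), ← g4]
          calc _ = m * j.1 * j.2 := by ring
            _ ≤ X := g3
        · intro j hj j' hj' h
          simp only [hs, coe_filter, mem_filter, Set.mem_ofPred_eq] at hj hj'
          exact Prod.ext h (hj.2.trans hj'.2.symm)
      calc (#s : ℝ) ≤ #(𝒜.filter (· ≤ X / (m * i.2))) := by exact_mod_cast hc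
        _ ≤ K * (X / (m * i.2) : ℕ) := hK _
        _ ≤ K * (X / (m * i.2 : ℕ)) := by gcongr; exact Nat.cast_div_le
        _ = _ := by ring
  refine (sum_le_sum e1).trans ?_
  rw [sum_sum_ite_mul_le_eq h𝒜 (fun n => if B n ∧ 1 < n ∧ n < X then K * X * (1 / (n : ℝ)) else 0)]
  have e2 : ∀ n ∈ Icc 1 X, (#(𝒜.filter (· ∣ n)) : ℝ) * (if B n ∧ 1 < n ∧ n < X then K * X * (1 / (n : ℝ)) else 0) ≤
      (if B n ∧ 1 < n ∧ n < X then W * (K * X * (1 / (n : ℝ))) else 0) := by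
    intro n hn
    split_ifs
    · exact mul_le_mul_of_nonneg_right (hW n hn) (by positivity)
    · rw [mul_zero]
  refine (sum_le_sum e2).trans (le_of_eq ?_)
  rw [← sum_filter]
  have : (Icc 1 X).filter (fun n => B n ∧ 1 < n ∧ n < X) = (Ioo 1 X).filter B := by
    ext n
    simp only [mem_filter, mem_Icc, mem_Ioo]
    constructor
    · rintro ⟨_, h1, h2, h3⟩; exact ⟨⟨h2, h3⟩, h1⟩
    · rintro ⟨⟨h1, h2⟩, h3⟩; exact ⟨⟨h1.le, h2.le⟩, h3, h1, h2⟩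
  rw [this, ← mul_sum, ← mul_sum]
  ring

lemma sum_card_boundaryPairs_le {a b : ℕ → ℤ} {𝒜 𝒮 : Finset ℕ} {X A H : ℕ} (hA : 0 < A)
    (h𝒜 : ∀ P ∈ 𝒜, P.Prime ∧ A < P) {W : ℝ}
    (hW : ∀ n ∈ Icc 1 X, (#(𝒜.filter (· ∣ n)) : ℝ) ≤ W) :
    ∑ m ∈ Icc 1 X, (#(boundaryPairs a b 𝒜 𝒮 X H m) : ℝ) ≤ W ^ 2 * (X * H / A + 1) := by
  obtain ⟨h, hh⟩ : ∃ h : ℕ → ℝ, h = fun n => if X * A < n * A + X * H then 1 else 0 := ⟨_, rfl⟩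
  have hh0 : ∀ n, 0 ≤ h n := fun n => by simp only [hh]; split_ifs <;> norm_num
  have e1 : ∀ m ∈ Icc 1 X, (#(boundaryPairs a b 𝒜 𝒮 X H m) : ℝ) ≤
      ∑ i ∈ 𝒜 ×ˢ 𝒜, if m * (i.1 * i.2) ≤ X then h (m * (i.1 * i.2)) else 0 := by
    intro m hm
    have hsub : boundaryPairs a b 𝒜 𝒮 X H m ⊆
        (𝒜 ×ˢ 𝒜).filter (fun i => m * (i.1 * i.2) ≤ X ∧ X * A < m * (i.1 * i.2) * A + X * H) := by
      intro i hi
      simp only [boundaryPairs, mem_filter, mem_goodPairs] at hi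
      obtain ⟨⟨h1, h2, h3⟩, h4⟩ := hi
      simp only [mem_filter, mem_product, ← mul_assoc]
      refine ⟨⟨h1.1, h2.1⟩, h3, ?_⟩
      have h5 : i.1 / H * H ≤ i.1 := Nat.div_mul_le_self _ _
      have h6 : m * i.2 * ((i.1 / H + 1) * H) ≤ m * i.2 * (i.1 + H) := by
        refine Nat.mul_le_mul_left _ ?_
        rw [add_mul, one_mul]; omega
      have h7 : m * i.2 * A ≤ X := by
        refine le_trans ?_ h3
        rw [mul_right_comm m i.1]
        exact Nat.mul_le_mul_left _ (h𝒜 _ h1.1).2.le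
      calc X * A < m * i.2 * (i.1 + H) * A := Nat.mul_lt_mul_of_pos_right (h4.trans_le h6) hA
        _ = m * i.1 * i.2 * A + m * i.2 * A * H := by ring
        _ ≤ _ := by gcongr
    calc (#(boundaryPairs a b 𝒜 𝒮 X H m) : ℝ) ≤ #((𝒜 ×ˢ 𝒜).filter (fun i => m * (i.1 * i.2) ≤ X ∧
          X * A < m * (i.1 * i.2) * A + X * H)) := by exact_mod_cast card_le_card hsub
      _ = _ := by
        rw [card_filter, Nat.cast_sum]
        refine sum_congr rfl fun i _ => ?_
        simp only [hh, ite_and]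
        split_ifs <;> simp
  refine (sum_le_sum e1).trans ?_
  rw [sum_comm]
  have e2 : ∀ i ∈ 𝒜 ×ˢ 𝒜, ∑ m ∈ Icc 1 X, (if m * (i.1 * i.2) ≤ X then h (m * (i.1 * i.2)) else 0) ≤
      ∑ n ∈ Icc 1 X, if i.1 ∣ n ∧ i.2 ∣ n then h n else 0 := by
    intro i hi
    rw [mem_product] at hi
    rw [← sum_filter, ← sum_filter, ← sum_filter_dvd_eq_sum_mul X
      (Nat.mul_pos (h𝒜 _ hi.1).1.pos (h𝒜 _ hi.2).1.pos)]
    refine sum_le_sum_of_subset_of_nonneg (fun n hn => ?_) fun n _ _ => hh0 n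
    rw [mem_filter] at hn ⊢
    exact ⟨hn.1, (dvd_mul_right _ _).trans hn.2, (dvd_mul_left _ _).trans hn.2⟩
  refine (sum_le_sum e2).trans ?_
  rw [sum_comm]
  have e3 : ∀ n ∈ Icc 1 X, ∑ i ∈ 𝒜 ×ˢ 𝒜, (if i.1 ∣ n ∧ i.2 ∣ n then h n else 0) ≤ W ^ 2 * h n := by
    intro n hn
    rw [← sum_filter, sum_const, nsmul_eq_mul]
    refine mul_le_mul_of_nonneg_right ?_ (hh0 n)
    rw [filter_product (· ∣ n) (· ∣ n), card_product, Nat.cast_mul, sq]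
    have := hW n hn
    gcongr
    exact (Nat.cast_nonneg _).trans this
  refine (sum_le_sum e3).trans ?_
  rw [← mul_sum]
  refine mul_le_mul_of_nonneg_left ?_ (sq_nonneg _)
  simp only [hh]
  rw [sum_boole]
  have hA' : (0 : ℝ) < A := by exact_mod_cast hA
  have hc : #((Icc 1 X).filter (fun n => X * A < n * A + X * H)) ≤ #(range (X * H / A + 1)) := by
    refine card_le_card_of_injOn (fun n => X - n) ?_ ?_
    · intro n hn
      simp only [coe_filter, mem_Icc, Set.mem_ofPred_eq] at hn
      rw [mem_coe, mem_range, Nat.lt_succ_iff, Nat.le_div_iff_mul_le hA, Nat.sub_mul]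
      omega
    · intro n hn n' hn' h
      simp only [coe_filter, mem_Icc, Set.mem_ofPred_eq] at hn hn' h
      omega
  rw [card_range] at hc
  calc (#((Icc 1 X).filter (fun n => X * A < n * A + X * H)) : ℝ) ≤ ((X * H / A + 1 : ℕ) : ℝ) := by
        exact_mod_cast hc
    _ ≤ _ := by
      push_cast
      gcongr
      exact Nat.cast_div_le.trans (le_of_eq (by push_cast; ring))

variable {f a b : ℕ → ℤ}

open Classical in
lemma norm_sum_offDiag_le {X : ℕ} {𝒜 𝒮 : Finset ℕ} {g : ℕ → ℂ} (hg : ∀ n, ‖g n‖ ≤ 2) (m : ℕ) :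
    ‖∑ i ∈ 𝒜.offDiag.filter (fun i => m * i.1 * i.2 ≤ X), g (m * i.1 * i.2)‖ ≤
      ‖∑ i ∈ (goodPairs a b 𝒜 𝒮 X m).filter (fun i => i.1 ≠ i.2), g (m * i.1 * i.2)‖ +
      2 * (#((𝒜 ×ˢ 𝒜).filter (fun i => i.1 ∣ m ∧ m * i.1 * i.2 ≤ X)) +
        #((𝒜 ×ˢ 𝒜).filter (fun i => i.1 ∣ m ∧ m * i.1 * i.2 ≤ X)) +
        #((𝒜 ×ˢ 𝒜).filter (fun i => (∃ p ∈ 𝒮, (p : ℤ) ∣ a (m * i.2) ∧ (p : ℤ) ∣ b (m * i.2)) ∧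
          m * i.1 * i.2 ≤ X))) := by
  obtain ⟨T, hT⟩ : ∃ T, T = 𝒜.offDiag.filter (fun i => m * i.1 * i.2 ≤ X) := ⟨_, rfl⟩
  rw [← hT]
  have hsub : (goodPairs a b 𝒜 𝒮 X m).filter (fun i => i.1 ≠ i.2) ⊆ T := by
    intro i hi
    rw [mem_filter, mem_goodPairs] at hi
    rw [hT, mem_filter, mem_offDiag]
    exact ⟨⟨hi.1.1.1, hi.1.2.1.1, hi.2⟩, hi.1.2.2⟩
  rw [← sum_sdiff hsub, add_comm]
  refine (norm_add_le _ _).trans (add_le_add le_rfl ?_)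
  refine (norm_sum_le_of_le _ fun i _ => hg _).trans ?_
  rw [sum_const, nsmul_eq_mul, mul_comm]
  refine mul_le_mul_of_nonneg_left ?_ two_pos.le
  have hswap : #((𝒜 ×ˢ 𝒜).filter (fun i => i.2 ∣ m ∧ m * i.1 * i.2 ≤ X)) ≤
      #((𝒜 ×ˢ 𝒜).filter (fun i => i.1 ∣ m ∧ m * i.1 * i.2 ≤ X)) := by
    refine card_le_card_of_injOn Prod.swap ?_ Prod.swap_injective.injOn
    intro i hi
    simp only [coe_filter, mem_product, Set.mem_ofPred_eq, Prod.fst_swap, Prod.snd_swap] at hi ⊢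
    refine ⟨hi.1.symm, hi.2.1, ?_⟩
    rw [mul_right_comm]; exact hi.2.2
  have hcov : T \ (goodPairs a b 𝒜 𝒮 X m).filter (fun i => i.1 ≠ i.2) ⊆
      (𝒜 ×ˢ 𝒜).filter (fun i => i.1 ∣ m ∧ m * i.1 * i.2 ≤ X) ∪
      (𝒜 ×ˢ 𝒜).filter (fun i => i.2 ∣ m ∧ m * i.1 * i.2 ≤ X) ∪
      (𝒜 ×ˢ 𝒜).filter (fun i => (∃ p ∈ 𝒮, (p : ℤ) ∣ a (m * i.2) ∧ (p : ℤ) ∣ b (m * i.2)) ∧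
        m * i.1 * i.2 ≤ X) := by
    intro i hi
    rw [Finset.mem_sdiff, hT, mem_filter, mem_filter, mem_goodPairs, mem_offDiag] at hi
    simp only [mem_union, mem_filter, mem_product]
    by_cases c1 : i.1 ∣ m
    · exact Or.inl (Or.inl ⟨⟨hi.1.1.1, hi.1.1.2.1⟩, c1, hi.1.2⟩)
    by_cases c2 : i.2 ∣ m
    · exact Or.inl (Or.inr ⟨⟨hi.1.1.1, hi.1.1.2.1⟩, c2, hi.1.2⟩)
    refine Or.inr ⟨⟨hi.1.1.1, hi.1.1.2.1⟩, ?_, hi.1.2⟩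
    by_contra c3
    push Not at c3
    exact hi.2 ⟨⟨⟨hi.1.1.1, c1⟩, ⟨hi.1.1.2.1, c2, fun p hp h => c3 p hp h.1 h.2⟩, hi.1.2⟩, hi.1.1.2.2⟩
  have := (card_le_card hcov).trans ((card_union_le _ _).trans (Nat.add_le_add_right (card_union_le _ _) _))
  have h' := this.trans (Nat.add_le_add_right (Nat.add_le_add_left hswap _) _)
  exact_mod_cast h'

lemma sq_mul_norm_sum_le
    {X A H : ℕ} (hA : 0 < A) {𝒜 𝒮 : Finset ℕ} (h𝒜 : ∀ P ∈ 𝒜, P.Prime ∧ A < P ∧ P ≤ X)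
    {S : ℝ} (hS : ∑ P ∈ 𝒜, 1 / (P : ℝ) = S) {g : ℕ → ℂ} (hg : ∀ n, ‖g n‖ ≤ 2)
    {E : ℝ} (hE0 : 0 ≤ E)
    (hE : ∀ m : ℕ, 0 < m → ‖∑ i ∈ (goodPairs a b 𝒜 𝒮 X m).filter (fun i => i.1 ≠ i.2), g (m * i.1 * i.2)‖ ≤
      X / m * E + 2 * #(boundaryPairs a b 𝒜 𝒮 X H m))
    {K W : ℝ} (hK0 : 0 ≤ K) (hK : ∀ Y : ℕ, (#(𝒜.filter (· ≤ Y)) : ℝ) ≤ K * Y)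
    (hW : ∀ n ∈ Icc 1 X, (#(𝒜.filter (· ∣ n)) : ℝ) ≤ W) :
    S ^ 2 * ‖∑ n ∈ Icc 1 X, g n‖ ≤ X * (8 * S * √S + 8 * S + 4 * S ^ 2 / A +
      2 * K * W * (∑ n ∈ (Ioo 1 X).filter (fun n => ∃ p ∈ 𝒮, (p : ℤ) ∣ a n ∧ (p : ℤ) ∣ b n), 1 / (n : ℝ)) +
      (1 + Real.log X) * E) + 2 * W ^ 2 * (X * H / A + 1) := by
  have hpr : ∀ P ∈ 𝒜, P.Prime := fun P hP => (h𝒜 P hP).1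
  have h1 := sum_abs_sq_sub_card_mul_le (X := X) (fun P hP => ⟨hpr P hP, (h𝒜 P hP).2.2⟩) hS
  have h2 := sum_card_mul_eq_sum_sum_offDiag (X := X) hpr g
  have hS0 : 0 ≤ S := hS ▸ sum_nonneg fun _ _ => by positivity
  have h3 : ‖∑ n ∈ Icc 1 X, (((S : ℂ) ^ 2 - (#(𝒜.filter (· ∣ n)) : ℂ) * (#(𝒜.filter (· ∣ n)) - 1)) * g n)‖ ≤
      X * (8 * S * √S + 8 * S) := by
    have hpt : ∀ n ∈ Icc 1 X, ‖((S : ℂ) ^ 2 - (#(𝒜.filter (· ∣ n)) : ℂ) * (#(𝒜.filter (· ∣ n)) - 1)) * g n‖ ≤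
        |S ^ 2 - (#(𝒜.filter (· ∣ n)) : ℝ) * (#(𝒜.filter (· ∣ n)) - 1)| * 2 := by
      intro n _
      rw [norm_mul]
      have : ((S : ℂ) ^ 2 - (#(𝒜.filter (· ∣ n)) : ℂ) * (#(𝒜.filter (· ∣ n)) - 1)) =
          ((S ^ 2 - (#(𝒜.filter (· ∣ n)) : ℝ) * (#(𝒜.filter (· ∣ n)) - 1) : ℝ) : ℂ) := by push_cast; rfl
      rw [this, Complex.norm_real, Real.norm_eq_abs]
      exact mul_le_mul_of_nonneg_left (hg n) (abs_nonneg _)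
    refine (norm_sum_le_of_le _ hpt).trans ?_
    rw [← sum_mul]
    linarith
  have h4 : ∀ m ∈ Icc 1 X, ‖∑ i ∈ 𝒜.offDiag.filter (fun i => m * i.1 * i.2 ≤ X), g (m * i.1 * i.2)‖ ≤
      X / m * E + 2 * #(boundaryPairs a b 𝒜 𝒮 X H m) +
      2 * (#((𝒜 ×ˢ 𝒜).filter (fun i => i.1 ∣ m ∧ m * i.1 * i.2 ≤ X)) +
        #((𝒜 ×ˢ 𝒜).filter (fun i => i.1 ∣ m ∧ m * i.1 * i.2 ≤ X)) +
        #((𝒜 ×ˢ 𝒜).filter (fun i => (∃ p ∈ 𝒮, (p : ℤ) ∣ a (m * i.2) ∧ (p : ℤ) ∣ b (m * i.2)) ∧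
          m * i.1 * i.2 ≤ X))) := fun m hm =>
    (norm_sum_offDiag_le (a := a) (b := b) (𝒮 := 𝒮) hg m).trans (add_le_add (hE m (mem_Icc.1 hm).1) le_rfl)
  have h5 := (norm_sum_le_of_le _ h4)
  rw [← h2] at h5
  simp_rw [sum_add_distrib, ← mul_sum, sum_add_distrib] at h5
  have h6 := sum_card_filter_fst_dvd_le (X := X) hA (fun P hP => ⟨hpr P hP, (h𝒜 P hP).2.1⟩) hS
  have h7 := sum_card_filter_mul_le hpr hK0 hK hW (fun n => ∃ p ∈ 𝒮, (p : ℤ) ∣ a n ∧ (p : ℤ) ∣ b n)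
  have h8 := sum_card_boundaryPairs_le (a := a) (b := b) (𝒮 := 𝒮) (H := H) hA
    (fun P hP => ⟨hpr P hP, (h𝒜 P hP).2.1⟩) hW
  have h9 : ∑ m ∈ Icc 1 X, (X : ℝ) / m * E ≤ X * ((1 + Real.log X) * E) := by
    have : ∑ m ∈ Icc 1 X, (X : ℝ) / m * E = X * ((∑ m ∈ Icc 1 X, (1 : ℝ) / m) * E) := by
      rw [sum_mul, mul_sum]
      exact sum_congr rfl fun _ _ => by ring
    rw [this]
    have := sum_inv_le_one_add_log X
    gcongr
  have h10 : (S : ℂ) ^ 2 * ∑ n ∈ Icc 1 X, g n =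
      ∑ n ∈ Icc 1 X, (((S : ℂ) ^ 2 - (#(𝒜.filter (· ∣ n)) : ℂ) * (#(𝒜.filter (· ∣ n)) - 1)) * g n) +
      ∑ n ∈ Icc 1 X, ((#(𝒜.filter (· ∣ n)) : ℂ) * (#(𝒜.filter (· ∣ n)) - 1)) * g n := by
    rw [mul_sum, ← sum_add_distrib]
    exact sum_congr rfl fun _ _ => by ring
  have h11 : S ^ 2 * ‖∑ n ∈ Icc 1 X, g n‖ = ‖(S : ℂ) ^ 2 * ∑ n ∈ Icc 1 X, g n‖ := by
    rw [norm_mul, norm_pow, Complex.norm_real, Real.norm_eq_abs, sq_abs]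
  rw [h11, h10]
  refine (norm_add_le _ _).trans ((add_le_add h3 h5).trans ?_)
  have h12 : (X : ℝ) * (S ^ 2 / A) * 4 = X * (4 * S ^ 2 / A) := by ring
  nlinarith

end AveragingBounds

section ShiftedValues
open Finset

variable {f a b : ℕ → ℤ}

lemma sum_card_primeFactors_filter_le
    (hrec : ∀ m : ℕ, 0 < m → ∀ P : ℕ, P.Prime → ¬ P ∣ m → f (m * P) = (P : ℤ) * a m + b m)
    {X m : ℕ} (hm : 1 < m) {𝒜 𝒮 𝒯 𝒯₀ 𝒬 : Finset ℕ} (h𝒜 : ∀ P ∈ 𝒜, P.Prime) (h𝒯 : ∀ p ∈ 𝒯, p.Prime)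
    (h𝒯𝒬 : 𝒯 ⊆ 𝒯₀ ∪ 𝒬) {Z : ℝ} (hcov : ∀ p : ℕ, p.Prime → (p : ℝ) ≤ Z → p ∈ 𝒮 ∨ p ∈ 𝒯)
    (hB : ¬ ∃ p ∈ 𝒬, (p : ℤ) ∣ a m ∧ (p : ℤ) ∣ b m)
    {K T R : ℝ} (hK0 : 0 ≤ K) (hK : ∀ Y : ℕ, (#(𝒜.filter (· ≤ Y)) : ℝ) ≤ K * Y)
    (hK' : ∀ p ∈ 𝒯, ∀ Y r : ℕ, (#(𝒜.filter (fun P => P ≤ Y ∧ P % p = r)) : ℝ) ≤ K * (Y / p))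
    (hT : ∑ p ∈ 𝒯, 1 / (p : ℝ) ≤ T) (hR0 : 0 ≤ R)
    (hR : ∀ n ∈ Icc 2 X, (#((f n).natAbs.primeFactors.filter (fun p : ℕ => Z < p)) : ℝ) ≤ R) :
    ∑ P ∈ 𝒜.filter (fun P => ¬ P ∣ m ∧ m * P ≤ X),
      (#((f (m * P)).natAbs.primeFactors.filter (· ∉ 𝒮)) : ℝ) ≤
      K * (X / m) * (#(𝒯₀.filter (fun p : ℕ => (p : ℤ) ∣ a m ∧ (p : ℤ) ∣ b m)) + T + R) := by
  classical
  have hm0 : 0 < m := by omega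
  have hm' : (0 : ℝ) < m := by exact_mod_cast hm0
  have hX' : ((X / m : ℕ) : ℝ) ≤ X / m := Nat.cast_div_le
  set 𝒫' := 𝒜.filter (fun P => ¬ P ∣ m ∧ m * P ≤ X) with h𝒫'
  have hsub : 𝒫' ⊆ 𝒜.filter (· ≤ X / m) := by
    intro P hP
    simp only [h𝒫', mem_filter] at hP ⊢
    exact ⟨hP.1, (Nat.le_div_iff_mul_le hm0).2 (by rw [mul_comm]; exact hP.2.2)⟩
  have hc : (#𝒫' : ℝ) ≤ K * (X / m) := by
    calc (#𝒫' : ℝ) ≤ #(𝒜.filter (· ≤ X / m)) := by exact_mod_cast card_le_card hsub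
      _ ≤ K * (X / m : ℕ) := hK _
      _ ≤ _ := by gcongr
  have h1 : ∀ P ∈ 𝒫', (#((f (m * P)).natAbs.primeFactors.filter (· ∉ 𝒮)) : ℝ) ≤
      (#(𝒯₀.filter (fun p : ℕ => (p : ℤ) ∣ a m ∧ (p : ℤ) ∣ b m)) + R) +
      #((𝒯.filter (fun p : ℕ => ¬ (p : ℤ) ∣ a m)).filter (fun p : ℕ => (p : ℤ) ∣ f (m * P))) := by
    intro P hP
    simp only [h𝒫', mem_filter] at hP
    obtain ⟨hP1, hP2, hP3⟩ := hP
    have hPp := h𝒜 P hP1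
    have hmP : 2 ≤ m * P := hm.trans_le (Nat.le_mul_of_pos_right _ hPp.pos)
    have hcover : (f (m * P)).natAbs.primeFactors.filter (· ∉ 𝒮) ⊆
        𝒯₀.filter (fun p : ℕ => (p : ℤ) ∣ a m ∧ (p : ℤ) ∣ b m) ∪
        (f (m * P)).natAbs.primeFactors.filter (fun p : ℕ => Z < p) ∪
        (𝒯.filter (fun p : ℕ => ¬ (p : ℤ) ∣ a m)).filter (fun p : ℕ => (p : ℤ) ∣ f (m * P)) := by
      intro p hp
      simp only [mem_filter, mem_union, Nat.mem_primeFactors] at hp ⊢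
      obtain ⟨⟨hpp, hpd, hp0⟩, hpS⟩ := hp
      by_cases hpZ : Z < p
      · exact Or.inl (Or.inr ⟨⟨hpp, hpd, hp0⟩, hpZ⟩)
      have hpT := (hcov p hpp (not_lt.1 hpZ)).resolve_left hpS
      have hpf : (p : ℤ) ∣ f (m * P) := Int.natCast_dvd.2 hpd
      by_cases hpa : (p : ℤ) ∣ a m
      · have hpb : (p : ℤ) ∣ b m := by
          rw [hrec m hm0 P hPp hP2] at hpf
          exact (dvd_add_right (dvd_mul_of_dvd_right hpa _)).1 hpf
        rcases mem_union.1 (h𝒯𝒬 hpT) with h | h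
        · exact Or.inl (Or.inl ⟨h, hpa, hpb⟩)
        · exact absurd ⟨p, h, hpa, hpb⟩ hB
      · exact Or.inr ⟨⟨hpT, hpa⟩, hpf⟩
    have hcc := (card_le_card hcover).trans
      ((card_union_le _ _).trans (Nat.add_le_add_right (card_union_le _ _) _))
    have hRR := hR (m * P) (mem_Icc.2 ⟨hmP, hP3⟩)
    have hcc' : (#((f (m * P)).natAbs.primeFactors.filter (· ∉ 𝒮)) : ℝ) ≤
        #(𝒯₀.filter (fun p : ℕ => (p : ℤ) ∣ a m ∧ (p : ℤ) ∣ b m)) +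
        #((f (m * P)).natAbs.primeFactors.filter (fun p : ℕ => Z < p)) +
        #((𝒯.filter (fun p : ℕ => ¬ (p : ℤ) ∣ a m)).filter (fun p : ℕ => (p : ℤ) ∣ f (m * P))) := by
      exact_mod_cast hcc
    linarith
  have h2 : ∑ P ∈ 𝒫', (#((𝒯.filter (fun p : ℕ => ¬ (p : ℤ) ∣ a m)).filter
      (fun p : ℕ => (p : ℤ) ∣ f (m * P))) : ℝ) ≤ K * (X / m) * T := by
    simp_rw [card_filter _ (filter _ _), Nat.cast_sum]
    rw [sum_comm]
    have h3 : ∀ p ∈ 𝒯.filter (fun p : ℕ => ¬ (p : ℤ) ∣ a m),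
        ∑ P ∈ 𝒫', (((if (p : ℤ) ∣ f (m * P) then 1 else 0 : ℕ)) : ℝ) ≤ K * (X / m) * (1 / p) := by
      intro p hp
      rw [mem_filter] at hp
      have hpp : Prime (p : ℤ) := Nat.prime_iff_prime_int.1 (h𝒯 p hp.1)
      rw [← Nat.cast_sum, ← card_filter]
      rcases (𝒫'.filter (fun P => (p : ℤ) ∣ f (m * P))).eq_empty_or_nonempty with h0 | ⟨P₀, hP₀⟩
      · rw [h0]; simp; positivity
      have hval : ∀ P ∈ 𝒫', f (m * P) = (P : ℤ) * a m + b m := by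
        intro P hP
        simp only [h𝒫', mem_filter] at hP
        exact hrec m hm0 P (h𝒜 P hP.1) hP.2.1
      have hss : 𝒫'.filter (fun P => (p : ℤ) ∣ f (m * P)) ⊆
          𝒜.filter (fun P => P ≤ X / m ∧ P % p = P₀ % p) := by
        intro P hP
        rw [mem_filter] at hP hP₀ ⊢
        have hP' := mem_filter.1 (hsub hP.1)
        refine ⟨hP'.1, hP'.2, ?_⟩
        have hd := dvd_sub hP.2 hP₀.2
        rw [hval P hP.1, hval P₀ hP₀.1] at hd
        have : (p : ℤ) ∣ ((P : ℤ) - P₀) * a m := by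
          have e : ((P : ℤ) - P₀) * a m = (P : ℤ) * a m + b m - (P₀ * a m + b m) := by ring
          rw [e]; exact hd
        have h5 := (hpp.dvd_or_dvd this).resolve_right hp.2
        exact ((Nat.modEq_iff_dvd.2 h5)).symm
      calc (#(𝒫'.filter (fun P => (p : ℤ) ∣ f (m * P))) : ℝ) ≤
            #(𝒜.filter (fun P => P ≤ X / m ∧ P % p = P₀ % p)) := by exact_mod_cast card_le_card hss
        _ ≤ K * ((X / m : ℕ) / p) := hK' p hp.1 _ _
        _ ≤ K * (X / m / p) := by gcongr
        _ = _ := by ring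
    refine (sum_le_sum h3).trans ?_
    rw [← mul_sum]
    refine mul_le_mul_of_nonneg_left (le_trans ?_ hT) (by positivity)
    exact sum_le_sum_of_subset_of_nonneg (filter_subset _ _) fun _ _ _ => by positivity
  refine (sum_le_sum h1).trans ?_
  rw [sum_add_distrib, sum_const, nsmul_eq_mul]
  have h4 : (#𝒫' : ℝ) * (#(𝒯₀.filter (fun p : ℕ => (p : ℤ) ∣ a m ∧ (p : ℤ) ∣ b m)) + R) ≤
      K * (X / m) * (#(𝒯₀.filter (fun p : ℕ => (p : ℤ) ∣ a m ∧ (p : ℤ) ∣ b m)) + R) := by gcongr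
  linarith

lemma norm_pow_card_primeFactors_sub_le {v : ℤ} (hv : v ≠ 0) {𝒮 : Finset ℕ} (h𝒮 : ∀ p ∈ 𝒮, p.Prime)
    {z : ℂ} (hz : ‖1 + z‖ = 1) :
    ‖(1 + z) ^ #v.natAbs.primeFactors - (1 + z) ^ #(𝒮.filter (fun p : ℕ => (p : ℤ) ∣ v))‖ ≤
      ‖z‖ * #(v.natAbs.primeFactors.filter (· ∉ 𝒮)) := by
  have h1 : 𝒮.filter (fun p : ℕ => (p : ℤ) ∣ v) = v.natAbs.primeFactors.filter (· ∈ 𝒮) := by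
    ext p
    simp only [mem_filter, Nat.mem_primeFactors]
    constructor
    · rintro ⟨h, h'⟩
      exact ⟨⟨h𝒮 p h, Int.natCast_dvd.1 h', Int.natAbs_ne_zero.2 hv⟩, h⟩
    · rintro ⟨⟨_, h, _⟩, h'⟩
      exact ⟨h', Int.natCast_dvd.2 h⟩
  have h2 := card_filter_add_card_filter_not (s := v.natAbs.primeFactors) (· ∈ 𝒮)
  rw [h1, ← h2, pow_add]
  have h3 : ∀ n : ℕ, ‖(1 + z) ^ n - 1‖ ≤ ‖z‖ * n := by
    intro n
    induction n with
    | zero => simp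
    | succ n ih =>
      have : (1 + z) ^ (n + 1) - 1 = (1 + z) * ((1 + z) ^ n - 1) + z := by ring
      rw [this]
      refine (norm_add_le _ _).trans ?_
      rw [norm_mul, hz, one_mul]
      push_cast
      linarith
  have h4 : ∀ u v : ℂ, u * v - u = u * (v - 1) := fun u v => by ring
  rw [h4, norm_mul, norm_pow, hz, one_pow, one_mul]
  exact h3 _

lemma card_filter_card_eq_zero_le {𝒜 : Finset ℕ} {X : ℕ} (h𝒜 : ∀ P ∈ 𝒜, P.Prime ∧ P ≤ X) {S : ℝ}
    (hS : ∑ P ∈ 𝒜, 1 / (P : ℝ) = S) (hS0 : 0 < S) :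
    (#((Icc 1 X).filter (fun n => 𝒜.filter (· ∣ n) = ∅)) : ℝ) ≤ 3 * X / S := by
  have h1 := sum_sq_card_filter_dvd_sub_le h𝒜 hS
  have h2 : (#((Icc 1 X).filter (fun n => 𝒜.filter (· ∣ n) = ∅)) : ℝ) * S ^ 2 ≤
      ∑ n ∈ Icc 1 X, ((#(𝒜.filter (· ∣ n)) : ℝ) - S) ^ 2 := by
    rw [← nsmul_eq_mul, ← sum_const, sum_filter]
    refine sum_le_sum fun n _ => ?_
    split_ifs with h
    · rw [h]; simp
    · positivity
  rw [le_div_iff₀ hS0]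
  refine le_of_mul_le_mul_right ?_ hS0
  nlinarith

end ShiftedValues

section ShiftedValuesTotal
open Finset

variable {f a b : ℕ → ℤ}

open Classical in
lemma sum_norm_pow_sub_pow_le
    (hf0 : ∀ n : ℕ, 1 < n → f n ≠ 0)
    (hrec : ∀ m : ℕ, 0 < m → ∀ P : ℕ, P.Prime → ¬ P ∣ m → f (m * P) = (P : ℤ) * a m + b m)
    {X A : ℕ} (hA : 0 < A) {𝒜 𝒮 𝒯 𝒯₀ 𝒬 : Finset ℕ} (h𝒜 : ∀ P ∈ 𝒜, P.Prime ∧ A < P ∧ P ≤ X)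
    (h𝒮 : ∀ p ∈ 𝒮, p.Prime) (h𝒯 : ∀ p ∈ 𝒯, p.Prime)
    (h𝒯𝒬 : 𝒯 ⊆ 𝒯₀ ∪ 𝒬) {Z : ℝ} (hcov : ∀ p : ℕ, p.Prime → (p : ℝ) ≤ Z → p ∈ 𝒮 ∨ p ∈ 𝒯)
    {S : ℝ} (hS : ∑ P ∈ 𝒜, 1 / (P : ℝ) = S) (hS0 : 0 < S)
    {K T R : ℝ} (hK0 : 0 ≤ K) (hK : ∀ Y : ℕ, (#(𝒜.filter (· ≤ Y)) : ℝ) ≤ K * Y)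
    (hK' : ∀ p ∈ 𝒯, ∀ Y r : ℕ, (#(𝒜.filter (fun P => P ≤ Y ∧ P % p = r)) : ℝ) ≤ K * (Y / p))
    (hT : ∑ p ∈ 𝒯, 1 / (p : ℝ) ≤ T) (hR0 : 0 ≤ R)
    (hR : ∀ n ∈ Icc 2 X, (#((f n).natAbs.primeFactors.filter (fun p : ℕ => Z < p)) : ℝ) ≤ R)
    {z : ℂ} (hz : ‖1 + z‖ = 1) :
    ∑ n ∈ Icc 2 X, ‖(1 + z) ^ #(f n).natAbs.primeFactors -
        (1 + z) ^ #(𝒮.filter (fun p : ℕ => (p : ℤ) ∣ f n))‖ ≤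
      X * (6 / S + 2 * S / A + 2 * K +
        2 * K * (∑ m ∈ (Ioo 1 X).filter (fun m => ∃ p ∈ 𝒬, (p : ℤ) ∣ a m ∧ (p : ℤ) ∣ b m), 1 / (m : ℝ)) +
        ‖z‖ * K * (∑ p ∈ 𝒯₀, ∑ m ∈ (Icc 1 X).filter (fun m => (p : ℤ) ∣ a m ∧ (p : ℤ) ∣ b m), 1 / (m : ℝ) +
          (1 + Real.log X) * (T + R))) := by
  have hpr : ∀ P ∈ 𝒜, P.Prime := fun P hP => (h𝒜 P hP).1
  have hA' : (0 : ℝ) < A := by exact_mod_cast hA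
  obtain ⟨B, hBdef⟩ : ∃ B : ℕ → Prop, B = fun m => ∃ p ∈ 𝒬, (p : ℤ) ∣ a m ∧ (p : ℤ) ∣ b m := ⟨_, rfl⟩
  obtain ⟨W, hWdef⟩ : ∃ W : ℕ → ℝ, W = fun n => (#((f n).natAbs.primeFactors.filter (· ∉ 𝒮)) : ℝ) := ⟨_, rfl⟩
  have hW0 : ∀ n, 0 ≤ W n := fun n => by rw [hWdef]; positivity
  have hT0 : 0 ≤ T := le_trans (sum_nonneg fun _ _ => by positivity) hT
  set F : ℕ → ℕ → ℝ := fun P m => (if P ∣ m then 2 else 0) + (if m = 1 then 2 else 0) +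
    (if 1 < m ∧ B m then 2 else 0) + (if ¬ P ∣ m ∧ 1 < m ∧ ¬ B m then ‖z‖ * W (m * P) else 0) with hF
  have hF0 : ∀ P m, 0 ≤ F P m := by
    intro P m
    have := hW0 (m * P)
    simp only [hF]
    refine add_nonneg (add_nonneg (add_nonneg ?_ ?_) ?_) ?_ <;> split_ifs <;> positivity
  have h1 : ∀ n ∈ Icc 2 X, ‖(1 + z) ^ #(f n).natAbs.primeFactors -
        (1 + z) ^ #(𝒮.filter (fun p : ℕ => (p : ℤ) ∣ f n))‖ ≤
      (if 𝒜.filter (· ∣ n) = ∅ then 2 else 0) + ∑ P ∈ 𝒜, if P ∣ n then F P (n / P) else 0 := by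
    intro n hn
    have hn2 := (mem_Icc.1 hn).1
    have hsum0 : 0 ≤ ∑ P ∈ 𝒜, if P ∣ n then F P (n / P) else 0 :=
      sum_nonneg fun P _ => by split_ifs; exacts [hF0 _ _, le_rfl]
    have htwo : ‖(1 + z) ^ #(f n).natAbs.primeFactors -
        (1 + z) ^ #(𝒮.filter (fun p : ℕ => (p : ℤ) ∣ f n))‖ ≤ 2 := by
      refine (norm_sub_le _ _).trans ?_
      rw [norm_pow, norm_pow, hz, one_pow, one_pow]; norm_num
    split_ifs with he
    · linarith
    · obtain ⟨P, hP⟩ := nonempty_iff_ne_empty.2 he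
      rw [mem_filter] at hP
      obtain ⟨hP, m, rfl⟩ := hP
      have hP0 := (hpr P hP).pos
      rw [zero_add]
      refine le_trans ?_ (single_le_sum (f := fun Q => if Q ∣ P * m then F Q (P * m / Q) else 0)
        (fun Q _ => by split_ifs; exacts [hF0 _ _, le_rfl]) hP)
      simp only [dvd_mul_right, if_true, Nat.mul_div_cancel_left _ hP0]
      have hm0 : m ≠ 0 := by rintro rfl; simp at hn2
      have hn1 : 1 < P * m := hn2
      have hlast : (0 : ℝ) ≤ (if ¬ P ∣ m ∧ 1 < m ∧ ¬ B m then ‖z‖ * W (m * P) else 0) := by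
        have := hW0 (m * P)
        split_ifs <;> positivity
      simp only [hF]
      by_cases c1 : P ∣ m
      · rw [if_pos c1] at *
        refine htwo.trans ?_
        have c2 : (0 : ℝ) ≤ (if m = 1 then 2 else 0) := by split_ifs <;> norm_num
        have c3 : (0 : ℝ) ≤ (if 1 < m ∧ B m then 2 else 0) := by split_ifs <;> norm_num
        linarith
      by_cases c2 : m = 1
      · rw [if_pos c2]
        refine htwo.trans ?_
        have c3 : (0 : ℝ) ≤ (if 1 < m ∧ B m then 2 else 0) := by split_ifs <;> norm_num
        rw [if_neg c1]
        linarith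
      have hm1 : 1 < m := by omega
      by_cases c3 : B m
      · rw [if_neg c1, if_neg c2, if_pos (show 1 < m ∧ B m from ⟨hm1, c3⟩)]
        refine htwo.trans ?_
        linarith
      · rw [if_neg c1, if_neg c2, if_neg (fun h => c3 h.2), if_pos (show ¬ P ∣ m ∧ 1 < m ∧ ¬ B m from ⟨c1, hm1, c3⟩), mul_comm m P]
        have := norm_pow_card_primeFactors_sub_le (hf0 _ hn1) h𝒮 hz
        rw [hWdef]
        linarith
  have h2 : ∑ n ∈ Icc 2 X, ‖(1 + z) ^ #(f n).natAbs.primeFactors -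
        (1 + z) ^ #(𝒮.filter (fun p : ℕ => (p : ℤ) ∣ f n))‖ ≤
      ∑ n ∈ Icc 1 X, ((if 𝒜.filter (· ∣ n) = ∅ then (2 : ℝ) else 0) +
        ∑ P ∈ 𝒜, if P ∣ n then F P (n / P) else 0) := by
    refine (sum_le_sum h1).trans (sum_le_sum_of_subset_of_nonneg
      (Icc_subset_Icc_left one_le_two) fun n _ _ => add_nonneg ?_ (sum_nonneg fun P _ => ?_))
    · split_ifs <;> norm_num
    · split_ifs
      exacts [hF0 _ _, le_rfl]
  refine h2.trans ?_
  rw [sum_add_distrib, sum_comm (s := Icc 1 X)]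
  have h3 : ∑ n ∈ Icc 1 X, (if 𝒜.filter (· ∣ n) = ∅ then (2 : ℝ) else 0) ≤ X * (6 / S) := by
    have := card_filter_card_eq_zero_le (X := X) (fun P hP => ⟨hpr P hP, (h𝒜 P hP).2.2⟩) hS hS0
    rw [← sum_filter, sum_const, nsmul_eq_mul]
    calc _ ≤ 3 * X / S * 2 := by gcongr
      _ = _ := by ring
  have h4 : ∀ P ∈ 𝒜, ∑ n ∈ Icc 1 X, (if P ∣ n then F P (n / P) else 0) =
      ∑ m ∈ Icc 1 X, if m * P ≤ X then F P m else 0 := by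
    intro P hP
    have := sum_filter_dvd_eq_sum_mul X (hpr P hP).pos (fun n => F P (n / P))
    simp only [Nat.mul_div_cancel _ (hpr P hP).pos] at this
    rw [← sum_filter, this, sum_filter]
  rw [sum_congr rfl h4]
  have h5 : ∀ P m, (if m * P ≤ X then F P m else 0) =
      (if m * P ≤ X ∧ P ∣ m then 2 else 0) + (if m * P ≤ X ∧ m = 1 then 2 else 0) +
      (if m * P ≤ X ∧ (1 < m ∧ B m) then 2 else 0) +
      (if m * P ≤ X ∧ (¬ P ∣ m ∧ 1 < m ∧ ¬ B m) then ‖z‖ * W (m * P) else 0) := by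
    intro P m
    simp only [hF, ite_and (m * P ≤ X)]
    split_ifs <;> simp
  simp_rw [h5, sum_add_distrib]
  have h6 : ∑ P ∈ 𝒜, ∑ m ∈ Icc 1 X, (if m * P ≤ X ∧ P ∣ m then (2 : ℝ) else 0) ≤ X * (2 * S / A) := by
    have : ∀ P ∈ 𝒜, ∑ m ∈ Icc 1 X, (if m * P ≤ X ∧ P ∣ m then (2 : ℝ) else 0) ≤ X * 2 / A * (1 / P) := by
      intro P hP
      obtain ⟨hp, hAP, hPX⟩ := h𝒜 P hP
      have hAP' : (A : ℝ) ≤ P := by exact_mod_cast hAP.le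
      have hc : #((Icc 1 X).filter (fun m => m * P ≤ X ∧ P ∣ m)) ≤ #((Icc 1 X).filter (fun n => P * P ∣ n)) := by
        refine card_le_card_of_injOn (fun m => m * P) ?_ ?_
        · intro m hm
          simp only [coe_filter, mem_Icc, Set.mem_ofPred_eq] at hm ⊢
          exact ⟨⟨Nat.mul_pos hm.1.1 hp.pos, hm.2.1⟩, mul_dvd_mul_right hm.2.2 _⟩
        · intro m _ m' _ h
          exact Nat.eq_of_mul_eq_mul_right hp.pos h
      rw [card_filter_dvd_eq_div] at hc
      have hP0 : (0 : ℝ) < P := hA'.trans_le hAP'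
      rw [← sum_filter, sum_const, nsmul_eq_mul]
      calc (#((Icc 1 X).filter (fun m => m * P ≤ X ∧ P ∣ m)) : ℝ) * 2 ≤ ((X / (P * P) : ℕ) : ℝ) * 2 := by
            gcongr
        _ ≤ X / (P * P : ℕ) * 2 := by gcongr; exact Nat.cast_div_le
        _ ≤ X / (A * P : ℝ) * 2 := by push_cast; gcongr
        _ = _ := by field_simp
    refine (sum_le_sum this).trans (le_of_eq ?_)
    rw [← mul_sum, hS]; ring
  have h7 : ∑ P ∈ 𝒜, ∑ m ∈ Icc 1 X, (if m * P ≤ X ∧ m = 1 then (2 : ℝ) else 0) ≤ X * (2 * K) := by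
    have : ∀ P ∈ 𝒜, ∑ m ∈ Icc 1 X, (if m * P ≤ X ∧ m = 1 then (2 : ℝ) else 0) ≤ 2 := by
      intro P _
      rw [← sum_filter, sum_const, nsmul_eq_mul]
      have : #((Icc 1 X).filter (fun m => m * P ≤ X ∧ m = 1)) ≤ 1 :=
        card_le_one.2 fun m hm m' hm' => (mem_filter.1 hm).2.2.trans (mem_filter.1 hm').2.2.symm
      have : (#((Icc 1 X).filter (fun m => m * P ≤ X ∧ m = 1)) : ℝ) ≤ 1 := by exact_mod_cast this
      linarith
    refine (sum_le_sum this).trans ?_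
    rw [sum_const, nsmul_eq_mul]
    have h := hK X
    rw [filter_true_of_mem fun P hP => (h𝒜 P hP).2.2] at h
    linarith
  have h8 : ∑ P ∈ 𝒜, ∑ m ∈ Icc 1 X, (if m * P ≤ X ∧ (1 < m ∧ B m) then (2 : ℝ) else 0) ≤
      X * (2 * K * ∑ m ∈ (Ioo 1 X).filter B, 1 / (m : ℝ)) := by
    rw [sum_comm]
    have : ∀ m ∈ Icc 1 X, ∑ P ∈ 𝒜, (if m * P ≤ X ∧ (1 < m ∧ B m) then (2 : ℝ) else 0) ≤
        if 1 < m ∧ m < X ∧ B m then X * (2 * K) * (1 / m) else 0 := by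
      intro m hm
      have hm0 := (mem_Icc.1 hm).1
      rw [← sum_filter, sum_const, nsmul_eq_mul]
      rcases (𝒜.filter (fun P => m * P ≤ X ∧ (1 < m ∧ B m))).eq_empty_or_nonempty with h0 | ⟨P, hP⟩
      · rw [h0, card_empty, Nat.cast_zero, zero_mul]
        split_ifs <;> positivity
      · rw [mem_filter] at hP
        have hmX : m < X := by nlinarith [(hpr P hP.1).two_le, hP.2.1]
        rw [if_pos ⟨hP.2.2.1, hmX, hP.2.2.2⟩]
        have hss : 𝒜.filter (fun P => m * P ≤ X ∧ (1 < m ∧ B m)) ⊆ 𝒜.filter (· ≤ X / m) := by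
          intro Q hQ
          rw [mem_filter] at hQ ⊢
          exact ⟨hQ.1, (Nat.le_div_iff_mul_le hm0).2 (by rw [mul_comm]; exact hQ.2.1)⟩
        calc _ ≤ (#(𝒜.filter (· ≤ X / m)) : ℝ) * 2 := by
              gcongr
          _ ≤ K * (X / m : ℕ) * 2 := by gcongr; exact hK _
          _ ≤ K * (X / m) * 2 := by gcongr; exact Nat.cast_div_le
          _ = _ := by ring
    refine (sum_le_sum this).trans (le_of_eq ?_)
    rw [← sum_filter, ← mul_sum, mul_assoc]
    congr 3
    ext m
    simp only [mem_filter, mem_Icc, mem_Ioo]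
    constructor
    · rintro ⟨_, h1, h2, h3⟩; exact ⟨⟨h1, h2⟩, h3⟩
    · rintro ⟨⟨h1, h2⟩, h3⟩; exact ⟨⟨h1.le, h2.le⟩, h1, h2, h3⟩
  have h9 : ∑ P ∈ 𝒜, ∑ m ∈ Icc 1 X,
      (if m * P ≤ X ∧ (¬ P ∣ m ∧ 1 < m ∧ ¬ B m) then ‖z‖ * W (m * P) else 0) ≤
      X * (‖z‖ * K * (∑ p ∈ 𝒯₀, ∑ m ∈ (Icc 1 X).filter (fun m => (p : ℤ) ∣ a m ∧ (p : ℤ) ∣ b m), 1 / (m : ℝ) +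
          (1 + Real.log X) * (T + R))) := by
    rw [sum_comm]
    have : ∀ m ∈ Icc 1 X, ∑ P ∈ 𝒜,
        (if m * P ≤ X ∧ (¬ P ∣ m ∧ 1 < m ∧ ¬ B m) then ‖z‖ * W (m * P) else 0) ≤
        X * (‖z‖ * K) * ((1 / m) * (#(𝒯₀.filter (fun p : ℕ => (p : ℤ) ∣ a m ∧ (p : ℤ) ∣ b m))) +
          (1 / m) * (T + R)) := by
      intro m hm
      have hm0 := (mem_Icc.1 hm).1
      by_cases c : 1 < m ∧ ¬ B m
      · have key := sum_card_primeFactors_filter_le (X := X) hrec c.1 hpr h𝒯 h𝒯𝒬 hcov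
          (by have := c.2; rwa [hBdef] at this) hK0 hK hK' hT hR0 hR
        have e : ∑ P ∈ 𝒜, (if m * P ≤ X ∧ (¬ P ∣ m ∧ 1 < m ∧ ¬ B m) then ‖z‖ * W (m * P) else 0) =
            ‖z‖ * ∑ P ∈ 𝒜.filter (fun P => ¬ P ∣ m ∧ m * P ≤ X), W (m * P) := by
          rw [← sum_filter, mul_sum]
          refine sum_congr (filter_congr fun P _ => ?_) fun _ _ => rfl
          constructor
          · rintro ⟨h1, h2, _⟩; exact ⟨h2, h1⟩
          · rintro ⟨h1, h2⟩; exact ⟨h2, h1, c⟩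
        rw [e, hWdef]
        refine (mul_le_mul_of_nonneg_left key (norm_nonneg z)).trans (le_of_eq ?_)
        ring
      · refine le_trans (le_of_eq (sum_eq_zero fun P _ => if_neg fun h => c h.2.2)) (by positivity)
    refine (sum_le_sum this).trans ?_
    rw [← mul_sum, sum_add_distrib, ← sum_mul, mul_assoc]
    refine mul_le_mul_of_nonneg_left (mul_le_mul_of_nonneg_left (add_le_add (le_of_eq ?_) ?_)
      (by positivity)) (by positivity)
    · simp_rw [card_filter, Nat.cast_sum, mul_sum, sum_filter]
      rw [sum_comm]
      refine sum_congr rfl fun p _ => sum_congr rfl fun m _ => ?_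
      split_ifs <;> simp
    · exact mul_le_mul_of_nonneg_right (sum_inv_le_one_add_log X) (by positivity)
  have hBs : (Ioo 1 X).filter B = (Ioo 1 X).filter (fun m => ∃ p ∈ 𝒬, (p : ℤ) ∣ a m ∧ (p : ℤ) ∣ b m) :=
    filter_congr fun m _ => by rw [hBdef]
  rw [hBs] at h8
  refine (add_le_add h3 (add_le_add (add_le_add (add_le_add h6 h7) h8) h9)).trans (le_of_eq ?_)
  ring

end ShiftedValuesTotal

section PrimesBetween
open Finset

/-- The primes in the interval `(u, v]`. -/
noncomputable def primesBetween (u v : ℝ) : Finset ℕ :=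
  (range (⌊v⌋₊ + 1)).filter (fun p : ℕ => p.Prime ∧ u < p)

lemma mem_primesBetween {u v : ℝ} {p : ℕ} : p ∈ primesBetween u v ↔ p.Prime ∧ u < p ∧ (p : ℝ) ≤ v := by
  rw [primesBetween, mem_filter, mem_range, Nat.lt_succ_iff]
  constructor
  · rintro ⟨h1, h2, h3⟩
    exact ⟨h2, h3, (Nat.le_floor_iff' h2.ne_zero).1 h1⟩
  · rintro ⟨h2, h3, h1⟩
    exact ⟨(Nat.le_floor_iff' h2.ne_zero).2 h1, h2, h3⟩

lemma exists_abs_sum_inv_primesBetween_sub_le :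
    ∃ C > 0, (∀ v : ℝ, 2 ≤ v → |∑ p ∈ primesBetween 0 v, 1 / (p : ℝ) - Real.log (Real.log v)| ≤ C) ∧
      ∀ u v : ℝ, 2 ≤ u → u ≤ v → |∑ p ∈ primesBetween u v, 1 / (p : ℝ) -
        (Real.log (Real.log v) - Real.log (Real.log u))| ≤ C := by
  obtain ⟨C, hC, h⟩ := exists_abs_sum_inv_sub_log_log_le
  have h0 : ∀ v : ℝ, (range (⌊v⌋₊ + 1)).filter Nat.Prime = primesBetween 0 v := by
    intro v
    refine filter_congr fun p _ => ?_
    exact ⟨fun hp => ⟨hp, by exact_mod_cast hp.pos⟩, fun hp => hp.1⟩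
  simp only [h0] at h
  refine ⟨2 * C, by positivity, fun v hv => (h v hv).trans (by linarith), fun u v hu huv => ?_⟩
  have hu' := abs_le.1 (h u hu)
  have hv' := abs_le.1 (h v (hu.trans huv))
  have hsplit : ∑ p ∈ primesBetween 0 v, 1 / (p : ℝ) =
      ∑ p ∈ primesBetween 0 u, 1 / (p : ℝ) + ∑ p ∈ primesBetween u v, 1 / (p : ℝ) := by
    rw [← sum_union]
    · congr 1
      ext p
      simp only [mem_union, mem_primesBetween]
      constructor
      · rintro ⟨h1, h2, h3⟩
        rcases le_or_gt (p : ℝ) u with h4 | h4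
        · exact Or.inl ⟨h1, h2, h4⟩
        · exact Or.inr ⟨h1, h4, h3⟩
      · rintro (⟨h1, h2, h3⟩ | ⟨h1, h2, h3⟩)
        · exact ⟨h1, h2, h3.trans huv⟩
        · exact ⟨h1, by linarith, h3⟩
    · rw [disjoint_left]
      intro p hp hp'
      rw [mem_primesBetween] at hp hp'
      linarith [hp.2.2, hp'.2.1]
  rw [abs_le]
  constructor <;> linarith [hu'.1, hu'.2, hv'.1, hv'.2]

lemma card_mul_log_le_log_abs {U : Finset ℕ} {v : ℤ} (hv : v ≠ 0) {u : ℝ} (hu : 0 < u)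
    (hU : ∀ p ∈ U, p.Prime ∧ u ≤ p ∧ (p : ℤ) ∣ v) : #U * Real.log u ≤ Real.log |(v : ℝ)| := by
  have h1 : ∏ p ∈ U, p ∣ v.natAbs :=
    prod_primes_dvd _ (fun p hp => (hU p hp).1.prime) fun p hp => Int.natCast_dvd.1 (hU p hp).2.2
  have h2 : ∏ p ∈ U, p ≤ v.natAbs := Nat.le_of_dvd (Int.natAbs_pos.2 hv) h1
  have h3 : u ^ #U ≤ |(v : ℝ)| := by
    calc u ^ #U = ∏ _p ∈ U, u := by rw [prod_const]
      _ ≤ ∏ p ∈ U, (p : ℝ) := prod_le_prod (fun _ _ => hu.le) fun p hp => (hU p hp).2.1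
      _ = ((∏ p ∈ U, p : ℕ) : ℝ) := by push_cast; rfl
      _ ≤ (v.natAbs : ℝ) := by exact_mod_cast h2
      _ = |(v : ℝ)| := by rw [Nat.cast_natAbs, Int.cast_abs]
  rw [← Real.log_pow]
  exact Real.log_le_log (by positivity) h3

lemma card_primesBetween_modEq_le {u v : ℝ} {q D : ℕ} (hq : q = 1 ∨ q.Prime) (hD : 1 ≤ D)
    (hDu : (D : ℝ) ^ 4 * q ≤ u) (Y r : ℕ) :
    (#((primesBetween u v).filter (fun P => P ≤ Y ∧ P % q = r)) : ℝ) ≤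
      12 / Real.log (D + 1) * (Y / q) := by
  have hq0 : 0 < q := hq.elim (fun h => h ▸ one_pos) Nat.Prime.pos
  have hlog : 0 < Real.log ((D : ℝ) + 1) := Real.log_pos (by
    have : (1 : ℝ) ≤ D := by exact_mod_cast hD
    linarith)
  rcases ((primesBetween u v).filter (fun P => P ≤ Y ∧ P % q = r)).eq_empty_or_nonempty with h0 | ⟨P₀, hP₀⟩
  · rw [h0]; simp; positivity
  rw [mem_filter, mem_primesBetween] at hP₀
  have hYu : u ≤ Y := by
    have : (P₀ : ℝ) ≤ Y := by exact_mod_cast hP₀.2.1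
    linarith [hP₀.1.2.1]
  have hDY : D ^ 4 ≤ Y / q := by
    rw [Nat.le_div_iff_mul_le hq0]
    have := hDu.trans hYu
    exact_mod_cast this
  have hDu' : (D : ℝ) ≤ u := by
    refine le_trans ?_ hDu
    have h1 : D ≤ D ^ 4 * q := (Nat.le_self_pow (by norm_num) D).trans (Nat.le_mul_of_pos_right _ hq0)
    exact_mod_cast h1
  have h := card_primes_modEq_mul_log_le r hq hD hDY
  rw [div_mul_eq_mul_div, le_div_iff₀ hlog]
  refine le_trans (mul_le_mul_of_nonneg_right ?_ hlog.le) h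
  refine Nat.cast_le.2 (card_le_card fun P hP => ?_)
  rw [mem_filter, mem_primesBetween] at hP
  rw [mem_filter, mem_Icc]
  refine ⟨⟨hP.1.1.pos, hP.2.1⟩, hP.1.1, ?_, hP.2.2⟩
  have := hDu'.trans_lt hP.1.2.1
  exact_mod_cast this

lemma sum_inv_filter_exists_dvd_le (a b : ℕ → ℤ) {x w : ℝ} (hwx : w ≤ x) {y : ℝ} {𝒮 : Finset ℕ}
    (h𝒮 : ∀ p ∈ 𝒮, p.Prime ∧ y < p ∧ (p : ℝ) ≤ w) :
    ∑ m ∈ (Ioo 1 ⌊x⌋₊).filter (fun m => ∃ p ∈ 𝒮, (p : ℤ) ∣ a m ∧ (p : ℤ) ∣ b m), 1 / (m : ℝ) ≤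
      ∑ d ∈ (Finset.range (⌊x⌋₊ + 1)).filter (fun d : ℕ =>
          Squarefree d ∧ d.primeFactors.card ≤ 1 ∧
          ∀ p ∈ d.primeFactors, y < (p : ℝ) ∧ (p : ℝ) ≤ w),
        ∑ m ∈ (Finset.Ioo 1 ⌈x⌉₊).filter (fun m : ℕ =>
            (∀ p ∈ d.primeFactors,
              ((p : ℤ) ∣ a m ∧ (p : ℤ) ∣ b m) ∨ (¬ (p : ℤ) ∣ a m ∧ ¬ (p : ℤ) ∣ b m)) ∧
            Int.gcd (d : ℤ) (a m * b m) ≠ 1),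
          (Int.gcd (d : ℤ) (a m) : ℝ) / (m * d) := by
  have h1 : ∑ m ∈ (Ioo 1 ⌊x⌋₊).filter (fun m => ∃ p ∈ 𝒮, (p : ℤ) ∣ a m ∧ (p : ℤ) ∣ b m), 1 / (m : ℝ) ≤
      ∑ m ∈ Ioo 1 ⌊x⌋₊, ∑ p ∈ 𝒮, if (p : ℤ) ∣ a m ∧ (p : ℤ) ∣ b m then 1 / (m : ℝ) else 0 := by
    rw [sum_filter]
    refine sum_le_sum fun m _ => ?_
    split_ifs with h
    · obtain ⟨p, hp, h⟩ := h
      refine le_trans (le_of_eq (if_pos h).symm) (single_le_sum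
        (f := fun p : ℕ => if (p : ℤ) ∣ a m ∧ (p : ℤ) ∣ b m then 1 / (m : ℝ) else 0) (fun q _ => ?_) hp)
      split_ifs <;> positivity
    · exact sum_nonneg fun q _ => by split_ifs <;> positivity
  refine h1.trans ?_
  rw [sum_comm]
  have hsub : 𝒮 ⊆ (Finset.range (⌊x⌋₊ + 1)).filter (fun d : ℕ =>
          Squarefree d ∧ d.primeFactors.card ≤ 1 ∧
          ∀ p ∈ d.primeFactors, y < (p : ℝ) ∧ (p : ℝ) ≤ w) := by
    intro p hp
    obtain ⟨hpp, hp1, hp2⟩ := h𝒮 p hp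
    rw [mem_filter, mem_range, Nat.lt_succ_iff, Nat.le_floor_iff' hpp.ne_zero, hpp.primeFactors]
    refine ⟨hp2.trans hwx, hpp.squarefree, by simp, fun q hq => ?_⟩
    rw [mem_singleton.1 hq]
    exact ⟨hp1, hp2⟩
  refine le_trans ?_ (sum_le_sum_of_subset_of_nonneg hsub fun d _ _ => sum_nonneg fun m _ => by positivity)
  refine sum_le_sum fun p hp => ?_
  have hpp := (h𝒮 p hp).1
  have hp0 : (0 : ℝ) < p := by exact_mod_cast hpp.pos
  rw [← sum_filter]
  have hgcd : ∀ m, (p : ℤ) ∣ a m → Int.gcd (p : ℤ) (a m) = p := by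
    intro m h
    have h' := Int.gcd_eq_natAbs_left h
    rwa [Int.natAbs_natCast] at h'
  calc ∑ m ∈ (Ioo 1 ⌊x⌋₊).filter (fun m => (p : ℤ) ∣ a m ∧ (p : ℤ) ∣ b m), 1 / (m : ℝ) =
        ∑ m ∈ (Ioo 1 ⌊x⌋₊).filter (fun m => (p : ℤ) ∣ a m ∧ (p : ℤ) ∣ b m),
          (Int.gcd (p : ℤ) (a m) : ℝ) / (m * p) := by
        refine sum_congr rfl fun m hm => ?_
        rw [hgcd m (mem_filter.1 hm).2.1]
        have : (m : ℝ) ≠ 0 := by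
          have := (mem_Ioo.1 (mem_filter.1 hm).1).1
          positivity
        field_simp
    _ ≤ _ := by
        refine sum_le_sum_of_subset_of_nonneg (fun m hm => ?_) fun m _ _ => by positivity
        rw [mem_filter, mem_Ioo] at hm ⊢
        obtain ⟨⟨h1, h2⟩, h3, h4⟩ := hm
        refine ⟨⟨h1, h2.trans_le (Nat.floor_le_ceil x)⟩, fun q hq => ?_, fun h => ?_⟩
        · rw [hpp.primeFactors, mem_singleton] at hq
          rw [hq]; exact Or.inl ⟨h3, h4⟩
        · have : p ∣ 1 := by
            rw [← h]
            exact_mod_cast Int.dvd_coe_gcd (dvd_refl _) (dvd_mul_of_dvd_left h3 _)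
          exact hpp.one_lt.ne' (Nat.dvd_one.1 this)

lemma le_sum_inv_mul_log_div {𝒮 𝒢 : Finset ℕ} (h𝒢 : 𝒢 ⊆ 𝒮) {y w D nb σ : ℝ} (hy : 0 < y)
    (h𝒮 : ∀ p ∈ 𝒮, 0 < p ∧ y ≤ p ∧ (p : ℝ) ≤ w) (hw : 0 < w) (hwD : w ≤ D)
    (hnb : (#(𝒮 \ 𝒢) : ℝ) ≤ nb) (hσ : σ ≤ ∑ p ∈ 𝒮, 1 / (p : ℝ)) :
    (σ - nb / y) * Real.log (D / w) ≤ ∑ p ∈ 𝒢, 1 / (p : ℝ) * Real.log (D / p) := by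
  have hlog : 0 ≤ Real.log (D / w) := Real.log_nonneg ((one_le_div hw).2 hwD)
  have h1 : ∑ p ∈ 𝒮 \ 𝒢, 1 / (p : ℝ) ≤ nb / y := by
    have : ∀ p ∈ 𝒮 \ 𝒢, 1 / (p : ℝ) ≤ 1 / y := fun p hp =>
      one_div_le_one_div_of_le hy (h𝒮 p (mem_sdiff.1 hp).1).2.1
    refine (sum_le_sum this).trans ?_
    rw [sum_const, nsmul_eq_mul, mul_one_div]
    gcongr
  have h2 := sum_sdiff (f := fun p : ℕ => 1 / (p : ℝ)) h𝒢
  calc (σ - nb / y) * Real.log (D / w) ≤ (∑ p ∈ 𝒢, 1 / (p : ℝ)) * Real.log (D / w) :=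
        mul_le_mul_of_nonneg_right (by linarith) hlog
    _ ≤ _ := by
      rw [sum_mul]
      refine sum_le_sum fun p hp => ?_
      obtain ⟨h3, _, h4⟩ := h𝒮 p (h𝒢 hp)
      have : (0 : ℝ) < p := by exact_mod_cast h3
      have hD : 0 < D := hw.trans_le hwD
      gcongr

end PrimesBetween

section LogScales
open Finset

/-- `L`, `ℓ`, `κ`, `ψ` are the first four iterated logarithms of `x`, the last one not too small. -/
structure LogScale (x L ℓ κ ψ : ℝ) : Prop where
  exp_L : Real.exp L = x
  exp_ℓ : Real.exp ℓ = L
  exp_κ : Real.exp κ = ℓ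
  exp_ψ : Real.exp ψ = κ
  ten_le_ψ : 10 ≤ ψ

lemma eventually_logScale : ∀ᶠ x : ℝ in atTop, LogScale x (Real.log x) (Real.log (Real.log x))
    (Real.log (Real.log (Real.log x))) (Real.log (Real.log (Real.log (Real.log x)))) := by
  have h1 := Real.tendsto_log_atTop
  have h2 := h1.comp h1
  have h3 := h1.comp h2
  have h4 := h1.comp h3
  filter_upwards [eventually_gt_atTop 0, h1.eventually_gt_atTop 0, h2.eventually_gt_atTop 0,
    h3.eventually_gt_atTop 0, h4.eventually_ge_atTop 10] with x hx hx1 hx2 hx3 hx4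
  exact ⟨Real.exp_log hx, Real.exp_log hx1, Real.exp_log hx2, Real.exp_log hx3, hx4⟩

namespace LogScale
variable {x L ℓ κ ψ : ℝ} (h : LogScale x L ℓ κ ψ)
include h

lemma log_x : Real.log x = L := by rw [← h.exp_L, Real.log_exp]
lemma log_L : Real.log L = ℓ := by rw [← h.exp_ℓ, Real.log_exp]
lemma log_ℓ : Real.log ℓ = κ := by rw [← h.exp_κ, Real.log_exp]
lemma log_κ : Real.log κ = ψ := by rw [← h.exp_ψ, Real.log_exp]

lemma le_κ : 2000 ≤ κ := by
  rw [← h.exp_ψ]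
  have h1 : Real.exp 10 ≤ Real.exp ψ := Real.exp_le_exp.2 h.ten_le_ψ
  have h2 : Real.exp 10 = Real.exp 1 ^ 10 := by rw [← Real.exp_nat_mul]; norm_num
  have h3 : (2.7 : ℝ) ^ 10 ≤ Real.exp 1 ^ 10 :=
    pow_le_pow_left₀ (by norm_num) (by linarith [Real.exp_one_gt_d9]) 10
  norm_num at h3
  linarith

lemma two_mul_ψ_le : 2 * ψ ≤ κ := by
  have := Real.quadratic_le_exp_of_nonneg (by linarith [h.ten_le_ψ] : (0 : ℝ) ≤ ψ)
  rw [h.exp_ψ] at this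
  nlinarith [h.ten_le_ψ]

lemma mul_κ_le : 1000 * κ ≤ ℓ := by
  have := Real.quadratic_le_exp_of_nonneg (by linarith [h.le_κ] : (0 : ℝ) ≤ κ)
  rw [h.exp_κ] at this
  nlinarith [h.le_κ]

lemma le_ℓ : 2000000 ≤ ℓ := by linarith [h.mul_κ_le, h.le_κ]

lemma ψ_le_ℓ : 2000 * ψ ≤ ℓ := by linarith [h.mul_κ_le, h.two_mul_ψ_le]

lemma pow_ℓ_le : ℓ ^ 10 ≤ L := by
  rw [← h.exp_κ, ← Real.exp_nat_mul, ← h.exp_ℓ]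
  refine Real.exp_le_exp.2 ?_
  push_cast
  linarith [h.mul_κ_le, h.le_κ]

lemma pow_L_le : L ^ 20 ≤ Real.exp (ℓ ^ 2) := by
  rw [← h.exp_ℓ, ← Real.exp_nat_mul]
  refine Real.exp_le_exp.2 ?_
  push_cast
  nlinarith [h.le_ℓ]

lemma ℓ_le_L : ℓ ≤ L := by
  have := Real.add_one_le_exp ℓ
  rw [h.exp_ℓ] at this
  linarith

lemma le_L : 2000000 ≤ L := h.le_ℓ.trans h.ℓ_le_L

lemma pow_ℓ_le_div : ℓ ^ 9 ≤ L / ℓ := by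
  rw [le_div_iff₀ (by linarith [h.le_ℓ])]
  linarith [h.pow_ℓ_le]

lemma div_ℓ_le_div_ψ : L / ℓ ≤ L / ψ / 2000 := by
  have := h.le_L
  rw [div_div]
  exact div_le_div_of_nonneg_left (by linarith) (by linarith [h.ten_le_ψ]) (by linarith [h.ψ_le_ℓ])

lemma sq_ℓ_le_div : 1000 * ℓ ^ 2 ≤ L / ℓ := by
  refine le_trans ?_ h.pow_ℓ_le_div
  have h1 : (1000 : ℝ) ≤ ℓ ^ 7 := (by linarith [h.le_ℓ] : (1000 : ℝ) ≤ ℓ).trans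
    (le_self_pow₀ (by linarith [h.le_ℓ]) (by norm_num))
  calc 1000 * ℓ ^ 2 ≤ ℓ ^ 7 * ℓ ^ 2 := by gcongr
    _ = ℓ ^ 9 := by ring

omit h in
lemma half_exp_le_floor {t : ℝ} (ht : 1 ≤ t) : Real.exp t / 2 ≤ ⌊Real.exp t⌋₊ := by
  have h1 := Nat.lt_floor_add_one (Real.exp t)
  have h2 := Real.add_one_le_exp t
  linarith

lemma exp_sq_le_floor : Real.exp (ℓ ^ 2) ≤ ⌊Real.exp (L / ψ)⌋₊ := by
  have h1 : 1 + ℓ ^ 2 ≤ L / ψ := by nlinarith [h.sq_ℓ_le_div, h.div_ℓ_le_div_ψ, h.le_ℓ]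
  refine le_trans ?_ (half_exp_le_floor (by nlinarith [h.le_ℓ]))
  have h2 := Real.exp_le_exp.2 h1
  rw [Real.exp_add] at h2
  nlinarith [Real.exp_one_gt_d9, Real.exp_pos (ℓ ^ 2)]

lemma blockError_le : blockError ⌈20 * ℓ⌉₊ ⌊Real.exp (ℓ ^ 2)⌋₊ ⌊Real.exp (21 * L / ℓ ^ 2)⌋₊ ⌈Real.exp (L / ℓ)⌉₊
    (Real.exp 1) ℓ ≤ 3 / L ^ 3 := by
  have hℓ := h.le_ℓ
  have hL := h.le_L
  have hk1 : 20 * ℓ ≤ (⌈20 * ℓ⌉₊ : ℝ) := Nat.le_ceil _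
  have hk2 : (⌈20 * ℓ⌉₊ : ℝ) ≤ 20 * ℓ + 1 := (Nat.ceil_lt_add_one (by positivity)).le
  have e1 : 2 * (3 : ℝ) ^ ⌈20 * ℓ⌉₊ / ⌊Real.exp (ℓ ^ 2)⌋₊ ≤ Real.exp (-8 * ℓ) / 2 := by
    have h3 : (3 : ℝ) ≤ Real.exp 2 := by have := Real.add_one_le_exp (2 : ℝ); linarith
    have h4 : (3 : ℝ) ^ ⌈20 * ℓ⌉₊ ≤ Real.exp (40 * ℓ + 2) := by
      calc (3 : ℝ) ^ ⌈20 * ℓ⌉₊ ≤ Real.exp 2 ^ ⌈20 * ℓ⌉₊ := by gcongr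
        _ = Real.exp (⌈20 * ℓ⌉₊ * 2) := by rw [Real.exp_nat_mul]
        _ ≤ _ := Real.exp_le_exp.2 (by linarith)
    have h5 := half_exp_le_floor (t := ℓ ^ 2) (by nlinarith)
    have h6 : (8 : ℝ) ≤ Real.exp 7 := by have := Real.add_one_le_exp (7 : ℝ); linarith
    rw [div_le_iff₀ (lt_of_lt_of_le (by positivity) h5)]
    calc 2 * (3 : ℝ) ^ ⌈20 * ℓ⌉₊ ≤ 2 * Real.exp (40 * ℓ + 2) := by gcongr
      _ = 8 * Real.exp (40 * ℓ + 2) / 4 := by ring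
      _ ≤ Real.exp 7 * Real.exp (40 * ℓ + 2) / 4 := by gcongr
      _ = Real.exp (40 * ℓ + 9) / 4 := by rw [← Real.exp_add]; ring_nf
      _ ≤ Real.exp (-8 * ℓ + ℓ ^ 2) / 4 := div_le_div_of_nonneg_right (Real.exp_le_exp.2 (by nlinarith)) (by norm_num)
      _ = Real.exp (-8 * ℓ) / 2 * (Real.exp (ℓ ^ 2) / 2) := by rw [Real.exp_add]; ring
      _ ≤ _ := by gcongr
  have e2 : (⌊Real.exp (21 * L / ℓ ^ 2)⌋₊ : ℝ) ^ 4 / ⌈Real.exp (L / ℓ)⌉₊ ≤ Real.exp (-8 * ℓ) / 2 := by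
    rw [div_le_iff₀ (lt_of_lt_of_le (Real.exp_pos _) (Nat.le_ceil _))]
    have h3 : 84 * L / ℓ ^ 2 ≤ L / ℓ / 2 := by
      rw [div_div, div_le_div_iff₀ (by positivity) (by positivity)]
      nlinarith [mul_pos (by linarith : 0 < L) (by linarith : 0 < ℓ)]
    have h4 : (2 : ℝ) ≤ Real.exp 1 := by linarith [Real.exp_one_gt_d9]
    have h5 := h.sq_ℓ_le_div
    calc (⌊Real.exp (21 * L / ℓ ^ 2)⌋₊ : ℝ) ^ 4 ≤ Real.exp (21 * L / ℓ ^ 2) ^ 4 := by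
          gcongr; exact Nat.floor_le (Real.exp_pos _).le
      _ = Real.exp (84 * L / ℓ ^ 2) := by rw [← Real.exp_nat_mul]; push_cast; ring_nf
      _ = 2 * Real.exp (84 * L / ℓ ^ 2) / 2 := by ring
      _ ≤ Real.exp 1 * Real.exp (84 * L / ℓ ^ 2) / 2 := by gcongr
      _ = Real.exp (1 + 84 * L / ℓ ^ 2) / 2 := by rw [Real.exp_add]
      _ ≤ Real.exp (-8 * ℓ + L / ℓ) / 2 := div_le_div_of_nonneg_right (Real.exp_le_exp.2 (by nlinarith)) (by norm_num)
      _ = Real.exp (-8 * ℓ) / 2 * Real.exp (L / ℓ) := by rw [Real.exp_add]; ring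
      _ ≤ _ := by gcongr; exact Nat.le_ceil _
  have e3 : √(2 * (3 : ℝ) ^ ⌈20 * ℓ⌉₊ / ⌊Real.exp (ℓ ^ 2)⌋₊ +
      (⌊Real.exp (21 * L / ℓ ^ 2)⌋₊ : ℝ) ^ 4 / ⌈Real.exp (L / ℓ)⌉₊) ≤ Real.exp (-4 * ℓ) := by
    rw [Real.sqrt_le_left (Real.exp_pos _).le, ← Real.exp_nat_mul]
    refine (add_le_add e1 e2).trans (le_of_eq ?_)
    push_cast; ring_nf
  have e4 : Real.exp (Real.exp 1 * ℓ) / Real.exp 1 ^ ⌈20 * ℓ⌉₊ ≤ Real.exp (-3 * ℓ) := by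
    rw [← Real.exp_nat_mul, ← Real.exp_sub]
    refine Real.exp_le_exp.2 ?_
    nlinarith [Real.exp_one_lt_d9]
  have e5 : Real.exp (-3 * ℓ) = 1 / L ^ 3 := by
    rw [← h.exp_ℓ, ← Real.exp_nat_mul, one_div, ← Real.exp_neg]; push_cast; ring_nf
  rw [blockError]
  calc _ ≤ Real.exp ℓ * Real.exp (-4 * ℓ) + 2 * Real.exp (-3 * ℓ) := by gcongr
    _ = 3 * Real.exp (-3 * ℓ) := by rw [← Real.exp_add]; ring_nf
    _ = _ := by rw [e5]; ring

lemma floor_le : (⌊x⌋₊ : ℝ) ≤ x := Nat.floor_le (by rw [← h.exp_L]; positivity)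

lemma ceil_div_floor_le : (⌈Real.exp (L / ℓ)⌉₊ : ℝ) / ⌊Real.exp (L / ψ)⌋₊ ≤ 1 / L ^ 20 := by
  have hℓ := h.le_ℓ
  have hL := h.le_L
  have h1 := h.div_ℓ_le_div_ψ
  have h2 := h.sq_ℓ_le_div
  have h4 : (4 : ℝ) ≤ Real.exp 3 := by have := Real.add_one_le_exp (3 : ℝ); linarith
  have h3 : (⌈Real.exp (L / ℓ)⌉₊ : ℝ) ≤ 2 * Real.exp (L / ℓ) := by
    have := (Nat.ceil_lt_add_one (Real.exp_pos (L / ℓ)).le)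
    have := Real.one_le_exp (x := L / ℓ) (by positivity)
    linarith
  have h5 := half_exp_le_floor (t := L / ψ) (by nlinarith)
  have hψ := h.ten_le_ψ
  rw [div_le_div_iff₀ (lt_of_lt_of_le (by positivity) h5) (by positivity), one_mul]
  calc (⌈Real.exp (L / ℓ)⌉₊ : ℝ) * L ^ 20 ≤ 2 * Real.exp (L / ℓ) * Real.exp (ℓ ^ 2) := by
        gcongr; exact h.pow_L_le
    _ = 4 * (Real.exp (L / ℓ) * Real.exp (ℓ ^ 2)) / 2 := by ring
    _ ≤ Real.exp 3 * (Real.exp (L / ℓ) * Real.exp (ℓ ^ 2)) / 2 := by gcongr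
    _ = Real.exp (3 + (L / ℓ + ℓ ^ 2)) / 2 := by rw [← Real.exp_add, ← Real.exp_add]
    _ ≤ Real.exp (L / ψ) / 2 := div_le_div_of_nonneg_right (Real.exp_le_exp.2 (by nlinarith)) (by norm_num)
    _ ≤ _ := h5

end LogScale
end LogScales

section LogScalePrimes
open Finset

namespace LogScale
variable {x L ℓ κ ψ : ℝ} (h : LogScale x L ℓ κ ψ)
include h

lemma div_cube_le : L / ℓ ^ 3 ≤ L / ψ / 1000000 := by
  have hL := h.le_L
  have hℓ := h.le_ℓ
  have hψ := h.ten_le_ψ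
  rw [div_div]
  refine div_le_div_of_nonneg_left (by linarith) (by linarith) ?_
  have h1 := h.ψ_le_ℓ
  have h2 : (1000000 : ℝ) ≤ ℓ ^ 2 := by nlinarith
  calc ψ * 1000000 ≤ ℓ * ℓ ^ 2 := by gcongr; linarith
    _ = ℓ ^ 3 := by ring

lemma sq_le_div_cube : ℓ ^ 2 ≤ L / ℓ ^ 3 := by
  have hℓ := h.le_ℓ
  rw [le_div_iff₀ (by positivity)]
  refine le_trans ?_ h.pow_ℓ_le
  calc ℓ ^ 2 * ℓ ^ 3 = ℓ ^ 5 := by ring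
    _ ≤ ℓ ^ 10 := pow_le_pow_right₀ (by linarith) (by norm_num)

lemma abs_sum_averaging_sub_le {C : ℝ} (hC : ∀ u v : ℝ, 2 ≤ u → u ≤ v →
    |∑ p ∈ primesBetween u v, 1 / (p : ℝ) - (Real.log (Real.log v) - Real.log (Real.log u))| ≤ C) :
    |∑ P ∈ primesBetween (Real.exp (L / ψ)) x, 1 / (P : ℝ) - Real.log ψ| ≤ C := by
  have hL := h.le_L
  have hψ := h.ten_le_ψ
  have h0 := h.div_ℓ_le_div_ψ
  have h1 := h.sq_ℓ_le_div
  have h2 := h.le_ℓ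
  have := hC (Real.exp (L / ψ)) x (by linarith [Real.add_one_le_exp (L / ψ), (by nlinarith : 1 ≤ L / ψ)])
    (by rw [← h.exp_L]; exact Real.exp_le_exp.2 (div_le_self (by linarith) (by linarith)))
  rwa [h.log_x, h.log_L, Real.log_exp, Real.log_div (by linarith) (by linarith), h.log_L,
    show ℓ - (ℓ - Real.log ψ) = Real.log ψ by ring] at this

lemma abs_sum_sieving_sub_le {C : ℝ} (hC : ∀ u v : ℝ, 2 ≤ u → u ≤ v →
    |∑ p ∈ primesBetween u v, 1 / (p : ℝ) - (Real.log (Real.log v) - Real.log (Real.log u))| ≤ C) :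
    |∑ p ∈ primesBetween (Real.exp (ℓ ^ 2)) (Real.exp (L / ℓ ^ 3)), 1 / (p : ℝ) - (ℓ - 5 * κ)| ≤ C := by
  have hL := h.le_L
  have hℓ := h.le_ℓ
  have := hC (Real.exp (ℓ ^ 2)) (Real.exp (L / ℓ ^ 3))
    (by linarith [Real.add_one_le_exp (ℓ ^ 2), (by nlinarith : 1 ≤ ℓ ^ 2)]) (Real.exp_le_exp.2 h.sq_le_div_cube)
  rwa [Real.log_exp, Real.log_exp, Real.log_div (by linarith) (by positivity), Real.log_pow, Real.log_pow,
    h.log_L, h.log_ℓ, show ℓ - (3 : ℕ) * κ - (2 : ℕ) * κ = ℓ - 5 * κ by push_cast; ring] at this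

lemma card_averaging_modEq_le {q : ℕ} (hq : q = 1 ∨ q.Prime) (hqx : (q : ℝ) ≤ Real.exp (L / κ)) (Y r : ℕ) :
    (#((primesBetween (Real.exp (L / ψ)) x).filter (fun P => P ≤ Y ∧ P % q = r)) : ℝ) ≤
      192 * ψ / L * (Y / q) := by
  have hL := h.le_L
  have hψ := h.ten_le_ψ
  have hκ := h.le_κ
  have h1 : 1 ≤ L / (16 * ψ) := by
    rw [le_div_iff₀ (by positivity)]; nlinarith [h.ψ_le_ℓ, h.ℓ_le_L]
  have h2 : 1 ≤ ⌊Real.exp (L / (16 * ψ))⌋₊ := by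
    rw [Nat.one_le_floor_iff]
    exact Real.one_le_exp (by linarith)
  have h3 : (⌊Real.exp (L / (16 * ψ))⌋₊ : ℝ) ^ 4 * q ≤ Real.exp (L / ψ) := by
    calc (⌊Real.exp (L / (16 * ψ))⌋₊ : ℝ) ^ 4 * q ≤ Real.exp (L / (16 * ψ)) ^ 4 * Real.exp (L / κ) := by
          gcongr; exact Nat.floor_le (Real.exp_pos _).le
      _ = Real.exp (L / (4 * ψ) + L / κ) := by
          rw [← Real.exp_nat_mul, Real.exp_add]
          congr 2; push_cast; field_simp; norm_num
      _ ≤ _ := by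
          refine Real.exp_le_exp.2 ?_
          have h4 : L / κ ≤ L / (2 * ψ) :=
            div_le_div_of_nonneg_left (by linarith) (by linarith) h.two_mul_ψ_le
          have h5 : L / (4 * ψ) + L / (2 * ψ) = 3 / 4 * (L / ψ) := by field_simp; norm_num
          have h6 : 0 ≤ L / ψ := by positivity
          linarith
  refine (card_primesBetween_modEq_le hq h2 h3 Y r).trans ?_
  refine mul_le_mul_of_nonneg_right ?_ (by positivity)
  have h4 : L / (16 * ψ) ≤ Real.log (⌊Real.exp (L / (16 * ψ))⌋₊ + 1) := by
    rw [Real.le_log_iff_exp_le (by positivity)]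
    exact (Nat.lt_floor_add_one _).le
  calc 12 / Real.log (⌊Real.exp (L / (16 * ψ))⌋₊ + 1) ≤ 12 / (L / (16 * ψ)) := by gcongr
    _ = 192 * ψ / L := by field_simp; norm_num

lemma card_averaging_le (Y : ℕ) :
    (#((primesBetween (Real.exp (L / ψ)) x).filter (· ≤ Y)) : ℝ) ≤ 192 * ψ / L * Y := by
  have hL := h.le_L
  have hκ := h.le_κ
  have := h.card_averaging_modEq_le (q := 1) (Or.inl rfl)
    (by rw [Nat.cast_one]; exact Real.one_le_exp (by positivity)) Y 0
  simpa [Nat.mod_one] using this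

lemma card_averaging_dvd_le : ∀ n ∈ Icc 1 ⌊x⌋₊,
    (#((primesBetween (Real.exp (L / ψ)) x).filter (· ∣ n)) : ℝ) ≤ ψ := by
  intro n hn
  rw [mem_Icc] at hn
  have hn0 : (0 : ℝ) < n := by exact_mod_cast hn.1
  have hnx : (n : ℝ) ≤ x := (Nat.le_floor_iff' (by omega)).1 hn.2
  have hL := h.le_L
  have hψ := h.ten_le_ψ
  have := card_mul_log_le_log_abs (U := (primesBetween (Real.exp (L / ψ)) x).filter (· ∣ n)) (v := n)
    (by exact_mod_cast hn0.ne') (Real.exp_pos (L / ψ)) (fun p hp => by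
      rw [mem_filter, mem_primesBetween] at hp
      exact ⟨hp.1.1, hp.1.2.1.le, by exact_mod_cast hp.2⟩)
  rw [Real.log_exp, Int.cast_natCast, abs_of_pos hn0] at this
  have h2 : Real.log n ≤ L := by rw [← h.log_x]; exact Real.log_le_log hn0 hnx
  have h3 : (0 : ℝ) < L / ψ := by positivity
  refine le_of_mul_le_mul_right (this.trans (h2.trans (le_of_eq ?_))) h3
  field_simp

lemma card_dvd_le {c : ℝ} {𝒮 : Finset ℕ} (h𝒮 : ∀ p ∈ 𝒮, p.Prime) {v : ℤ} (hv : v ≠ 0)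
    (hvx : (|v| : ℝ) ≤ 4 * ⌊x⌋₊ * (x ^ c) ^ 2) :
    #(𝒮.filter (fun p : ℕ => (p : ℤ) ∣ v)) ≤ ⌊(4 + 4 * c) * L⌋₊ := by
  have hL := h.le_L
  refine Nat.le_floor ?_
  have h1 := card_mul_log_le_log_abs (U := 𝒮.filter (fun p : ℕ => (p : ℤ) ∣ v)) hv two_pos (fun p hp => by
      rw [mem_filter] at hp
      exact ⟨h𝒮 p hp.1, by exact_mod_cast (h𝒮 p hp.1).two_le, hp.2⟩)
  have hx0 : 0 < x := by rw [← h.exp_L]; positivity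
  have h2 : Real.log |(v : ℝ)| ≤ 2 + L + 2 * c * L := by
    have h4 : (4 : ℝ) ≤ Real.exp 2 := by
      have := Real.quadratic_le_exp_of_nonneg (x := 2) (by norm_num); linarith
    rw [Real.log_le_iff_le_exp (by positivity)]
    calc |(v : ℝ)| ≤ 4 * ⌊x⌋₊ * (x ^ c) ^ 2 := by exact_mod_cast hvx
      _ ≤ Real.exp 2 * Real.exp L * (Real.exp (L * c)) ^ 2 := by
          rw [Real.exp_mul, h.exp_L]
          gcongr
          exact h.floor_le
      _ = _ := by rw [← Real.exp_nat_mul, ← Real.exp_add, ← Real.exp_add]; push_cast; ring_nf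
  have h3 := Real.log_two_gt_d9
  have h5 : (0 : ℝ) ≤ #(𝒮.filter (fun p : ℕ => (p : ℤ) ∣ v)) := Nat.cast_nonneg _
  have h6 : (#(𝒮.filter (fun p : ℕ => (p : ℤ) ∣ v)) : ℝ) * (1 / 2) ≤ 2 + L + 2 * c * L :=
    (mul_le_mul_of_nonneg_left (by linarith) h5).trans (h1.trans h2)
  nlinarith

lemma le_sum_sieving {c C : ℝ} (hc : 0 < c) (hC : ∀ u v : ℝ, 2 ≤ u → u ≤ v →
    |∑ p ∈ primesBetween u v, 1 / (p : ℝ) - (Real.log (Real.log v) - Real.log (Real.log u))| ≤ C)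
    (hCℓ : C + c ≤ κ) {𝒢 : Finset ℕ} (h𝒢 : 𝒢 ⊆ primesBetween (Real.exp (ℓ ^ 2)) (Real.exp (L / ℓ ^ 3)))
    (hnb : #(primesBetween (Real.exp (ℓ ^ 2)) (Real.exp (L / ℓ ^ 3)) \ 𝒢) ≤ ⌊(4 + 4 * c) * L⌋₊) :
    ℓ * L / (16 * ψ) ≤ ∑ p ∈ 𝒢, 1 / (p : ℝ) * Real.log ((⌊Real.exp (L / (4 * ψ))⌋₊ : ℝ) / p) := by
  have hL := h.le_L
  have hℓ := h.le_ℓ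
  have hψ := h.ten_le_ψ
  have h1 : 1000 ≤ L / ψ := by rw [le_div_iff₀ (by linarith)]; nlinarith [h.ψ_le_ℓ, h.ℓ_le_L]
  have e1 : L / (4 * ψ) = L / ψ / 4 := by field_simp
  have h2 : Real.exp (L / ψ / 4) / 2 ≤ ⌊Real.exp (L / (4 * ψ))⌋₊ := by
    rw [e1]; exact half_exp_le_floor (by linarith)
  have h3 : Real.exp (L / ψ / 8) ≤ ⌊Real.exp (L / (4 * ψ))⌋₊ / Real.exp (L / ℓ ^ 3) := by
    rw [le_div_iff₀ (Real.exp_pos _)]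
    refine le_trans ?_ h2
    rw [← Real.exp_add]
    have h4 : Real.exp (L / ψ / 8 + L / ℓ ^ 3) * 2 ≤ Real.exp (L / ψ / 4) := by
      calc _ ≤ Real.exp (L / ψ / 8 + L / ℓ ^ 3) * Real.exp 1 := by
            gcongr; linarith [Real.exp_one_gt_d9]
        _ = Real.exp (L / ψ / 8 + L / ℓ ^ 3 + 1) := by rw [← Real.exp_add]
        _ ≤ _ := Real.exp_le_exp.2 (by linarith [h.div_cube_le])
    linarith
  have hσ := (abs_le.1 (h.abs_sum_sieving_sub_le hC)).1
  have h5 : (⌊(4 + 4 * c) * L⌋₊ : ℝ) / Real.exp (ℓ ^ 2) ≤ 1 := by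
    rw [div_le_one (Real.exp_pos _)]
    refine (Nat.floor_le (by positivity)).trans (le_trans ?_ h.pow_L_le)
    have hcL : c ≤ L := by
      have := h.mul_κ_le
      have := h.ℓ_le_L
      have hC0 : 0 ≤ C := le_trans (abs_nonneg _) (hC 2 2 le_rfl le_rfl)
      linarith [h.le_κ]
    calc (4 + 4 * c) * L ≤ (L + L * L) * L := by gcongr; linarith; linarith
      _ ≤ L ^ 4 := by nlinarith [pow_pos (by linarith : 0 < L) 3, pow_pos (by linarith : 0 < L) 2]
      _ ≤ _ := pow_le_pow_right₀ (by linarith) (by norm_num)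
  have hw : Real.exp (L / ℓ ^ 3) ≤ ⌊Real.exp (L / (4 * ψ))⌋₊ := by
    have h7 : 1 ≤ Real.exp (L / ψ / 8) := Real.one_le_exp (by positivity)
    exact (one_le_div (Real.exp_pos _)).1 (h7.trans h3)
  refine le_trans ?_ (le_sum_inv_mul_log_div h𝒢 (Real.exp_pos (ℓ ^ 2)) (w := Real.exp (L / ℓ ^ 3))
    (fun p hp => ?_) (Real.exp_pos _) hw (Nat.cast_le.2 hnb) (σ := ℓ - 5 * κ - C) (by linarith))
  · have h8 : L / ψ / 8 ≤ Real.log (⌊Real.exp (L / (4 * ψ))⌋₊ / Real.exp (L / ℓ ^ 3)) := by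
      rw [Real.le_log_iff_exp_le (lt_of_lt_of_le (Real.exp_pos _) h3)]
      exact h3
    have h9 : ℓ / 2 ≤ ℓ - 5 * κ - C - ⌊(4 + 4 * c) * L⌋₊ / Real.exp (ℓ ^ 2) := by
      linarith [h.mul_κ_le, h.le_κ]
    calc ℓ * L / (16 * ψ) = ℓ / 2 * (L / ψ / 8) := by field_simp; norm_num
      _ ≤ _ := mul_le_mul h9 h8 (by positivity) (by linarith)
  · rw [mem_primesBetween] at hp
    exact ⟨hp.1.pos, hp.2.1.le, hp.2.2⟩

end LogScale
end LogScalePrimes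

section SievedMeanValue
open Finset

variable {f a b : ℕ → ℤ}

lemma one_add_mul_error_le {L ℓ ψ S c l l₁ bl nb A y : ℝ} (hL : 2000000 ≤ L) (hℓ : 1 ≤ ℓ) (hℓL : ℓ ≤ L)
    (hψ : 1 ≤ ψ) (hS1 : 1 ≤ S) (hSℓ : S ≤ ℓ) (hc : 0 ≤ c) (hc1 : c ≤ L) (hl : l ≤ L) (hl10 : 0 ≤ l₁)
    (hl1 : l₁ ≤ L + 1) (hbl0 : 0 ≤ bl) (hbl : bl ≤ 3 / L ^ 3) (hA : L ^ 20 ≤ A) (hy2 : L ^ 20 / 2 ≤ y)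
    (hnb00 : 0 ≤ nb) (hnb0 : nb ≤ (4 + 4 * c) * L) :
    (1 + l) * (2 * (1 + l₁) * bl + 2 * (S / A) + 5 * nb * S / y + 24 * S / (ℓ * L / (16 * ψ))) ≤
      (900 + c) * ψ / ℓ * S ^ 2 := by
  have hA0 : 0 < A := lt_of_lt_of_le (by positivity) hA
  have hy0 : 0 < y := lt_of_lt_of_le (by positivity) hy2
  have hSS : S ≤ S ^ 2 := by nlinarith
  have t1 : 2 * (1 + l₁) * bl ≤ 12 / L ^ 2 := by
    calc _ ≤ 2 * (L + L) * (3 / L ^ 3) :=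
          mul_le_mul (by linarith) hbl hbl0 (by linarith)
      _ = _ := by field_simp; norm_num
  have hpow : ∀ j : ℕ, j ≤ 17 → L ^ j * 1000 ≤ L ^ 18 := by
    intro j hj
    calc L ^ j * 1000 ≤ L ^ 17 * L := by
          gcongr
          · linarith
          · linarith
      _ = _ := by ring
  have t2 : 2 * (S / A) ≤ 1 / L ^ 2 := by
    calc _ ≤ 2 * (L / L ^ 20) := by gcongr; linarith [hℓL]
      _ ≤ _ := by
        rw [← mul_div_assoc, div_le_div_iff₀ (by positivity) (by positivity)]
        have := hpow 1 (by norm_num)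
        nlinarith [pow_pos (by linarith : 0 < L) 2]
  have hnb : nb ≤ 8 * L ^ 2 := by
    refine hnb0.trans ?_
    nlinarith
  have t3 : 5 * nb * S / y ≤ 1 / L ^ 2 := by
    calc _ ≤ 5 * (8 * L ^ 2) * L / (L ^ 20 / 2) := by gcongr; linarith [hℓL]
      _ ≤ _ := by
        rw [div_le_div_iff₀ (by positivity) (by positivity)]
        have := hpow 3 (by norm_num)
        nlinarith [pow_pos (by linarith : 0 < L) 2, pow_pos (by linarith : 0 < L) 3]
  have t4 : 24 * S / (ℓ * L / (16 * ψ)) = 384 * S * ψ / (ℓ * L) := by field_simp; norm_num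
  have hE' : 2 * (1 + l₁) * bl + 2 * (S / A) + 5 * nb * S / y + 24 * S / (ℓ * L / (16 * ψ)) ≤ 14 / L ^ 2 + 384 * S * ψ / (ℓ * L) := by
    rw [t4]
    have : 14 / L ^ 2 = 12 / L ^ 2 + 1 / L ^ 2 + 1 / L ^ 2 := by ring
    linarith
  calc _ ≤ (2 * L) * (14 / L ^ 2 + 384 * S * ψ / (ℓ * L)) :=
        mul_le_mul (by linarith) hE' (by positivity) (by linarith)
    _ = 28 / L + 768 * S * ψ / ℓ := by field_simp; ring
    _ ≤ 28 * ψ / ℓ * S ^ 2 + 768 * S ^ 2 * ψ / ℓ := by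
        refine add_le_add ?_ (by gcongr)
        calc 28 / L ≤ 28 / ℓ := by gcongr
          _ ≤ 28 * ψ / ℓ * S ^ 2 := by
            rw [div_mul_eq_mul_div]
            gcongr
            nlinarith
    _ = 796 * ψ / ℓ * S ^ 2 := by ring
    _ ≤ _ := by gcongr; linarith

lemma le_of_sq_mul_le {L ℓ ψ S c l X x B B₀ E N A H : ℝ} (hL : 2000000 ≤ L) (hℓ : 1 ≤ ℓ) (hℓL : ℓ ≤ L)
    (hψ : 1 ≤ ψ) (hψℓ : 4 * ψ ≤ ℓ) (hS1 : 1 ≤ S) (hc : 0 ≤ c) (hX : X ≤ x) (hX0 : 0 ≤ X) (hxL : L ^ 20 ≤ x)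
    (hA : L ^ 20 ≤ A) (hB00 : 0 ≤ B₀) (hB : B₀ ≤ B) (hHA : H / A ≤ 1 / L ^ 20) (hH0 : 0 ≤ H)
    (hE : (1 + l) * E ≤ (900 + c) * ψ / ℓ * S ^ 2)
    (main : S ^ 2 * N ≤ X * (8 * S * √S + 8 * S + 4 * S ^ 2 / A + 2 * (192 * ψ / L) * ψ * B₀ + (1 + l) * E) +
      2 * ψ ^ 2 * (X * H / A + 1)) :
    N ≤ x * (8 / √S + 8 / S + (1000 + c) * ψ / ℓ + 384 * ψ ^ 2 * B / L) := by
  have hA0 : 0 < A := lt_of_lt_of_le (by positivity) hA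
  have hx0 : 0 < x := lt_of_lt_of_le (by positivity) hxL
  have hS2 : 0 < S ^ 2 := by positivity
  have hLℓ : 4 * ℓ ≤ L ^ 20 := by
    calc 4 * ℓ ≤ L * L := by gcongr; linarith
      _ = L ^ 2 := by ring
      _ ≤ _ := pow_le_pow_right₀ (by linarith) (by norm_num)
  have hB0 : 0 ≤ B := hB00.trans hB
  have m1 : 8 * S * √S = 8 / √S * S ^ 2 := by
    have h1 : √S * √S = S := Real.mul_self_sqrt (by linarith)
    have h2 : 0 < √S := Real.sqrt_pos.2 (by linarith)
    rw [div_mul_eq_mul_div, eq_div_iff h2.ne', mul_assoc, h1]; ring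
  have m2 : 8 * S = 8 / S * S ^ 2 := by field_simp
  have m3 : 4 * S ^ 2 / A ≤ ψ / ℓ * S ^ 2 := by
    calc 4 * S ^ 2 / A ≤ 4 * S ^ 2 / (4 * ℓ) := by
          gcongr; exact hLℓ.trans hA
      _ = 1 / ℓ * S ^ 2 := by field_simp
      _ ≤ _ := by gcongr
  have m4 : 2 * (192 * ψ / L) * ψ * B₀ ≤ 384 * ψ ^ 2 * B / L * S ^ 2 := by
    calc _ ≤ 2 * (192 * ψ / L) * ψ * B := by gcongr
      _ = 384 * ψ ^ 2 * B / L * 1 := by ring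
      _ ≤ _ := by gcongr; nlinarith
  have m5 : 2 * ψ ^ 2 * (X * H / A + 1) ≤ x * (ψ / ℓ * S ^ 2) := by
    have h1 : X * H / A ≤ x * (1 / L ^ 20) := by
      rw [mul_div_assoc]
      exact mul_le_mul hX hHA (by positivity) hx0.le
    have h2 : 1 ≤ x * (1 / L ^ 20) := by
      rw [mul_one_div, le_div_iff₀ (by positivity)]; linarith
    have h3 : ψ * (4 * ℓ) ≤ L ^ 20 := by
      calc ψ * (4 * ℓ) ≤ L * L := by
            have := hℓL
            have := mul_le_mul (by linarith : 4 * ψ ≤ L) hℓL (by linarith) (by linarith)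
            linarith
        _ = L ^ 2 := by ring
        _ ≤ _ := pow_le_pow_right₀ (by linarith) (by norm_num)
    calc _ ≤ 2 * ψ ^ 2 * (x * (1 / L ^ 20) + x * (1 / L ^ 20)) := by gcongr
      _ = x * (4 * ψ ^ 2 / L ^ 20) := by ring
      _ ≤ x * (4 * ψ ^ 2 / (ψ * (4 * ℓ))) := by gcongr
      _ = x * (ψ / ℓ * 1) := by field_simp
      _ ≤ _ := by gcongr; nlinarith
  refine le_of_mul_le_mul_left (main.trans ?_) hS2
  calc _ ≤ x * (8 / √S * S ^ 2 + 8 / S * S ^ 2 + ψ / ℓ * S ^ 2 + 384 * ψ ^ 2 * B / L * S ^ 2 +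
        (900 + c) * ψ / ℓ * S ^ 2) + x * (ψ / ℓ * S ^ 2) := by
        refine add_le_add (le_trans (mul_le_mul_of_nonneg_left ?_ hX0)
          (mul_le_mul_of_nonneg_right hX (by positivity))) m5
        linarith
    _ = x * S ^ 2 * (8 / √S + 8 / S + (902 + c) * ψ / ℓ + 384 * ψ ^ 2 * B / L) := by ring
    _ ≤ x * S ^ 2 * (8 / √S + 8 / S + (1000 + c) * ψ / ℓ + 384 * ψ ^ 2 * B / L) := by gcongr; norm_num
    _ = _ := by ring

lemma LogScale.norm_sum_sieved_le
    (ha0 : ∀ m : ℕ, 1 < m → a m ≠ 0) (hb0 : ∀ m : ℕ, 1 < m → b m ≠ 0)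
    (hrec : ∀ m : ℕ, 0 < m → ∀ P : ℕ, P.Prime → ¬ P ∣ m → f (m * P) = (P : ℤ) * a m + b m)
    {c : ℝ} (hc : 0 < c)
    (habd : ∀ m : ℕ, 1 < m → (|a m| : ℝ) ≤ (m : ℝ) ^ c)
    (hbbd : ∀ m : ℕ, 1 < m → (|b m| : ℝ) ≤ (m : ℝ) ^ c)
    {x L ℓ κ ψ : ℝ} (h : LogScale x L ℓ κ ψ)
    {C : ℝ} (hC : ∀ u v : ℝ, 2 ≤ u → u ≤ v →
      |∑ p ∈ primesBetween u v, 1 / (p : ℝ) - (Real.log (Real.log v) - Real.log (Real.log u))| ≤ C)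
    (hCℓ : C + c ≤ κ) {S : ℝ} (hS : ∑ P ∈ primesBetween (Real.exp (L / ψ)) x, 1 / (P : ℝ) = S)
    (hS1 : 1 ≤ S) {𝒮 : Finset ℕ}
    (h𝒮 : 𝒮 = primesBetween (Real.exp (ℓ ^ 2)) (Real.exp (L / ℓ ^ 3))) {B : ℝ}
    (hB : ∑ m ∈ (Ioo 1 ⌊x⌋₊).filter (fun m => ∃ p ∈ 𝒮,
      (p : ℤ) ∣ a m ∧ (p : ℤ) ∣ b m), 1 / (m : ℝ) ≤ B)
    {z : ℂ} (hz : ‖1 + z‖ = 1) (hz1 : ‖z‖ ≤ 1) :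
    ‖∑ n ∈ Icc 1 ⌊x⌋₊, ((1 + z) ^ #(𝒮.filter
      (fun p : ℕ => (p : ℤ) ∣ f n)) -
        ∏ p ∈ 𝒮, (1 + z / p))‖ ≤
      x * (8 / √S + 8 / S + (1000 + c) * ψ / ℓ + 384 * ψ ^ 2 * B / L) := by
  subst h𝒮
  have hL := h.le_L
  have hℓ := h.le_ℓ
  have hκ := h.le_κ
  have hψ := h.ten_le_ψ
  have hψℓ := h.ψ_le_ℓ
  have hC0 : 0 ≤ C := le_trans (abs_nonneg _) (hC 2 2 le_rfl le_rfl)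
  have hx0 : 0 < x := by rw [← h.exp_L]; positivity
  have hx1 : 1 ≤ x := by rw [← h.exp_L]; exact Real.one_le_exp (by linarith)
  have hSψ := (abs_le.1 (h.abs_sum_averaging_sub_le hC)).2
  rw [hS] at hSψ
  have hSℓ : S ≤ ℓ := by
    have := Real.log_le_sub_one_of_pos (by linarith : 0 < ψ)
    linarith [h.mul_κ_le]
  have hAlow : L ^ 20 ≤ (⌊Real.exp (L / ψ)⌋₊ : ℝ) := h.pow_L_le.trans h.exp_sq_le_floor
  have hA0 : 0 < ⌊Real.exp (L / ψ)⌋₊ := by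
    have : (0 : ℝ) < ⌊Real.exp (L / ψ)⌋₊ := lt_of_lt_of_le (by positivity) hAlow
    exact_mod_cast this
  have hDψ : 1 ≤ L / (4 * ψ) := by
    rw [le_div_iff₀ (by positivity)]; nlinarith [h.ℓ_le_L]
  have hσ := (abs_le.1 (h.abs_sum_sieving_sub_le hC)).2
  have h𝒜 : ∀ P ∈ primesBetween (Real.exp (L / ψ)) x, P.Prime ∧ ⌊Real.exp (L / ψ)⌋₊ < P ∧ P ≤ ⌊x⌋₊ := by
    intro P hP
    rw [mem_primesBetween] at hP
    exact ⟨hP.1, (Nat.floor_lt (Real.exp_pos _).le).2 hP.2.1, (Nat.le_floor_iff' hP.1.ne_zero).2 hP.2.2⟩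
  have h𝒮 : ∀ p ∈ primesBetween (Real.exp (ℓ ^ 2)) (Real.exp (L / ℓ ^ 3)),
      p.Prime ∧ ⌊Real.exp (ℓ ^ 2)⌋₊ < p ∧ p ≤ ⌊Real.exp (L / ψ)⌋₊ := by
    intro p hp
    rw [mem_primesBetween] at hp
    refine ⟨hp.1, (Nat.floor_lt (Real.exp_pos _).le).2 hp.2.1, (Nat.le_floor_iff' hp.1.ne_zero).2
      (hp.2.2.trans (Real.exp_le_exp.2 (h.div_cube_le.trans ?_)))⟩
    have : 0 ≤ L / ψ := by positivity
    linarith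
  have hD : ∀ U ⊆ primesBetween (Real.exp (ℓ ^ 2)) (Real.exp (L / ℓ ^ 3)), #U ≤ ⌈20 * ℓ⌉₊ →
      ∏ p ∈ U, p ≤ ⌊Real.exp (21 * L / ℓ ^ 2)⌋₊ := by
    intro U hU hUk
    refine Nat.le_floor ?_
    have hk2 : (#U : ℝ) ≤ 21 * ℓ := by
      have := (Nat.ceil_lt_add_one (by positivity : 0 ≤ 20 * ℓ)).le
      have h1 : (#U : ℝ) ≤ ⌈20 * ℓ⌉₊ := by exact_mod_cast hUk
      linarith
    push_cast
    calc ∏ p ∈ U, (p : ℝ) ≤ ∏ _p ∈ U, Real.exp (L / ℓ ^ 3) :=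
          prod_le_prod (fun _ _ => Nat.cast_nonneg _) fun p hp => (mem_primesBetween.1 (hU hp)).2.2
      _ = Real.exp (#U * (L / ℓ ^ 3)) := by rw [prod_const, Real.exp_nat_mul]
      _ ≤ Real.exp (21 * ℓ * (L / ℓ ^ 3)) := by gcongr
      _ = _ := by congr 1; field_simp
  have hDA : ⌊Real.exp (21 * L / ℓ ^ 2)⌋₊ ≤ ⌊Real.exp (L / ψ)⌋₊ := by
    refine Nat.floor_le_floor (Real.exp_le_exp.2 ?_)
    rw [div_le_div_iff₀ (by positivity) (by positivity)]
    nlinarith [mul_pos (by linarith : 0 < L) (by linarith : 0 < ℓ), mul_pos (by linarith : 0 < L) (by linarith : 0 < ψ)]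
  have hDA' : ⌊Real.exp (L / (4 * ψ))⌋₊ ^ 4 ≤ ⌊Real.exp (L / ψ)⌋₊ := by
    refine Nat.le_floor ?_
    push_cast
    calc (⌊Real.exp (L / (4 * ψ))⌋₊ : ℝ) ^ 4 ≤ Real.exp (L / (4 * ψ)) ^ 4 := by
          gcongr; exact Nat.floor_le (Real.exp_pos _).le
      _ = _ := by rw [← Real.exp_nat_mul]; congr 1; push_cast; field_simp
  have hV : ∀ g : ℕ → ℤ, (∀ m : ℕ, 1 < m → (|g m| : ℝ) ≤ (m : ℝ) ^ c) →
      ∀ n : ℕ, 1 < n → n ≤ ⌊x⌋₊ → (|g n| : ℝ) ≤ x ^ c := fun g hg n hn hnx =>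
    (hg n hn).trans (Real.rpow_le_rpow (by positivity) ((Nat.le_floor_iff' (by omega)).1 hnx) hc.le)
  have hG0 : 0 < ℓ * L / (16 * ψ) := by positivity
  have hy0 : 0 < ⌊Real.exp (ℓ ^ 2)⌋₊ := Nat.floor_pos.2 (Real.one_le_exp (by positivity))
  have key := fun m hm => norm_sum_goodPairs_le ha0 hb0 hrec (X := ⌊x⌋₊) (A := ⌊Real.exp (L / ψ)⌋₊)
    (H := ⌈Real.exp (L / ℓ)⌉₊) (D := ⌊Real.exp (21 * L / ℓ ^ 2)⌋₊) (D' := ⌊Real.exp (L / (4 * ψ))⌋₊)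
    (y := ⌊Real.exp (ℓ ^ 2)⌋₊) (k := ⌈20 * ℓ⌉₊) (nb := ⌊(4 + 4 * c) * L⌋₊) (m := m) hm
    (Nat.ceil_pos.2 (Real.exp_pos _)) hy0 hDA hA0
    (Nat.floor_pos.2 (Real.one_le_exp (by linarith))) hDA' (fun P hP => ⟨(h𝒜 P hP).1, (h𝒜 P hP).2.1⟩) h𝒮 hD hS.le
    (Real.one_le_exp zero_le_one) (μ := ℓ) (by linarith) hz hz1 hG0
    (fun 𝒢 h1 h2 => h.le_sum_sieving hc hC hCℓ h1 h2) (hV a habd) (hV b hbbd)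
    (fun v hv hvx => h.card_dvd_le (fun p hp => (h𝒮 p hp).1) hv hvx)
  have hlogX : Real.log ⌊x⌋₊ ≤ L := by
    rw [← h.log_x]
    exact Real.log_le_log (by exact_mod_cast Nat.floor_pos.2 hx1) h.floor_le
  have hlogX1 : Real.log ((⌊x⌋₊ : ℝ) + 1) ≤ L + 1 := by
    rw [Real.log_le_iff_le_exp (by positivity), Real.exp_add, h.exp_L]
    nlinarith [h.floor_le, Real.exp_one_gt_d9]
  have hlogX0 : 0 ≤ Real.log (⌊x⌋₊ : ℝ) := Real.log_natCast_nonneg _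
  have hlogX10 : 0 ≤ Real.log ((⌊x⌋₊ : ℝ) + 1) := Real.log_nonneg (by linarith [Nat.cast_nonneg (α := ℝ) ⌊x⌋₊])
  have hbl0 := blockError_nonneg ⌈20 * ℓ⌉₊ ⌊Real.exp (ℓ ^ 2)⌋₊ ⌊Real.exp (21 * L / ℓ ^ 2)⌋₊ ⌈Real.exp (L / ℓ)⌉₊
    (Real.one_le_exp zero_le_one) ℓ
  obtain ⟨E, hEdef⟩ : ∃ E : ℝ, E = 2 * (1 + Real.log ((⌊x⌋₊ : ℝ) + 1)) * blockError ⌈20 * ℓ⌉₊ ⌊Real.exp (ℓ ^ 2)⌋₊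
      ⌊Real.exp (21 * L / ℓ ^ 2)⌋₊ ⌈Real.exp (L / ℓ)⌉₊ (Real.exp 1) ℓ + 2 * (S / ⌊Real.exp (L / ψ)⌋₊) +
      5 * ⌊(4 + 4 * c) * L⌋₊ * S / ⌊Real.exp (ℓ ^ 2)⌋₊ + 24 * S / (ℓ * L / (16 * ψ)) := ⟨_, rfl⟩
  simp only [← hEdef] at key
  have hE0 : 0 ≤ E := by rw [hEdef]; positivity
  have hc1 : c ≤ L := by linarith [h.mul_κ_le, h.ℓ_le_L]
  have hE : (1 + Real.log ⌊x⌋₊) * E ≤ (900 + c) * ψ / ℓ * S ^ 2 := by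
    have hy2 := LogScale.half_exp_le_floor (t := ℓ ^ 2) (by nlinarith)
    rw [hEdef]
    exact one_add_mul_error_le hL (by linarith) h.ℓ_le_L (by linarith) hS1 hSℓ hc.le hc1 hlogX hlogX10
      hlogX1 hbl0 h.blockError_le hAlow (by linarith [h.pow_L_le]) (Nat.cast_nonneg _) (Nat.floor_le (by positivity))
  have hg : ∀ n, ‖(1 + z) ^ #((primesBetween (Real.exp (ℓ ^ 2)) (Real.exp (L / ℓ ^ 3))).filter
      (fun p : ℕ => (p : ℤ) ∣ f n)) -
        ∏ p ∈ primesBetween (Real.exp (ℓ ^ 2)) (Real.exp (L / ℓ ^ 3)), (1 + z / p)‖ ≤ 2 := by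
    intro n
    refine (norm_sub_le _ _).trans ?_
    rw [norm_pow, hz, one_pow, norm_prod]
    have : ∏ p ∈ primesBetween (Real.exp (ℓ ^ 2)) (Real.exp (L / ℓ ^ 3)), ‖1 + z / (p : ℂ)‖ ≤ 1 :=
      prod_le_one (fun _ _ => norm_nonneg _) fun p hp => norm_one_add_div_le_one hz (h𝒮 p hp).1.pos
    linarith
  have main := sq_mul_norm_sum_le (a := a) (b := b) hA0 h𝒜 hS hg hE0 key (by positivity : 0 ≤ 192 * ψ / L) h.card_averaging_le
    h.card_averaging_dvd_le
  have hxL : L ^ 20 ≤ x := by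
    refine h.pow_L_le.trans ?_
    rw [← h.exp_L]
    refine Real.exp_le_exp.2 (le_trans ?_ h.pow_ℓ_le)
    exact pow_le_pow_right₀ (by linarith) (by norm_num)
  exact le_of_sq_mul_le hL (by linarith) h.ℓ_le_L (by linarith) (by linarith) hS1 hc.le h.floor_le (Nat.cast_nonneg _)
    hxL hAlow (sum_nonneg fun _ _ => by positivity) hB h.ceil_div_floor_le (Nat.cast_nonneg _) hE main

end SievedMeanValue

section TotalMeanValue
open Finset

variable {f a b : ℕ → ℤ}

lemma LogScale.sum_norm_pow_sub_pow_le
    (hf0 : ∀ n : ℕ, 1 < n → f n ≠ 0)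
    (hrec : ∀ m : ℕ, 0 < m → ∀ P : ℕ, P.Prime → ¬ P ∣ m → f (m * P) = (P : ℤ) * a m + b m)
    {c : ℝ} (hc : 0 < c) (hfbd : ∀ m : ℕ, 1 < m → (|f m| : ℝ) ≤ (m : ℝ) ^ c)
    {x L ℓ κ ψ : ℝ} (h : LogScale x L ℓ κ ψ)
    {C : ℝ} (hC0 : ∀ v : ℝ, 2 ≤ v → |∑ p ∈ primesBetween 0 v, 1 / (p : ℝ) - Real.log (Real.log v)| ≤ C)
    (hC : ∀ u v : ℝ, 2 ≤ u → u ≤ v →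
      |∑ p ∈ primesBetween u v, 1 / (p : ℝ) - (Real.log (Real.log v) - Real.log (Real.log u))| ≤ C)
    (hCκ : C ≤ κ) {S : ℝ} (hS : ∑ P ∈ primesBetween (Real.exp (L / ψ)) x, 1 / (P : ℝ) = S)
    (hS1 : 1 ≤ S) {𝒮 𝒬 : Finset ℕ}
    (h𝒮 : 𝒮 = primesBetween (Real.exp (ℓ ^ 2)) (Real.exp (L / ℓ ^ 3)))
    (h𝒬 : 𝒬 = primesBetween (L ^ 2) (Real.exp (L / κ))) {B I : ℝ}
    (hB : ∑ m ∈ (Ioo 1 ⌊x⌋₊).filter (fun m => ∃ p ∈ 𝒬, (p : ℤ) ∣ a m ∧ (p : ℤ) ∣ b m), 1 / (m : ℝ) ≤ B)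
    (hI : ∑ p ∈ (range (⌊L ^ 2⌋₊ + 1)).filter Nat.Prime,
      ∑ m ∈ (Icc 1 ⌊x⌋₊).filter (fun m : ℕ => (p : ℤ) ∣ a m ∧ (p : ℤ) ∣ b m), (1 : ℝ) / m ≤ I)
    {z : ℂ} (hz : ‖1 + z‖ = 1) {τ : ℝ} (hzτ : ‖z‖ ≤ τ) :
    ∑ n ∈ Icc 2 ⌊x⌋₊, ‖(1 + z) ^ #(f n).natAbs.primeFactors -
        (1 + z) ^ #(𝒮.filter (fun p : ℕ => (p : ℤ) ∣ f n))‖ ≤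
      x * (6 / S + 400 * ψ / ℓ + 384 * ψ ^ 2 * B / L + τ * (192 * ψ * I / L + 400 * (7 + c) * ψ * κ)) := by
  have hL := h.le_L
  have hℓ := h.le_ℓ
  have hκ := h.le_κ
  have hψ := h.ten_le_ψ
  have hψℓ := h.ψ_le_ℓ
  have hC00 : 0 ≤ C := le_trans (abs_nonneg _) (hC 2 2 le_rfl le_rfl)
  have hx0 : 0 < x := by rw [← h.exp_L]; positivity
  have hx1 : 1 ≤ x := by rw [← h.exp_L]; exact Real.one_le_exp (by linarith)
  have hSψ := (abs_le.1 (h.abs_sum_averaging_sub_le hC)).2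
  rw [hS] at hSψ
  have hSℓ : S ≤ ℓ := by
    have := Real.log_le_sub_one_of_pos (by linarith : 0 < ψ)
    linarith [h.mul_κ_le]
  have hAlow : L ^ 20 ≤ (⌊Real.exp (L / ψ)⌋₊ : ℝ) := h.pow_L_le.trans h.exp_sq_le_floor
  have hA0 : 0 < ⌊Real.exp (L / ψ)⌋₊ := by
    have : (0 : ℝ) < ⌊Real.exp (L / ψ)⌋₊ := lt_of_lt_of_le (by positivity) hAlow
    exact_mod_cast this
  have h𝒜 : ∀ P ∈ primesBetween (Real.exp (L / ψ)) x, P.Prime ∧ ⌊Real.exp (L / ψ)⌋₊ < P ∧ P ≤ ⌊x⌋₊ := by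
    intro P hP
    rw [mem_primesBetween] at hP
    exact ⟨hP.1, (Nat.floor_lt (Real.exp_pos _).le).2 hP.2.1, (Nat.le_floor_iff' hP.1.ne_zero).2 hP.2.2⟩
  have hsqκ : ℓ ^ 2 ≤ L / κ := by
    have h1 : L / ℓ ≤ L / κ := div_le_div_of_nonneg_left (by linarith) (by linarith) (by linarith [h.mul_κ_le])
    linarith [h.sq_ℓ_le_div, sq_nonneg ℓ]
  have hcubeκ : L / ℓ ^ 3 ≤ L / κ := by
    refine div_le_div_of_nonneg_left (by linarith) (by linarith) ?_
    have : ℓ ≤ ℓ ^ 3 := le_self_pow₀ (by linarith) (by norm_num)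
    linarith [h.mul_κ_le]
  have hpos : 2 ≤ Real.exp (L / ℓ ^ 3) := by
    have := Real.add_one_le_exp (L / ℓ ^ 3)
    nlinarith [h.sq_le_div_cube]
  obtain ⟨𝒯, h𝒯def⟩ : ∃ 𝒯, 𝒯 = primesBetween 0 (Real.exp (ℓ ^ 2)) ∪
    primesBetween (Real.exp (L / ℓ ^ 3)) (Real.exp (L / κ)) := ⟨_, rfl⟩
  have h𝒯 : ∀ p ∈ 𝒯, p.Prime ∧ (p : ℝ) ≤ Real.exp (L / κ) := by
    intro p hp
    rw [h𝒯def, mem_union, mem_primesBetween, mem_primesBetween] at hp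
    rcases hp with hp | hp
    · exact ⟨hp.1, hp.2.2.trans (Real.exp_le_exp.2 hsqκ)⟩
    · exact ⟨hp.1, hp.2.2⟩
  have h𝒯𝒬 : 𝒯 ⊆ (range (⌊L ^ 2⌋₊ + 1)).filter Nat.Prime ∪ 𝒬 := by
    intro p hp
    obtain ⟨hp1, hp2⟩ := h𝒯 p hp
    rw [mem_union, mem_filter, mem_range, Nat.lt_succ_iff, h𝒬, mem_primesBetween]
    rcases le_or_gt (p : ℝ) (L ^ 2) with h1 | h1
    · exact Or.inl ⟨Nat.le_floor h1, hp1⟩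
    · exact Or.inr ⟨hp1, h1, hp2⟩
  have hcov : ∀ p : ℕ, p.Prime → (p : ℝ) ≤ Real.exp (L / κ) → p ∈ 𝒮 ∨ p ∈ 𝒯 := by
    intro p hp hpx
    rw [h𝒮, h𝒯def, mem_union, mem_primesBetween, mem_primesBetween, mem_primesBetween]
    rcases le_or_gt (p : ℝ) (Real.exp (ℓ ^ 2)) with h1 | h1
    · exact Or.inr (Or.inl ⟨hp, by exact_mod_cast hp.pos, h1⟩)
    rcases le_or_gt (p : ℝ) (Real.exp (L / ℓ ^ 3)) with h2 | h2
    · exact Or.inl ⟨hp, h1, h2⟩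
    · exact Or.inr (Or.inr ⟨hp, h2, hpx⟩)
  have hT : ∑ p ∈ 𝒯, 1 / (p : ℝ) ≤ 7 * κ := by
    have h1 := (abs_le.1 (hC0 (Real.exp (ℓ ^ 2)) (by
      have := Real.add_one_le_exp (ℓ ^ 2); nlinarith))).2
    have h2 := (abs_le.1 (hC (Real.exp (L / ℓ ^ 3)) (Real.exp (L / κ)) hpos (Real.exp_le_exp.2 hcubeκ))).2
    rw [Real.log_exp, Real.log_pow, h.log_ℓ] at h1
    rw [Real.log_exp, Real.log_exp, Real.log_div (by linarith) (by linarith), Real.log_div (by linarith) (by positivity),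
      Real.log_pow, h.log_ℓ, h.log_κ, h.log_L] at h2
    push_cast at h1 h2
    have h3 : ∑ p ∈ 𝒯, 1 / (p : ℝ) ≤ ∑ p ∈ primesBetween 0 (Real.exp (ℓ ^ 2)), 1 / (p : ℝ) +
        ∑ p ∈ primesBetween (Real.exp (L / ℓ ^ 3)) (Real.exp (L / κ)), 1 / (p : ℝ) := by
      rw [h𝒯def, ← sum_union_inter]
      exact le_add_of_nonneg_right (sum_nonneg fun _ _ => by positivity)
    linarith
  have hR : ∀ n ∈ Icc 2 ⌊x⌋₊, (#((f n).natAbs.primeFactors.filter (fun p : ℕ => Real.exp (L / κ) < p)) : ℝ) ≤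
      c * κ := by
    intro n hn
    rw [mem_Icc] at hn
    have hn0 : (0 : ℝ) < n := by exact_mod_cast (by omega : 0 < n)
    have hnx : (n : ℝ) ≤ x := (Nat.le_floor_iff' (by omega)).1 hn.2
    have h1 := card_mul_log_le_log_abs (v := f n) (hf0 n (by omega)) (Real.exp_pos (L / κ))
      (U := (f n).natAbs.primeFactors.filter (fun p : ℕ => Real.exp (L / κ) < p)) (fun p hp => by
        rw [mem_filter, Nat.mem_primeFactors] at hp
        exact ⟨hp.1.1, hp.2.le, Int.natCast_dvd.2 hp.1.2.1⟩)
    rw [Real.log_exp] at h1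
    have h2 : Real.log |(f n : ℝ)| ≤ c * L := by
      have h3 : (f n : ℝ) ≠ 0 := by exact_mod_cast hf0 n (by omega)
      calc Real.log |(f n : ℝ)| ≤ Real.log ((n : ℝ) ^ c) :=
            Real.log_le_log (by positivity) (by exact_mod_cast hfbd n (by omega))
        _ = c * Real.log n := Real.log_rpow hn0 c
        _ ≤ c * L := by
          rw [← h.log_x]
          exact mul_le_mul_of_nonneg_left (Real.log_le_log hn0 hnx) hc.le
    refine le_of_mul_le_mul_right (h1.trans (h2.trans (le_of_eq ?_))) (by positivity : 0 < L / κ)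
    field_simp
  have key := _root_.sum_norm_pow_sub_pow_le (𝒮 := 𝒮) hf0 hrec hA0 h𝒜
    (fun p hp => (mem_primesBetween.1 (h𝒮 ▸ hp)).1) (fun p hp => (h𝒯 p hp).1) h𝒯𝒬 hcov hS (by linarith)
    (by positivity : 0 ≤ 192 * ψ / L) h.card_averaging_le
    (fun p hp => h.card_averaging_modEq_le (Or.inr (h𝒯 p hp).1) (h𝒯 p hp).2) hT (by positivity : 0 ≤ c * κ) hR hz
  have hlogX : Real.log ⌊x⌋₊ ≤ L := by
    rw [← h.log_x]
    exact Real.log_le_log (by exact_mod_cast Nat.floor_pos.2 hx1) h.floor_le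
  have hlogX0 : 0 ≤ Real.log (⌊x⌋₊ : ℝ) := Real.log_natCast_nonneg _
  have hLℓ : 2 * ℓ * ℓ ≤ L ^ 20 := by
    calc 2 * ℓ * ℓ ≤ L * L * L := by
          gcongr
          · linarith
          · exact h.ℓ_le_L
          · exact h.ℓ_le_L
      _ = L ^ 3 := by ring
      _ ≤ _ := pow_le_pow_right₀ (by linarith) (by norm_num)
  have m1 : 2 * S / ⌊Real.exp (L / ψ)⌋₊ ≤ ψ / ℓ := by
    calc 2 * S / ⌊Real.exp (L / ψ)⌋₊ ≤ 2 * ℓ / (2 * ℓ * ℓ) := by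
          gcongr; exact hLℓ.trans hAlow
      _ = 1 / ℓ := by field_simp
      _ ≤ _ := by gcongr; linarith
  have m2 : 2 * (192 * ψ / L) ≤ 384 * ψ / ℓ := by
    calc 2 * (192 * ψ / L) = 384 * ψ / L := by ring
      _ ≤ _ := by gcongr; exact h.ℓ_le_L
  have hB0 : 0 ≤ B := le_trans (sum_nonneg fun _ _ => by positivity) hB
  have hI0 : 0 ≤ I := le_trans (sum_nonneg fun _ _ => sum_nonneg fun _ _ => by positivity) hI
  have m3 : 2 * (192 * ψ / L) * B ≤ 384 * ψ ^ 2 * B / L := by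
    calc 2 * (192 * ψ / L) * B = 384 * ψ * B / L * 1 := by ring
      _ ≤ 384 * ψ * B / L * ψ := by gcongr; linarith
      _ = _ := by ring
  have hτ : 0 ≤ τ := (norm_nonneg z).trans hzτ
  have m4 : ‖z‖ * (192 * ψ / L) * (I + (1 + Real.log ⌊x⌋₊) * (7 * κ + c * κ)) ≤
      τ * (192 * ψ * I / L + 400 * (7 + c) * ψ * κ) := by
    have hlog2 : 1 + Real.log ⌊x⌋₊ ≤ 2 * L := by linarith
    calc _ ≤ τ * (192 * ψ / L) * (I + (2 * L) * (7 * κ + c * κ)) := by gcongr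
      _ = τ * (192 * ψ * I / L + 384 * (7 + c) * ψ * κ) := by field_simp; ring
      _ ≤ _ := by gcongr; norm_num
  have m5 : ∀ B₀ I₀ : ℝ, B₀ ≤ B → I₀ ≤ I → (⌊x⌋₊ : ℝ) * (6 / S + 2 * S / ⌊Real.exp (L / ψ)⌋₊ + 2 * (192 * ψ / L) +
      2 * (192 * ψ / L) * B₀ + ‖z‖ * (192 * ψ / L) * (I₀ + (1 + Real.log ⌊x⌋₊) * (7 * κ + c * κ))) ≤
      x * (6 / S + 400 * ψ / ℓ + 384 * ψ ^ 2 * B / L + τ * (192 * ψ * I / L + 400 * (7 + c) * ψ * κ)) := by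
    intro B₀ I₀ hB' hI'
    calc _ ≤ (⌊x⌋₊ : ℝ) * (6 / S + 2 * S / ⌊Real.exp (L / ψ)⌋₊ + 2 * (192 * ψ / L) +
          2 * (192 * ψ / L) * B + ‖z‖ * (192 * ψ / L) * (I + (1 + Real.log ⌊x⌋₊) * (7 * κ + c * κ))) := by gcongr
      _ ≤ (⌊x⌋₊ : ℝ) * (6 / S + ψ / ℓ + 384 * ψ / ℓ + 384 * ψ ^ 2 * B / L +
          τ * (192 * ψ * I / L + 400 * (7 + c) * ψ * κ)) := by gcongr
      _ = (⌊x⌋₊ : ℝ) * (6 / S + 385 * ψ / ℓ + 384 * ψ ^ 2 * B / L +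
          τ * (192 * ψ * I / L + 400 * (7 + c) * ψ * κ)) := by ring
      _ ≤ _ := by
        gcongr
        · exact h.floor_le
        · norm_num
  refine le_trans (le_of_eq ?_) (key.trans (m5 _ _ (le_trans (le_of_eq ?_) hB) (le_trans (le_of_eq ?_) hI)))
  · refine sum_congr rfl fun n _ => ?_
    congr!
  · congr!
  · congr!

end TotalMeanValue

section CharacteristicFunctionLimit
open Finset Complex

lemma norm_prod_sub_prod_le_sum {ι : Type*} (s : Finset ι) (u v : ι → ℂ) (hu : ∀ i ∈ s, ‖u i‖ ≤ 1)
    (hv : ∀ i ∈ s, ‖v i‖ ≤ 1) : ‖∏ i ∈ s, u i - ∏ i ∈ s, v i‖ ≤ ∑ i ∈ s, ‖u i - v i‖ := by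
  classical
  induction s using Finset.induction_on with
  | empty => simp
  | insert p s hp ih =>
    rw [prod_insert hp, prod_insert hp, sum_insert hp]
    have e : u p * ∏ i ∈ s, u i - v p * ∏ i ∈ s, v i =
        u p * (∏ i ∈ s, u i - ∏ i ∈ s, v i) + (u p - v p) * ∏ i ∈ s, v i := by ring
    have h1 := ih (fun i hi => hu i (mem_insert_of_mem hi)) (fun i hi => hv i (mem_insert_of_mem hi))
    have h2 : ‖∏ i ∈ s, v i‖ ≤ 1 := by
      rw [norm_prod]
      exact prod_le_one (fun _ _ => norm_nonneg _) fun i hi => hv i (mem_insert_of_mem hi)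
    rw [e]
    refine (norm_add_le _ _).trans ?_
    rw [norm_mul, norm_mul]
    have h3 := mul_le_mul (hu p (mem_insert_self p s)) h1 (norm_nonneg _) zero_le_one
    have h4 := mul_le_mul_of_nonneg_left h2 (norm_nonneg (u p - v p))
    linarith

lemma norm_prod_one_add_sub_exp_le {z : ℂ} (hz : ‖1 + z‖ = 1) (hz1 : ‖z‖ ≤ 1) {𝒮 : Finset ℕ} {y : ℝ} (hy : 1 ≤ y)
    (h𝒮 : ∀ p ∈ 𝒮, y ≤ p) :
    ‖∏ p ∈ 𝒮, (1 + z / p) - cexp (z * (∑ p ∈ 𝒮, 1 / (p : ℝ) : ℝ))‖ ≤ (∑ p ∈ 𝒮, 1 / (p : ℝ)) / y := by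
  have hp0 : ∀ p ∈ 𝒮, (0 : ℝ) < p := fun p hp => by linarith [h𝒮 p hp]
  have e : cexp (z * (∑ p ∈ 𝒮, 1 / (p : ℝ) : ℝ)) = ∏ p ∈ 𝒮, cexp (z / p) := by
    rw [← Complex.exp_sum]
    congr 1
    push_cast
    rw [mul_sum]
    exact sum_congr rfl fun p _ => by ring
  have hre : z.re ≤ 0 := by
    have h1 := Complex.abs_re_le_norm (1 + z)
    rw [hz, Complex.add_re, Complex.one_re] at h1
    linarith [(abs_le.1 h1).2]
  rw [e]
  refine (norm_prod_sub_prod_le_sum _ _ _ (fun p hp => norm_one_add_div_le_one hz (by exact_mod_cast hp0 p hp))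
    (fun p hp => ?_)).trans ?_
  · rw [Complex.norm_exp, Real.exp_le_one_iff, Complex.div_natCast_re]
    exact div_nonpos_of_nonpos_of_nonneg hre (hp0 p hp).le
  · rw [sum_div]
    refine sum_le_sum fun p hp => ?_
    have h1 := hp0 p hp
    have h2 := h𝒮 p hp
    have h3 : ‖z / p‖ ≤ 1 / p := by
      rw [norm_div, Complex.norm_natCast]; gcongr
    have h4 : (1 : ℝ) / p ≤ 1 / y := one_div_le_one_div_of_le (by linarith) h2
    have h5 : (1 : ℝ) / y ≤ 1 := by rw [div_le_one (by linarith)]; exact hy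
    rw [norm_sub_rev, sub_add_eq_sub_sub]
    calc ‖cexp (z / p) - 1 - z / p‖ ≤ ‖z / p‖ ^ 2 := Complex.norm_exp_sub_one_sub_id_le (by linarith)
      _ ≤ 1 / p * (1 / y) := by
        rw [sq]; exact mul_le_mul h3 (h3.trans h4) (norm_nonneg _) (by positivity)
      _ = _ := by ring

lemma norm_exp_mul_I_sub_le {s : ℝ} (hs : |s| ≤ 1) :
    ‖cexp (s * I) - 1 - s * I + (s : ℂ) ^ 2 / 2‖ ≤ |s| ^ 3 := by
  have h0 : ‖(s : ℂ) * I‖ = |s| := by rw [norm_mul, Complex.norm_I, mul_one, Complex.norm_real, Real.norm_eq_abs]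
  have h := Complex.exp_bound (x := s * I) (by rw [h0]; exact hs) (n := 3) (by norm_num)
  rw [h0] at h
  have e : cexp (s * I) - 1 - s * I + (s : ℂ) ^ 2 / 2 =
      cexp (s * I) - ∑ m ∈ range 3, ((s : ℂ) * I) ^ m / (m.factorial : ℂ) := by
    have hI : ((s : ℂ) * I) ^ 2 = -(s : ℂ) ^ 2 := by rw [mul_pow, I_sq]; ring
    simp only [sum_range_succ, sum_range_zero, Nat.factorial, hI]
    push_cast
    ring
  rw [e]
  refine h.trans ?_
  have : (0 : ℝ) ≤ |s| ^ 3 := by positivity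
  norm_num [Nat.factorial]
  linarith

lemma tendsto_exp_exp_sub_one_mul {α : Type*} {F : Filter α} {q ρ : α → ℝ} (hq : Tendsto q F atTop)
    (hρ : Tendsto ρ F (nhds 0)) (t : ℝ) :
    Tendsto (fun x => cexp ((cexp ((t / q x : ℝ) * I) - 1) * (q x ^ 2 + ρ x * q x : ℝ) -
      ((t / q x : ℝ) * (q x ^ 2 : ℝ) : ℂ) * I)) F (nhds (cexp (-(t : ℂ) ^ 2 / 2))) := by
  refine (Complex.continuous_exp.tendsto _).comp ?_
  rw [tendsto_iff_norm_sub_tendsto_zero]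
  have hlim : Tendsto (fun x => |t| ^ 3 * ((q x)⁻¹ + |ρ x| * ((q x)⁻¹ * (q x)⁻¹)) + |t| * |ρ x| +
      t ^ 2 * |ρ x| * (q x)⁻¹) F (nhds 0) := by
    have hi : Tendsto (fun x => (q x)⁻¹) F (nhds 0) := tendsto_inv_atTop_zero.comp hq
    have ha : Tendsto (fun x => |ρ x|) F (nhds 0) := by simpa using hρ.abs
    have := (((hi.add (ha.mul (hi.mul hi))).const_mul (|t| ^ 3)).add (ha.const_mul |t|)).add
      ((ha.const_mul (t ^ 2)).mul hi)
    simpa using this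
  refine tendsto_of_tendsto_of_tendsto_of_le_of_le' tendsto_const_nhds hlim
    (Eventually.of_forall fun _ => norm_nonneg _) ?_
  filter_upwards [hq.eventually_ge_atTop (|t| + 1)] with x hx
  have hq0 : 0 < q x := by linarith [abs_nonneg t]
  obtain ⟨s, hs⟩ : ∃ s, s = t / q x := ⟨_, rfl⟩
  have hsq : s * q x = t := by rw [hs]; field_simp
  have hs1 : |s| ≤ 1 := by
    rw [hs, abs_div, abs_of_pos hq0, div_le_one hq0]; linarith
  have hsa : |s| = |t| * (q x)⁻¹ := by rw [hs, abs_div, abs_of_pos hq0, div_eq_mul_inv]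
  have e : (cexp ((t / q x : ℝ) * I) - 1) * (q x ^ 2 + ρ x * q x : ℝ) - ((t / q x : ℝ) * (q x ^ 2 : ℝ) : ℂ) * I -
      -(t : ℂ) ^ 2 / 2 = (cexp (s * I) - 1 - s * I + (s : ℂ) ^ 2 / 2) * (q x ^ 2 + ρ x * q x : ℝ) +
        (s * (ρ x * q x) : ℝ) * I - (s ^ 2 * (ρ x * q x) / 2 : ℝ) := by
    rw [← hs, ← hsq]; push_cast; ring
  rw [e]
  have n1 : ‖(cexp (s * I) - 1 - s * I + (s : ℂ) ^ 2 / 2) * (q x ^ 2 + ρ x * q x : ℝ)‖ ≤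
      |t| ^ 3 * ((q x)⁻¹ + |ρ x| * ((q x)⁻¹ * (q x)⁻¹)) := by
    rw [norm_mul, Complex.norm_real, Real.norm_eq_abs]
    have h1 : |q x ^ 2 + ρ x * q x| ≤ q x ^ 2 + |ρ x| * q x := by
      refine (abs_add_le _ _).trans (le_of_eq ?_)
      rw [abs_mul, abs_of_pos hq0, abs_of_pos (by positivity)]
    refine (mul_le_mul (norm_exp_mul_I_sub_le hs1) h1 (abs_nonneg _) (by positivity)).trans (le_of_eq ?_)
    rw [hsa]; field_simp
  have n2 : ‖((s * (ρ x * q x) : ℝ) : ℂ) * I‖ = |t| * |ρ x| := by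
    rw [norm_mul, Complex.norm_I, mul_one, Complex.norm_real, Real.norm_eq_abs, abs_mul, abs_mul, abs_of_pos hq0, hsa]
    field_simp
  have n3 : ‖((s ^ 2 * (ρ x * q x) / 2 : ℝ) : ℂ)‖ ≤ t ^ 2 * |ρ x| * (q x)⁻¹ := by
    rw [Complex.norm_real, Real.norm_eq_abs, abs_div, abs_mul, abs_mul, abs_of_pos hq0, abs_pow, hsa, mul_pow, sq_abs]
    have : t ^ 2 * (q x)⁻¹ ^ 2 * (|ρ x| * q x) = t ^ 2 * |ρ x| * (q x)⁻¹ := by field_simp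
    rw [this, abs_two]
    have : 0 ≤ t ^ 2 * |ρ x| * (q x)⁻¹ := by positivity
    linarith
  refine (norm_sub_le _ _).trans ?_
  have := norm_add_le ((cexp (s * I) - 1 - s * I + (s : ℂ) ^ 2 / 2) * (q x ^ 2 + ρ x * q x : ℝ))
    ((s * (ρ x * q x) : ℝ) * I)
  linarith

end CharacteristicFunctionLimit

section ErdosKac
open Finset Complex

lemma LogScale.norm_sum_pow_div_sub_exp_le {f a b : ℕ → ℤ}
    (hf0 : ∀ n : ℕ, 1 < n → f n ≠ 0) (ha0 : ∀ m : ℕ, 1 < m → a m ≠ 0) (hb0 : ∀ m : ℕ, 1 < m → b m ≠ 0)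
    (hrec : ∀ m : ℕ, 0 < m → ∀ P : ℕ, P.Prime → ¬ P ∣ m → f (m * P) = (P : ℤ) * a m + b m)
    {c : ℝ} (hc : 0 < c) (hfbd : ∀ m : ℕ, 1 < m → (|f m| : ℝ) ≤ (m : ℝ) ^ c)
    (habd : ∀ m : ℕ, 1 < m → (|a m| : ℝ) ≤ (m : ℝ) ^ c)
    (hbbd : ∀ m : ℕ, 1 < m → (|b m| : ℝ) ≤ (m : ℝ) ^ c)
    {x L ℓ κ ψ : ℝ} (h : LogScale x L ℓ κ ψ)
    {C : ℝ} (hC0 : ∀ v : ℝ, 2 ≤ v → |∑ p ∈ primesBetween 0 v, 1 / (p : ℝ) - Real.log (Real.log v)| ≤ C)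
    (hC : ∀ u v : ℝ, 2 ≤ u → u ≤ v →
      |∑ p ∈ primesBetween u v, 1 / (p : ℝ) - (Real.log (Real.log v) - Real.log (Real.log u))| ≤ C)
    (hCκ : C + c ≤ κ) {S : ℝ} (hS : ∑ P ∈ primesBetween (Real.exp (L / ψ)) x, 1 / (P : ℝ) = S)
    (hS1 : 1 ≤ S) {B I : ℝ}
    (hB : ∀ 𝒯 : Finset ℕ, (∀ p ∈ 𝒯, p.Prime ∧ L ^ 2 < p ∧ (p : ℝ) ≤ Real.exp (L / κ)) →
      ∑ m ∈ (Ioo 1 ⌊x⌋₊).filter (fun m => ∃ p ∈ 𝒯, (p : ℤ) ∣ a m ∧ (p : ℤ) ∣ b m), 1 / (m : ℝ) ≤ B)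
    (hI : ∑ p ∈ (range (⌊L ^ 2⌋₊ + 1)).filter Nat.Prime,
      ∑ m ∈ (Icc 1 ⌊x⌋₊).filter (fun m : ℕ => (p : ℤ) ∣ a m ∧ (p : ℤ) ∣ b m), (1 : ℝ) / m ≤ I)
    {z : ℂ} (hz : ‖1 + z‖ = 1) (hz1 : ‖z‖ ≤ 1) {τ : ℝ} (hzτ : ‖z‖ ≤ τ) {σ : ℝ}
    (hσ : ∑ p ∈ primesBetween (Real.exp (ℓ ^ 2)) (Real.exp (L / ℓ ^ 3)), 1 / (p : ℝ) = σ) :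
    ‖(∑ n ∈ Icc 2 ⌊x⌋₊, (1 + z) ^ #(f n).natAbs.primeFactors) / x - cexp (z * σ)‖ ≤
      8 / √S + 8 / S + (1000 + c) * ψ / ℓ + 384 * ψ ^ 2 * B / L +
      (6 / S + 400 * ψ / ℓ + 384 * ψ ^ 2 * B / L + τ * (192 * ψ * I / L + 400 * (7 + c) * ψ * κ)) +
      2 / x + 1 / ℓ := by
  have hL := h.le_L
  have hℓ := h.le_ℓ
  have hκ := h.le_κ
  have hx0 : 0 < x := by rw [← h.exp_L]; positivity
  have hx2 : 2 ≤ x := by rw [← h.exp_L]; linarith [Real.add_one_le_exp L]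
  have hX : 1 ≤ ⌊x⌋₊ := Nat.one_le_floor_iff x |>.2 (by linarith)
  obtain ⟨𝒮, h𝒮⟩ : ∃ 𝒮, 𝒮 = primesBetween (Real.exp (ℓ ^ 2)) (Real.exp (L / ℓ ^ 3)) := ⟨_, rfl⟩
  obtain ⟨𝒬, h𝒬⟩ : ∃ 𝒬, 𝒬 = primesBetween (L ^ 2) (Real.exp (L / κ)) := ⟨_, rfl⟩
  have hp𝒮 : ∀ p ∈ 𝒮, p.Prime ∧ L ^ 2 < p ∧ (p : ℝ) ≤ Real.exp (L / κ) := by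
    intro p hp
    rw [h𝒮, mem_primesBetween] at hp
    refine ⟨hp.1, lt_of_le_of_lt ?_ hp.2.1, hp.2.2.trans (Real.exp_le_exp.2 ?_)⟩
    · exact (pow_le_pow_right₀ (by linarith) (by norm_num)).trans h.pow_L_le
    · refine div_le_div_of_nonneg_left (by linarith) (by linarith) ?_
      have := h.mul_κ_le
      have := le_self_pow₀ (by linarith : 1 ≤ ℓ) (by norm_num : 3 ≠ 0)
      linarith
  have hp𝒬 : ∀ p ∈ 𝒬, p.Prime ∧ L ^ 2 < p ∧ (p : ℝ) ≤ Real.exp (L / κ) := by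
    intro p hp
    rwa [h𝒬, mem_primesBetween] at hp
  have k1 := h.sum_norm_pow_sub_pow_le hf0 hrec hc hfbd hC0 hC (by linarith) hS hS1 h𝒮 h𝒬 (hB 𝒬 hp𝒬) hI hz hzτ
  have k2 := h.norm_sum_sieved_le ha0 hb0 hrec hc habd hbbd hC hCκ hS hS1 h𝒮 (hB 𝒮 hp𝒮) hz hz1
  rw [← h𝒮] at hσ
  have k3 := norm_prod_one_add_sub_exp_le hz hz1 (y := Real.exp (ℓ ^ 2)) (Real.one_le_exp (by positivity))
    (𝒮 := 𝒮) (fun p hp => by rw [h𝒮, mem_primesBetween] at hp; exact hp.2.1.le)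
  rw [hσ] at k3
  have hσℓ : σ ≤ ℓ := by
    have := h.abs_sum_sieving_sub_le hC
    rw [← h𝒮, hσ] at this
    linarith [(abs_le.1 this).2]
  have k4 : σ / Real.exp (ℓ ^ 2) ≤ 1 / ℓ := by
    have := Real.add_one_le_exp (ℓ ^ 2)
    rw [div_le_div_iff₀ (Real.exp_pos _) (by linarith)]
    nlinarith
  obtain ⟨M, hM⟩ : ∃ M, M = ∏ p ∈ 𝒮, (1 + z / p) := ⟨_, rfl⟩
  rw [← hM] at k2 k3
  have hM1 : ‖M‖ ≤ 1 := by
    rw [hM, norm_prod]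
    exact prod_le_one (fun _ _ => norm_nonneg _) fun p hp =>
      norm_one_add_div_le_one hz (by exact_mod_cast (hp𝒮 p hp).1.pos)
  have hIcc : Icc 1 ⌊x⌋₊ = insert 1 (Icc 2 ⌊x⌋₊) := by
    ext n; simp only [mem_Icc, mem_insert]; omega
  have e : (∑ n ∈ Icc 2 ⌊x⌋₊, (1 + z) ^ #(f n).natAbs.primeFactors) - x * M =
      ∑ n ∈ Icc 2 ⌊x⌋₊, ((1 + z) ^ #(f n).natAbs.primeFactors - (1 + z) ^ #(𝒮.filter (fun p : ℕ => (p : ℤ) ∣ f n))) +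
      ∑ n ∈ Icc 1 ⌊x⌋₊, ((1 + z) ^ #(𝒮.filter (fun p : ℕ => (p : ℤ) ∣ f n)) - M) -
      (1 + z) ^ #(𝒮.filter (fun p : ℕ => (p : ℤ) ∣ f 1)) + ((⌊x⌋₊ : ℝ) - x : ℝ) * M := by
    have e1 : ∑ n ∈ Icc 1 ⌊x⌋₊, ((1 + z) ^ #(𝒮.filter (fun p : ℕ => (p : ℤ) ∣ f n)) - M) =
        (1 + z) ^ #(𝒮.filter (fun p : ℕ => (p : ℤ) ∣ f 1)) +
        ∑ n ∈ Icc 2 ⌊x⌋₊, (1 + z) ^ #(𝒮.filter (fun p : ℕ => (p : ℤ) ∣ f n)) - ⌊x⌋₊ * M := by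
      rw [sum_sub_distrib, sum_const, Nat.card_Icc, nsmul_eq_mul, Nat.add_sub_cancel, hIcc,
        sum_insert (by simp)]
    rw [e1, sum_sub_distrib]
    push_cast
    ring
  have n1 : ‖(1 + z) ^ #(𝒮.filter (fun p : ℕ => (p : ℤ) ∣ f 1))‖ = 1 := by rw [norm_pow, hz, one_pow]
  have n2 : ‖((⌊x⌋₊ : ℝ) - x : ℝ) * M‖ ≤ 1 := by
    rw [norm_mul, Complex.norm_real, Real.norm_eq_abs]
    refine mul_le_one₀ (abs_le.2 ⟨?_, ?_⟩) (norm_nonneg _) hM1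
    · linarith [Nat.lt_floor_add_one x]
    · linarith [h.floor_le]
  have n3 : ‖(∑ n ∈ Icc 2 ⌊x⌋₊, (1 + z) ^ #(f n).natAbs.primeFactors) - x * M‖ ≤
      x * (8 / √S + 8 / S + (1000 + c) * ψ / ℓ + 384 * ψ ^ 2 * B / L +
      (6 / S + 400 * ψ / ℓ + 384 * ψ ^ 2 * B / L + τ * (192 * ψ * I / L + 400 * (7 + c) * ψ * κ)) + 2 / x) := by
    rw [e]
    refine (norm_add_le _ _).trans ?_
    have t1 := norm_sub_le (∑ n ∈ Icc 2 ⌊x⌋₊, ((1 + z) ^ #(f n).natAbs.primeFactors -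
      (1 + z) ^ #(𝒮.filter (fun p : ℕ => (p : ℤ) ∣ f n))) +
      ∑ n ∈ Icc 1 ⌊x⌋₊, ((1 + z) ^ #(𝒮.filter (fun p : ℕ => (p : ℤ) ∣ f n)) - M))
      ((1 + z) ^ #(𝒮.filter (fun p : ℕ => (p : ℤ) ∣ f 1)))
    have t2 := norm_add_le (∑ n ∈ Icc 2 ⌊x⌋₊, ((1 + z) ^ #(f n).natAbs.primeFactors -
      (1 + z) ^ #(𝒮.filter (fun p : ℕ => (p : ℤ) ∣ f n))))
      (∑ n ∈ Icc 1 ⌊x⌋₊, ((1 + z) ^ #(𝒮.filter (fun p : ℕ => (p : ℤ) ∣ f n)) - M))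
    have t3 := norm_sum_le (Icc 2 ⌊x⌋₊) fun n => (1 + z) ^ #(f n).natAbs.primeFactors -
      (1 + z) ^ #(𝒮.filter (fun p : ℕ => (p : ℤ) ∣ f n))
    have t4 : x * (2 / x) = 2 := by field_simp
    rw [mul_add, mul_add, t4]
    linarith
  have n4 : ‖(∑ n ∈ Icc 2 ⌊x⌋₊, (1 + z) ^ #(f n).natAbs.primeFactors) / x - M‖ ≤
      8 / √S + 8 / S + (1000 + c) * ψ / ℓ + 384 * ψ ^ 2 * B / L +
      (6 / S + 400 * ψ / ℓ + 384 * ψ ^ 2 * B / L + τ * (192 * ψ * I / L + 400 * (7 + c) * ψ * κ)) + 2 / x := by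
    have hxc : (x : ℂ) ≠ 0 := by exact_mod_cast hx0.ne'
    rw [show (∑ n ∈ Icc 2 ⌊x⌋₊, (1 + z) ^ #(f n).natAbs.primeFactors) / x - M =
      ((∑ n ∈ Icc 2 ⌊x⌋₊, (1 + z) ^ #(f n).natAbs.primeFactors) - x * M) / x by field_simp,
      norm_div, Complex.norm_real, Real.norm_eq_abs, abs_of_pos hx0, div_le_iff₀' hx0]
    exact n3
  refine (norm_sub_le_norm_sub_add_norm_sub _ M _).trans ?_
  linarith

lemma tendsto_error_terms {L ℓ κ ψ S I : ℝ → ℝ} (h : ∀ᶠ x in atTop, LogScale x (L x) (ℓ x) (κ x) (ψ x))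
    (hψ : Tendsto ψ atTop atTop) (hS : Tendsto S atTop atTop)
    (hI : Tendsto (fun x => I x / (√(ℓ x) / ψ x * L x)) atTop (nhds 0)) (c C₁ C₂ t : ℝ) :
    Tendsto (fun x => 8 / √(S x) + 8 / S x + (1000 + c) * ψ x / ℓ x + 384 * ψ x ^ 2 * (C₁ * ℓ x ^ C₂) / L x +
      (6 / S x + 400 * ψ x / ℓ x + 384 * ψ x ^ 2 * (C₁ * ℓ x ^ C₂) / L x + |t| / √(ℓ x) *
      (192 * ψ x * I x / L x + 400 * (7 + c) * ψ x * κ x)) + 2 / x + 1 / ℓ x) atTop (nhds 0) := by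
  have hκ : Tendsto κ atTop atTop := (Real.tendsto_exp_atTop.comp hψ).congr' (by
    filter_upwards [h] with x hx using hx.exp_ψ)
  have hℓ : Tendsto ℓ atTop atTop := (Real.tendsto_exp_atTop.comp hκ).congr' (by
    filter_upwards [h] with x hx using hx.exp_κ)
  have d {g : ℝ → ℝ} (hg : Tendsto g atTop atTop) (k : ℝ) : Tendsto (fun x => k / g x) atTop (nhds 0) :=
    hg.const_div_atTop k
  have e1 := d (Real.tendsto_sqrt_atTop.comp hS) 8
  have hψκ : ∀ᶠ x in atTop, ψ x * κ x / √(ℓ x) ≤ κ x ^ (2 : ℝ) * Real.exp (-(1 / 2) * κ x) := by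
    filter_upwards [h] with x hx
    have := hx.le_κ
    have := hx.two_mul_ψ_le
    rw [← hx.exp_κ, ← Real.exp_half, div_eq_mul_inv, ← Real.exp_neg, Real.rpow_two,
      show -(1 / 2) * κ x = -(κ x / 2) by ring]
    gcongr
    nlinarith
  have hψκ0 : Tendsto (fun x => ψ x * κ x / √(ℓ x)) atTop (nhds 0) := by
    refine squeeze_zero' ?_ hψκ ((tendsto_rpow_mul_exp_neg_mul_atTop_nhds_zero 2 (1 / 2) (by norm_num)).comp hκ)
    filter_upwards [h] with x hx
    have := hx.le_κ
    have := hx.ten_le_ψ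
    positivity
  have hψℓ0 : Tendsto (fun x => ψ x / ℓ x) atTop (nhds 0) := by
    refine squeeze_zero' ?_ ?_ hψκ0
    · filter_upwards [h] with x hx
      have := hx.le_ℓ
      have := hx.ten_le_ψ
      positivity
    · filter_upwards [h] with x hx
      have := hx.le_ℓ
      have := hx.le_κ
      have := hx.ten_le_ψ
      have h1 : √(ℓ x) ≤ ℓ x := Real.sqrt_le_self_iff.2 (Or.inr (by linarith))
      have : 0 < √(ℓ x) := Real.sqrt_pos.2 (by linarith)
      gcongr
      nlinarith
  have hB0 : Tendsto (fun x => ψ x ^ 2 * ℓ x ^ C₂ / L x) atTop (nhds 0) := by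
    refine squeeze_zero' ?_ ?_ ((tendsto_rpow_mul_exp_neg_mul_atTop_nhds_zero (2 + C₂) 1 one_pos).comp hℓ)
    · filter_upwards [h] with x hx
      have := hx.le_ℓ
      have := hx.le_L
      positivity
    · filter_upwards [h] with x hx
      have := hx.le_ℓ
      have := hx.ψ_le_ℓ
      have := hx.ten_le_ψ
      simp only [Function.comp]
      rw [← hx.exp_ℓ, div_eq_mul_inv, ← Real.exp_neg, neg_one_mul, Real.rpow_add (by linarith), Real.rpow_two]
      gcongr
      linarith
  have hI0 : Tendsto (fun x => ψ x * I x / L x / √(ℓ x)) atTop (nhds 0) := by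
    refine hI.congr' ?_
    filter_upwards [h] with x hx
    have := hx.le_L
    have := hx.ten_le_ψ
    have : 0 < √(ℓ x) := Real.sqrt_pos.2 (by linarith [hx.le_ℓ])
    field_simp
  have := ((((((e1.add (d hS 8)).add (hψℓ0.const_mul (1000 + c))).add (hB0.const_mul (384 * C₁))).add
    ((((d hS 6).add (hψℓ0.const_mul 400)).add (hB0.const_mul (384 * C₁))).add
    ((hI0.const_mul (192 * |t|)).add (hψκ0.const_mul (400 * (7 + c) * |t|))))).add (d tendsto_id 2)).add (d hℓ 1))
  simp only [mul_zero, add_zero] at this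
  refine this.congr fun x => ?_
  simp only [Function.comp, id]
  ring

end ErdosKac

section ErdosKacLimit
open Finset Complex

lemma tendsto_charSum_of_norm_sub_le {w : ℕ → ℕ} {ℓ σ E : ℝ → ℝ} {t : ℝ} (hℓ : Tendsto ℓ atTop atTop)
    (hσ : Tendsto (fun x => (σ x - ℓ x) / √(ℓ x)) atTop (nhds 0)) (hE : Tendsto E atTop (nhds 0))
    (h : ∀ᶠ x : ℝ in atTop, ‖(∑ n ∈ Icc 2 ⌊x⌋₊, (1 + (cexp ((t / √(ℓ x) : ℝ) * I) - 1)) ^ w n) / x -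
      cexp ((cexp ((t / √(ℓ x) : ℝ) * I) - 1) * σ x)‖ ≤ E x) :
    Tendsto (fun x : ℝ => (∑ n ∈ Icc 2 ⌊x⌋₊, cexp (t * ((w n - ℓ x) / √(ℓ x) : ℝ) * I)) / (x : ℂ)) atTop
      (nhds (cexp (-(t : ℂ) ^ 2 / 2))) := by
  have hlim := tendsto_exp_exp_sub_one_mul (Real.tendsto_sqrt_atTop.comp hℓ) hσ t
  have hdiff : Tendsto (fun x : ℝ => (∑ n ∈ Icc 2 ⌊x⌋₊, cexp (t * ((w n - ℓ x) / √(ℓ x) : ℝ) * I)) / (x : ℂ) -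
      cexp ((cexp ((t / √(ℓ x) : ℝ) * I) - 1) * (√(ℓ x) ^ 2 + (σ x - ℓ x) / √(ℓ x) * √(ℓ x) : ℝ) -
      ((t / √(ℓ x) : ℝ) * (√(ℓ x) ^ 2 : ℝ) : ℂ) * I)) atTop (nhds 0) := by
    rw [tendsto_zero_iff_norm_tendsto_zero]
    refine squeeze_zero' (Eventually.of_forall fun _ => norm_nonneg _) ?_ hE
    filter_upwards [h, hℓ.eventually_gt_atTop 0] with x hx hℓx
    have hq : 0 < √(ℓ x) := Real.sqrt_pos.2 hℓx
    have e0 : √(ℓ x) ^ 2 + (σ x - ℓ x) / √(ℓ x) * √(ℓ x) = σ x := by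
      rw [Real.sq_sqrt hℓx.le, div_mul_cancel₀ _ hq.ne']; ring
    have e1 : ∀ n, cexp (t * ((w n - ℓ x) / √(ℓ x) : ℝ) * I) =
        cexp (-((t / √(ℓ x) * ℓ x : ℝ)) * I) * (1 + (cexp ((t / √(ℓ x) : ℝ) * I) - 1)) ^ w n := by
      intro n
      rw [add_sub_cancel, ← Complex.exp_nat_mul, ← Complex.exp_add]
      congr 1
      push_cast
      ring
    have e2 : (cexp ((cexp ((t / √(ℓ x) : ℝ) * I) - 1) * σ x -
        ((t / √(ℓ x) : ℝ) * (√(ℓ x) ^ 2 : ℝ) : ℂ) * I)) =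
        cexp (-((t / √(ℓ x) * ℓ x : ℝ)) * I) * cexp ((cexp ((t / √(ℓ x) : ℝ) * I) - 1) * σ x) := by
      rw [← Complex.exp_add, Real.sq_sqrt hℓx.le]
      congr 1
      push_cast
      ring
    have e3 : ‖cexp (-((t / √(ℓ x) * ℓ x : ℝ)) * I)‖ = 1 := by
      rw [← Complex.ofReal_neg, Complex.norm_exp_ofReal_mul_I]
    rw [e0, e2, sum_congr rfl fun n _ => e1 n, ← mul_sum, mul_div_assoc, ← mul_sub, norm_mul, e3, one_mul]
    exact hx
  simpa using hdiff.add hlim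

end ErdosKacLimit

/-- **General Erdős–Kac-type criterion** (Proposition 4.1 of the paper).
Suppose `f` is an integer-valued arithmetic function, nonzero for `n > 1`, with
`f(mP) = P·a(m) + b(m)` for all `m ≥ 1` and primes `P ∤ m`, where `a(m), b(m)` are
nonzero for `m > 1`, and `|f(n)| ≤ n^c`, `|a(m)|, |b(m)| ≤ m^c`. Say `m` is
`d`-compatible if every prime `p ∣ d` divides both or neither of `a(m), b(m)`, and
`d`-ideal if `gcd(d, a(m)·b(m)) = 1`. If
(i) `Σ_{p ≤ (log x)²} Σ_{m ≤ x, p ∣ a(m), p ∣ b(m)} 1/m = o((√(log₂ x)/log₄ x)·log x)`,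
and (ii) for each fixed `k ≥ 1`,
`Σ_d Σ_{1 < m < x, d-compatible, not d-ideal} gcd(d, a(m))/(m·d) ≤ (log₂ x)^{O(1)}`
(where `d` runs over squarefree integers with at most `k` prime factors, all in
`((log x)², x^{1/log₃ x}]`), then `ω(|f(n)|)` satisfies the Erdős–Kac law. -/
theorem erdosKac_general
    (f a b : ℕ → ℤ) (c : ℝ) (hc : 0 < c)
    (hf0 : ∀ n : ℕ, 1 < n → f n ≠ 0)
    (ha0 : ∀ m : ℕ, 1 < m → a m ≠ 0)
    (hb0 : ∀ m : ℕ, 1 < m → b m ≠ 0)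
    (hrec : ∀ m : ℕ, 0 < m → ∀ P : ℕ, P.Prime → ¬ P ∣ m →
      f (m * P) = (P : ℤ) * a m + b m)
    (hfbd : ∀ n : ℕ, 1 < n → (|f n| : ℝ) ≤ (n : ℝ) ^ c)
    (habd : ∀ m : ℕ, 1 < m → (|a m| : ℝ) ≤ (m : ℝ) ^ c)
    (hbbd : ∀ m : ℕ, 1 < m → (|b m| : ℝ) ≤ (m : ℝ) ^ c)
    (hi : Tendsto (fun x : ℝ =>
        (∑ p ∈ (Finset.range (⌊(Real.log x) ^ 2⌋₊ + 1)).filter Nat.Prime,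
          ∑ m ∈ (Finset.Icc 1 ⌊x⌋₊).filter
              (fun m : ℕ => (p : ℤ) ∣ a m ∧ (p : ℤ) ∣ b m), (1 : ℝ) / m)
          / ((Real.sqrt (Real.log (Real.log x)) /
                Real.log (Real.log (Real.log (Real.log x)))) * Real.log x))
      atTop (nhds 0))
    (hii : ∀ k : ℕ, 0 < k → ∃ C₁ C₂ : ℝ, 0 < C₁ ∧ 0 < C₂ ∧ ∀ᶠ x : ℝ in atTop,
      ∑ d ∈ (Finset.range (⌊x⌋₊ + 1)).filter (fun d : ℕ =>
          Squarefree d ∧ d.primeFactors.card ≤ k ∧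
          ∀ p ∈ d.primeFactors, (Real.log x) ^ 2 < (p : ℝ) ∧
            (p : ℝ) ≤ x ^ (1 / Real.log (Real.log (Real.log x)))),
        ∑ m ∈ (Finset.Ioo 1 ⌈x⌉₊).filter (fun m : ℕ =>
            (∀ p ∈ d.primeFactors,
              ((p : ℤ) ∣ a m ∧ (p : ℤ) ∣ b m) ∨ (¬ (p : ℤ) ∣ a m ∧ ¬ (p : ℤ) ∣ b m)) ∧
            Int.gcd (d : ℤ) (a m * b m) ≠ 1),
          (Int.gcd (d : ℤ) (a m) : ℝ) / (m * d)
        ≤ C₁ * (Real.log (Real.log x)) ^ C₂) :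
    ∀ u : ℝ, Tendsto (fun x : ℝ =>
      (((Finset.Icc 2 ⌊x⌋₊).filter (fun n : ℕ =>
        (((f n).natAbs.primeFactors.card : ℝ)) - Real.log (Real.log x)
          ≤ u * Real.sqrt (Real.log (Real.log x)))).card : ℝ) / x)
      atTop
      (nhds ((Real.sqrt (2 * Real.pi))⁻¹ * ∫ t in Set.Iic u, Real.exp (-t ^ 2 / 2))) := by
  intro u
  obtain ⟨C, -, hC0, hC⟩ := exists_abs_sum_inv_primesBetween_sub_le
  obtain ⟨C₁, C₂, -, -, hB⟩ := hii 1 one_pos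
  have hlog := Real.tendsto_log_atTop
  have hℓ := hlog.comp hlog
  have hκ := hlog.comp hℓ
  have hψ := hlog.comp hκ
  have hscale := eventually_logScale
  have hS : Tendsto (fun x : ℝ => ∑ P ∈ primesBetween (Real.exp (Real.log x /
      Real.log (Real.log (Real.log (Real.log x))))) x, 1 / (P : ℝ)) atTop atTop := by
    refine tendsto_atTop_mono' atTop ?_ (tendsto_atTop_add_const_right atTop (-C) (hlog.comp hψ))
    filter_upwards [hscale] with x h
    have := (abs_le.1 (h.abs_sum_averaging_sub_le hC)).1
    simp only [Function.comp]
    linarith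
  have hσ : Tendsto (fun x : ℝ => (∑ p ∈ primesBetween (Real.exp (Real.log (Real.log x) ^ 2))
      (Real.exp (Real.log x / Real.log (Real.log x) ^ 3)), 1 / (p : ℝ) - Real.log (Real.log x)) /
      √(Real.log (Real.log x))) atTop (nhds 0) := by
    refine squeeze_zero_norm' (a := fun x : ℝ => 6 * (Real.log (Real.log (Real.log x)) /
      √(Real.log (Real.log x)))) ?_ ?_
    · filter_upwards [hscale, hκ.eventually_ge_atTop C] with x h hCx
      have h1 := abs_le.1 (h.abs_sum_sieving_sub_le hC)
      simp only [Function.comp] at hCx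
      have h2 := h.le_κ
      rw [Real.norm_eq_abs, abs_div, abs_of_nonneg (Real.sqrt_nonneg _), ← mul_div_assoc]
      refine div_le_div_of_nonneg_right (abs_le.2 ⟨?_, ?_⟩) (Real.sqrt_nonneg _) <;> linarith
    · have h1 := (isLittleO_log_rpow_atTop (by norm_num : (0 : ℝ) < 1 / 2)).tendsto_div_nhds_zero.comp hℓ
      simpa [Function.comp_def, Real.sqrt_eq_rpow] using h1.const_mul 6
  have hG := tendsto_card_le_of_tendsto_charSum
    (fun x n => (((f n).natAbs.primeFactors.card : ℝ) - Real.log (Real.log x)) / √(Real.log (Real.log x)))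
    (fun t => ?_) u
  · refine hG.congr' ?_
    filter_upwards [hℓ.eventually_gt_atTop 0] with x hx
    simp only [Function.comp] at hx
    simp only [div_le_iff₀ (Real.sqrt_pos.2 hx)]
  · refine tendsto_charSum_of_norm_sub_le (w := fun n => (f n).natAbs.primeFactors.card) hℓ hσ
      (tendsto_error_terms hscale hψ hS hi c C₁ C₂ t) ?_
    filter_upwards [hscale, hκ.eventually_ge_atTop (C + c), hS.eventually_ge_atTop 1, hB,
      (Real.tendsto_sqrt_atTop.comp hℓ).eventually_ge_atTop (|t| + 1)] with x h hCx hSx hBx htx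
    have hq : 0 < √(Real.log (Real.log x)) := by
      simp only [Function.comp] at htx
      linarith [abs_nonneg t]
    have hz : ‖1 + (Complex.exp ((t / √(Real.log (Real.log x)) : ℝ) * Complex.I) - 1)‖ = 1 := by
      rw [add_sub_cancel, Complex.norm_exp_ofReal_mul_I]
    have hzτ : ‖Complex.exp ((t / √(Real.log (Real.log x)) : ℝ) * Complex.I) - 1‖ ≤
        |t| / √(Real.log (Real.log x)) := by
      rw [mul_comm]
      refine (Real.norm_exp_I_mul_ofReal_sub_one_le (x := t / √(Real.log (Real.log x)))).trans (le_of_eq ?_)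
      rw [Real.norm_eq_abs, abs_div, abs_of_pos hq]
    have hτ1 : |t| / √(Real.log (Real.log x)) ≤ 1 := by
      simp only [Function.comp] at htx
      rw [div_le_one hq]
      linarith
    have hL := h.le_L
    have hκ' := h.le_κ
    have hx1 : 1 ≤ x := by rw [← h.exp_L]; exact Real.one_le_exp (by linarith)
    have hw : Real.exp (Real.log x / Real.log (Real.log (Real.log x))) =
        x ^ (1 / Real.log (Real.log (Real.log x))) := by
      rw [Real.rpow_def_of_pos (by linarith), mul_one_div]
    refine h.norm_sum_pow_div_sub_exp_le hf0 ha0 hb0 hrec hc hfbd habd hbbd hC0 hC hCx rfl hSx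
      (fun 𝒯 h𝒯 => ?_) le_rfl hz (hzτ.trans hτ1) hzτ rfl
    refine (sum_inv_filter_exists_dvd_le a b (w := x ^ (1 / Real.log (Real.log (Real.log x)))) ?_
      (y := Real.log x ^ 2) (fun p hp => hw ▸ h𝒯 p hp)).trans hBx
    refine (Real.rpow_le_rpow_of_exponent_le hx1 ?_).trans (Real.rpow_one x).le
    rw [div_le_one (by linarith)]
    linarith
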